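/- Let p be a prime, k a finite field extension of ℚ_p, and K an ARBITRARY field extension of k. Then for every birational Galois section s : Gal_k → Gal_K there exists a valuation subring Ō of K̄ with k ⊆ Ō such that s(Gal_k) is contained in the decomposition subgroup D_Ō and the valuation subring Ō ∩ K of K has residue field k. -/

import Mathlib

/-!
Birational p-adic Galois sections: every birational Galois section for an arbitrary
field extension `K/k` of a `p`-adic local field `k` has image in the decomposition
subgroup of a `k`-valuation of `K̄` whose restriction to `K` has residue field `k`.

Setup: `Kbar` is an algebraic closure of `K`, `kbar := algebraicClosure k Kbar` is the
algebraic closure of `k` inside `Kbar`, `Gal_K := Kbar ≃ₐ[K] Kbar`,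
`Gal_k := kbar ≃ₐ[k] kbar`, both with the Krull topology, and
`resHom : Gal_K →* Gal_k` is the restriction homomorphism.
-/

/-- The restriction homomorphism `Gal(Kbar/F) →* Gal(kbar/k)`, where
`kbar = algebraicClosure k Kbar` is the relative algebraic closure of `k` in `Kbar`. -/
noncomputable def resHom (k F Kbar : Type*) [Field k] [Field F] [Field Kbar]
    [Algebra k F] [Algebra F Kbar] [Algebra k Kbar] [IsScalarTower k F Kbar]
    [IsAlgClosed Kbar] :
    (Kbar ≃ₐ[F] Kbar) →* ((algebraicClosure k Kbar) ≃ₐ[k] (algebraicClosure k Kbar)) :=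
  (AlgEquiv.restrictNormalHom (F := k) (K₁ := Kbar) (algebraicClosure k Kbar)).comp
    { toFun := fun σ => σ.restrictScalars k
      map_one' := rfl
      map_mul' := fun _ _ => rfl }

/-- The composite `k → O → O/m_O` from `k` to the residue field of a valuation subring `O`
of a field extension `K` of `k` containing (the image of) `k`. -/
noncomputable def residueEmbed {k K : Type*} [Field k] [Field K] [Algebra k K]
    (O : ValuationSubring K) (h : ∀ a : k, algebraMap k K a ∈ O) :
    k → IsLocalRing.ResidueField O :=
  fun a => IsLocalRing.residue O ⟨algebraMap k K a, h a⟩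

section ResidualHom

variable {F M : Type*} [Field F] [CommGroupWithZero M]

/-- A multiplicative map `f` is *residually rigid* if `f (1 + x)` is one of `1`, `f x` whenever
`x ≠ 0` and `f x ≠ 1`, and the kernel of `f` contains `-1` and is closed under square roots. -/
structure IsRigidHom (f : F →*₀ M) : Prop where
  map_neg_one : f (-1) = 1
  sq : ∀ x, f x ^ 2 = 1 → f x = 1
  one_add : ∀ x, x ≠ 0 → f x ≠ 1 → f (1 + x) = 1 ∨ f (1 + x) = f x

/-- The elements `x` with nontrivial class that are dominated by `1`. -/
def RigidSmall (f : F →*₀ M) (x : F) : Prop := x ≠ 0 ∧ f x ≠ 1 ∧ f (1 + x) = 1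

/-- The elements that are products of at most two elements of `RigidSmall f`. -/
def RigidMax (f : F →*₀ M) (x : F) : Prop :=
  RigidSmall f x ∨ ∃ g h, RigidSmall f g ∧ RigidSmall f h ∧ x = g * h

namespace IsRigidHom

variable {f : F →*₀ M} (hf : IsRigidHom f)
include hf

lemma map_neg (x : F) : f (-x) = f x := by
  rw [neg_eq_neg_one_mul, map_mul, hf.map_neg_one, one_mul]

omit hf in
lemma ne0 {x : F} (hx : x ≠ 0) : f x ≠ 0 := (map_ne_zero f).2 hx

lemma add {x y : F} (hx : x ≠ 0) (hy : y ≠ 0) (h : f x ≠ f y) :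
    f (x + y) = f x ∨ f (x + y) = f y := by
  have hfx := ne0 (f := f) hx
  have e : x + y = x * (1 + y / x) := by field_simp
  rcases hf.one_add (y / x) (div_ne_zero hy hx) (by
    rw [map_div₀]; intro h1; exact h ((div_eq_one_iff_eq hfx).1 h1).symm) with h1 | h1
  · left; rw [e, map_mul, h1, mul_one]
  · right; rw [e, map_mul, h1, map_div₀]; field_simp

lemma sq_ne_one {x : F} (h : f x ≠ 1) : f (x ^ 2) ≠ 1 := by
  rw [map_pow]; exact fun h1 => h (hf.sq x h1)

omit hf in
lemma ne_sq {x : F} (hx : x ≠ 0) (h : f x ≠ 1) : f x ≠ f (x ^ 2) := by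
  intro h1
  rw [pow_two, map_mul] at h1
  exact h (mul_left_cancel₀ (ne0 hx) (by rw [mul_one]; exact h1.symm))

lemma neg_small {x : F} (h : RigidSmall f x) : RigidSmall f (-x) := by
  obtain ⟨h0, h1, h2⟩ := h
  refine ⟨neg_ne_zero.2 h0, by rwa [hf.map_neg], ?_⟩
  by_contra h3
  have h4 := (hf.one_add (-x) (neg_ne_zero.2 h0) (by rwa [hf.map_neg])).resolve_left h3
  have h5 : f (1 + -x ^ 2) = f x := by
    rw [show 1 + -x ^ 2 = (1 + x) * (1 + -x) by ring, map_mul, h2, h4, hf.map_neg, one_mul]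
  rcases hf.one_add (-x ^ 2) (neg_ne_zero.2 (pow_ne_zero 2 h0))
    (by rw [hf.map_neg]; exact hf.sq_ne_one h1) with h6 | h6
  · exact h1 (h5.symm.trans h6)
  · rw [h5, hf.map_neg] at h6
    exact ne_sq h0 h1 h6

lemma small_or_inv {x : F} (hx : x ≠ 0) (h : f x ≠ 1) :
    RigidSmall f x ∨ RigidSmall f x⁻¹ := by
  rcases hf.one_add x hx h with h1 | h1
  · exact Or.inl ⟨hx, h, h1⟩
  · refine Or.inr ⟨inv_ne_zero hx, by rw [map_inv₀]; simpa using h, ?_⟩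
    rw [show 1 + x⁻¹ = (1 + x) / x by field_simp; ring, map_div₀, h1, div_self (ne0 hx)]

omit hf in
lemma not_small_inv {x : F} (h : RigidSmall f x) : ¬ RigidSmall f x⁻¹ := by
  rintro ⟨-, -, h3⟩
  obtain ⟨h0, h1, h2⟩ := h
  rw [show 1 + x⁻¹ = (1 + x) / x by field_simp; ring, map_div₀, h2] at h3
  exact h1 (by simpa using h3)

lemma trans {a b c : F} (ha : a ≠ 0) (hb : b ≠ 0) (hc : c ≠ 0) (hab : f a ≠ f b) (hbc : f b ≠ f c)
    (hac : f a ≠ f c) (h1 : f (a + b) = f a) (h2 : f (b + c) = f b) : f (a + c) = f a := by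
  have nz : ∀ {x y : F}, x ≠ 0 → f y = f x → y ≠ 0 := fun hx h => by
    rw [← map_ne_zero f, h]; exact ne0 hx
  have e1 := hf.add (nz ha h1) hc (by rwa [h1])
  have e2 := hf.add ha (nz hb h2) (by rwa [h2])
  rw [h1] at e1
  rw [h2, ← add_assoc] at e2
  have e3 : f (a + b + c) = f a := by grind
  by_contra h3
  have h4 := (hf.add ha hc hac).resolve_left h3
  have e4 := hf.add (nz hc h4) hb (by rw [h4]; exact hbc.symm)
  rw [add_right_comm, e3, h4] at e4
  grind

lemma small_mul {b c : F} (hb : RigidSmall f b) (hc : RigidSmall f c) (h : f (b * c) ≠ 1) :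
    RigidSmall f (b * c) := by
  obtain ⟨b0, b1, b2⟩ := hb
  obtain ⟨c0, c1, c2⟩ := hc
  refine ⟨mul_ne_zero b0 c0, h, ?_⟩
  have := hf.trans (a := 1) (b := b) (c := b * c) one_ne_zero b0 (mul_ne_zero b0 c0)
    (by rw [map_one]; exact b1.symm) (by
      rw [map_mul]; intro h1
      exact c1 (mul_left_cancel₀ (ne0 b0) (by rw [mul_one]; exact h1.symm)))
    (by rw [map_one]; exact h.symm) (by rwa [map_one])
    (by rw [show b + b * c = b * (1 + c) by ring, map_mul, c2, mul_one])
  rwa [map_one] at this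

lemma one_add_add {b c : F} (hb : RigidSmall f b) (hc : RigidSmall f c) : f (1 + b + c) = 1 := by
  obtain ⟨b0, b1, b2⟩ := id hb
  obtain ⟨c0, c1, c2⟩ := id hc
  have nz : ∀ {y : F}, f y = 1 → y ≠ 0 := fun h => by
    rw [← map_ne_zero f, h]; exact one_ne_zero
  have e1 := hf.add (nz b2) c0 (by rw [b2]; exact c1.symm)
  have e2 := hf.add (nz c2) b0 (by rw [c2]; exact b1.symm)
  rw [b2] at e1
  rw [c2, add_right_comm] at e2
  by_cases h : f b = f c
  · have hbc : f (b * c) = f (b ^ 2) := by rw [map_mul, ← h, pow_two, map_mul]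
    have h1 : f (b * c) ≠ 1 := hbc ▸ hf.sq_ne_one b1
    have e3 := hf.add (x := (1 + b) * (1 + c)) (y := -(b * c)) (mul_ne_zero (nz b2) (nz c2))
      (neg_ne_zero.2 (mul_ne_zero b0 c0)) (by
        rw [map_mul, b2, c2, hf.map_neg, mul_one]; exact h1.symm)
    rw [show (1 + b) * (1 + c) + -(b * c) = 1 + b + c by ring, map_mul (x := 1 + b), b2, c2,
      mul_one, hf.map_neg, hbc] at e3
    have := ne_sq b0 b1
    grind
  · grind

lemma small_div {a g : F} (ha : RigidSmall f a) (hg : RigidSmall f g) :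
    RigidSmall f (a / (1 + g)) := by
  have h := hf.one_add_add hg ha
  obtain ⟨a0, a1, a2⟩ := ha
  obtain ⟨g0, g1, g2⟩ := hg
  have nz : 1 + g ≠ 0 := by rw [← map_ne_zero f, g2]; exact one_ne_zero
  refine ⟨div_ne_zero a0 nz, by rwa [map_div₀, g2, div_one], ?_⟩
  rw [show 1 + a / (1 + g) = (1 + g + a) / (1 + g) by field_simp, map_div₀, h, g2, div_one]

lemma small_mul_one_add {a g : F} (ha : RigidSmall f a) (hg : RigidSmall f g) :
    RigidSmall f (a * (1 + g)) := by
  have nz : 1 + g ≠ 0 := by rw [← map_ne_zero f, hg.2.2]; exact one_ne_zero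
  have := hf.small_div ha (hf.neg_small (hf.small_div hg hg))
  rwa [show 1 + -(g / (1 + g)) = (1 + g)⁻¹ by field_simp; ring, div_inv_eq_mul] at this

lemma small_div_of_mul {g h : F} (hg : RigidSmall f g) (hh : RigidSmall f h) :
    RigidSmall f (h / (1 - g * h)) := by
  have h1 := hf.small_mul_one_add hh (hf.neg_small hg)
  have h2 := hf.small_div hh h1
  have h3 := hf.small_div h2 (hf.neg_small h2)
  have nz : 1 + h * (1 + -g) ≠ 0 := by
    rw [← map_ne_zero f, h1.2.2]; exact one_ne_zero
  have e : h / (1 + h * (1 + -g)) / (1 + -(h / (1 + h * (1 + -g)))) = h / (1 - g * h) := by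
    rw [div_div, mul_add, mul_one, mul_neg, mul_div_cancel₀ _ nz]
    congr 1; ring
  rwa [e] at h3

lemma max_of_three {a b c : F} (ha : RigidSmall f a) (hb : RigidSmall f b)
    (hc : RigidSmall f c) : RigidMax f (a * b * c) := by
  by_cases h1 : f (a * b) = 1
  · by_cases h2 : f (b * c) = 1
    · have h3 : f (a * c) ≠ 1 := by
        intro h3
        rw [map_mul] at h1 h2 h3
        apply ha.2.1
        apply hf.sq
        calc f a ^ 2 = (f a * f b) * (f a * f c) / (f b * f c) := by
              have := ne0 (f := f) hb.1
              have := ne0 (f := f) hc.1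
              field_simp
          _ = 1 := by rw [h1, h2, h3]; simp
      exact Or.inr ⟨_, _, hf.small_mul ha hc h3, hb, by ring⟩
    · exact Or.inr ⟨_, _, ha, hf.small_mul hb hc h2, by ring⟩
  · exact Or.inr ⟨_, _, hf.small_mul ha hb h1, hc, rfl⟩

lemma max_mul_small {a b : F} (ha : RigidMax f a) (hb : RigidSmall f b) : RigidMax f (a * b) := by
  rcases ha with ha | ⟨g, h, hg, hh, rfl⟩
  · exact Or.inr ⟨_, _, ha, hb, rfl⟩
  · exact hf.max_of_three hg hh hb

lemma max_mul {a b : F} (ha : RigidMax f a) (hb : RigidMax f b) : RigidMax f (a * b) := by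
  rcases hb with hb | ⟨g, h, hg, hh, rfl⟩
  · exact hf.max_mul_small ha hb
  · rw [← mul_assoc]; exact hf.max_mul_small (hf.max_mul_small ha hg) hh

omit hf in
lemma max_ne_zero {a : F} (ha : RigidMax f a) : a ≠ 0 := by
  rcases ha with ha | ⟨g, h, hg, hh, rfl⟩
  exacts [ha.1, mul_ne_zero hg.1 hh.1]

omit hf in
lemma not_max_one : ¬ RigidMax f (1 : F) := by
  rintro (h | ⟨g, h, hg, hh, e⟩)
  · exact h.2.1 (map_one f)
  · rw [(eq_inv_of_mul_eq_one_right e.symm : h = g⁻¹)] at hh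
    exact not_small_inv hg hh

lemma max_neg {a : F} (ha : RigidMax f a) : RigidMax f (-a) := by
  rcases ha with ha | ⟨g, h, hg, hh, rfl⟩
  exacts [Or.inl (hf.neg_small ha), Or.inr ⟨_, _, hf.neg_small hg, hh, by ring⟩]

lemma not_max_inv {a : F} (ha : RigidMax f a) : ¬ RigidMax f a⁻¹ := fun h => by
  have := hf.max_mul ha h
  rw [mul_inv_cancel₀ (max_ne_zero ha)] at this
  exact not_max_one this

lemma small_of_not_max_inv {x : F} (hx : x ≠ 0) (h : f x ≠ 1) (h' : ¬ RigidMax f x⁻¹) :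
    RigidSmall f x := (hf.small_or_inv hx h).resolve_right fun h1 => h' (Or.inl h1)

lemma not_max_mul {x y : F} (hx : ¬ RigidMax f x⁻¹) (hy : ¬ RigidMax f y⁻¹) :
    ¬ RigidMax f (x * y)⁻¹ := by
  intro h
  have h0 := max_ne_zero h
  have x0 : x ≠ 0 := by rintro rfl; simp at h0
  have y0 : y ≠ 0 := by rintro rfl; simp at h0
  by_cases fx : f x = 1
  · by_cases fy : f y = 1
    · rcases h with h | ⟨g, h, hg, hh, e⟩
      · apply h.2.1; rw [map_inv₀, map_mul, fx, fy]; simp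
      · rcases hf.small_or_inv (x := x * g) (mul_ne_zero x0 hg.1)
          (by rw [map_mul, fx, one_mul]; exact hg.2.1) with h1 | h1
        · apply hy
          rw [show y⁻¹ = x * g * h by rw [mul_assoc, ← e]; field_simp]
          exact Or.inr ⟨_, _, h1, hh, rfl⟩
        · apply hx
          have := hg.1
          rw [show x⁻¹ = (x * g)⁻¹ * g by field_simp]
          exact Or.inr ⟨_, _, h1, hg, rfl⟩
    · have := hf.max_mul_small h (hf.small_of_not_max_inv y0 fy hy)
      rw [show (x * y)⁻¹ * y = x⁻¹ by field_simp] at this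
      exact hx this
  · have := hf.max_mul_small h (hf.small_of_not_max_inv x0 fx hx)
    rw [show (x * y)⁻¹ * x = y⁻¹ by field_simp] at this
    exact hy this

lemma not_max_one_add {x : F} (hx : ¬ RigidMax f x⁻¹) : ¬ RigidMax f (1 + x)⁻¹ := by
  by_cases x0 : x = 0
  · subst x0; simpa using not_max_one
  intro h
  apply hx
  have h0 : 1 + x ≠ 0 := fun h1 => max_ne_zero h (by rw [h1, inv_zero])
  have e : x⁻¹ = (1 + x)⁻¹ / (1 - (1 + x)⁻¹) := by
    have : (1 + x) - 1 ≠ 0 := by simpa using x0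
    field_simp
    ring
  rw [e]
  rcases h with h | ⟨g, h, hg, hh, e'⟩
  · rw [sub_eq_add_neg]; exact Or.inl (hf.small_div h (hf.neg_small h))
  · rw [e', mul_div_assoc]
    exact Or.inr ⟨_, _, hg, hf.small_div_of_mul hg hh, rfl⟩

/-- The valuation ring attached to a rigid multiplicative map. -/
def valuationSubring : ValuationSubring F where
  carrier := {x | ¬ RigidMax f x⁻¹}
  mul_mem' := hf.not_max_mul
  one_mem' := by simpa using not_max_one
  add_mem' := by
    intro x y hx hy
    wlog h : ¬ RigidMax f (y / x)⁻¹ generalizing x y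
    · rw [add_comm]
      refine this hy hx fun h1 => ?_
      rw [inv_div] at h1 h
      exact hf.not_max_inv h1 (by rw [inv_div]; exact not_not.1 h)
    by_cases x0 : x = 0
    · subst x0; simpa using hy
    rw [show x + y = x * (1 + y / x) by field_simp]
    exact hf.not_max_mul hx (hf.not_max_one_add h)
  zero_mem' := fun h => max_ne_zero h (by simp)
  neg_mem' := fun {x} hx h => hx (by rw [inv_neg] at h; simpa using hf.max_neg h)
  mem_or_inv_mem' := fun x => by
    by_contra! h
    simp only [Set.mem_ofPred_eq, not_not, inv_inv] at h
    exact hf.not_max_inv h.2 h.1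

lemma mem_valuationSubring {x : F} : x ∈ hf.valuationSubring ↔ ¬ RigidMax f x⁻¹ := Iff.rfl

end IsRigidHom

end ResidualHom

section Collinear

variable {F 𝔽 V : Type*} [Field F] [Field 𝔽] [AddCommGroup V] [Module 𝔽 V]

/-- `f y` is the point of the affine plane `{(v, 1)}` represented by the vector `q`. -/
def Represents (f : F → V) (y : F) (q : V × 𝔽) : Prop :=
  y ≠ 0 ∧ ∃ c : 𝔽, c ≠ 0 ∧ q = c • (f y, (1 : 𝔽))

/-- Linear independence of three vectors. -/
def TripleIndep (𝔽 : Type*) {W : Type*} [Field 𝔽] [AddCommGroup W] [Module 𝔽 W] (u v w : W) :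
    Prop :=
  ∀ a b c : 𝔽, a • u + b • v + c • w = 0 → a = 0 ∧ b = 0 ∧ c = 0

lemma Represents.ne_of_indep {f : F → V} {y z : F} {q r : V × 𝔽} (hy : Represents f y q)
    (hz : Represents f z r) (h : ∀ a b : 𝔽, a • q + b • r = 0 → a = 0) : f y ≠ f z := by
  obtain ⟨-, c, hc, rfl⟩ := hy
  obtain ⟨-, d, hd, rfl⟩ := hz
  intro e
  refine hd (h d (-c) ?_)
  rw [e]
  module

lemma Represents.add_of_col {f : F → V}
    (hcol : ∀ x y, x ≠ 0 → y ≠ 0 → x + y ≠ 0 → f x ≠ f y →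
      ∃ i : 𝔽, f (x + y) = i • f x + (1 - i) • f y) {y z : F} {q r : V × 𝔽}
    (hy : Represents f y q) (hz : Represents f z r) (h0 : y + z ≠ 0)
    (h : ∀ a b : 𝔽, a • q + b • r = 0 → a = 0) :
    ∃ a b : 𝔽, (f (y + z), (1 : 𝔽)) = a • q + b • r := by
  obtain ⟨i, hi⟩ := hcol y z hy.1 hz.1 h0 (hy.ne_of_indep hz h)
  obtain ⟨-, c, hc, rfl⟩ := hy
  obtain ⟨-, d, hd, rfl⟩ := hz
  refine ⟨i / c, (1 - i) / d, ?_⟩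
  rw [smul_smul, smul_smul, div_mul_cancel₀ _ hc, div_mul_cancel₀ _ hd, hi]
  ext <;> simp

lemma Represents.add {f : F → V}
    (hcol : ∀ x y, x ≠ 0 → y ≠ 0 → x + y ≠ 0 → f x ≠ f y →
      ∃ i : 𝔽, f (x + y) = i • f x + (1 - i) • f y) {y₁ y₂ y₃ y₄ : F} {q₁ q₂ q₃ q₄ : V × 𝔽}
    (h₁ : Represents f y₁ q₁) (h₂ : Represents f y₂ q₂) (h₃ : Represents f y₃ q₃)
    (h₄ : Represents f y₄ q₄) (h0 : y₁ + y₂ ≠ 0) (hy : y₁ + y₂ = y₃ + y₄)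
    (hq : q₁ + q₂ = q₃ + q₄) (hi : TripleIndep 𝔽 q₁ q₂ q₃) :
    Represents f (y₁ + y₂) (q₁ + q₂) := by
  obtain ⟨a, b, e₁⟩ := h₁.add_of_col hcol h₂ h0 fun a b h => (hi a b 0 (by rw [h]; simp)).1
  obtain rfl : q₄ = q₁ + q₂ - q₃ := by rw [hq]; abel
  obtain ⟨c, d, e₂⟩ := h₃.add_of_col hcol h₄ (hy ▸ h0) fun a b h => by
    obtain ⟨h1, h2, h3⟩ := hi b b (a - b) (by rw [← h]; module)
    simpa [h1] using h3
  rw [← hy, e₁] at e₂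
  obtain ⟨h1, h2, h3⟩ := hi (a - d) (b - d) (d - c) (by
    rw [← sub_eq_zero] at e₂; rw [← e₂]; module)
  have ea : a = d := sub_eq_zero.1 h1
  have eb : b = d := sub_eq_zero.1 h2
  subst ea
  subst eb
  have hb : b ≠ 0 := by
    rintro rfl
    have := congrArg Prod.snd e₁
    simp at this
  refine ⟨h0, b⁻¹, inv_ne_zero hb, ?_⟩
  rw [e₁, ← smul_add, smul_smul, inv_mul_cancel₀ hb, one_smul]

/-- If `f` maps sums to points on the line spanned by the summands then `f (1 + x)` and
`f (1 + z)` cannot both be interior points of the respective lines. -/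
theorem false_of_collinear {f : F → V}
    (hneg : ∀ x, f (-x) = f x) (h1 : f 1 = 0)
    (hcol : ∀ x y, x ≠ 0 → y ≠ 0 → x + y ≠ 0 → f x ≠ f y →
      ∃ i : 𝔽, f (x + y) = i • f x + (1 - i) • f y)
    {x z : F} {l m : 𝔽} (hl : f (x + 1) = l • f x) (hm : f (1 + z) = m • f z)
    (l0 : l ≠ 0) (l1 : l ≠ 1) (m0 : m ≠ 0) (m1 : m ≠ 1)
    (hind : ∀ a b : 𝔽, a • f x + b • f z = 0 → a = 0 ∧ b = 0)
    (x0 : x ≠ 0) (z0 : z ≠ 0) (z1 : 1 + z ≠ 0) (xz : x + z ≠ 0)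
    (nx : ∀ n : ℕ, n • x + 1 ≠ 0) (nxz : ∀ n : ℕ, n • x + 1 + z ≠ 0)
    (hn : ∃ n : ℕ, (n : 𝔽) * l = l - 1) : False := by
  have l1' : 1 - l ≠ 0 := sub_ne_zero.2 l1.symm
  have m1' : 1 - m ≠ 0 := sub_ne_zero.2 m1.symm
  set ν : 𝔽 := m * (1 - l) / (1 - m) with hν
  have ν0 : ν ≠ 0 := div_ne_zero (mul_ne_zero m0 l1') m1'
  set X : V × 𝔽 := l • (f x, 1) with hX
  set Y : V × 𝔽 := (1 - l) • (0, 1) with hY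
  set Z : V × 𝔽 := ν • (f z, 1) with hZ
  have ind : TripleIndep 𝔽 X Y Z := by
    intro a b c h
    obtain ⟨h2, h3⟩ := Prod.ext_iff.1 h
    simp only [hX, hY, hZ, Prod.fst_add, Prod.smul_fst, Prod.snd_add, Prod.smul_snd, smul_zero,
      add_zero, smul_smul, smul_eq_mul, mul_one, Prod.fst_zero, Prod.snd_zero] at h2 h3
    obtain ⟨h4, h5⟩ := hind _ _ h2
    have ha : a = 0 := (mul_eq_zero.1 h4).resolve_right l0
    have hc : c = 0 := (mul_eq_zero.1 h5).resolve_right ν0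
    refine ⟨ha, ?_, hc⟩
    subst ha; subst hc
    simpa [l1'] using h3
  have rX : Represents f x X := ⟨x0, l, l0, rfl⟩
  have rY : Represents f 1 Y := ⟨one_ne_zero, 1 - l, l1', by rw [h1]⟩
  have rZ : Represents f z Z := ⟨z0, ν, ν0, rfl⟩
  have neg : ∀ {y : F} {q : V × 𝔽}, Represents f y q → Represents f (-y) (-q) := by
    rintro y q ⟨hy, c, hc, rfl⟩
    exact ⟨neg_ne_zero.2 hy, -c, neg_ne_zero.2 hc, by rw [hneg, neg_smul]⟩
  have rXY : Represents f (x + 1) (X + Y) := by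
    refine ⟨by simpa using nx 1, 1, one_ne_zero, ?_⟩
    rw [hl]; ext <;> simp [hX, hY]
  have rYZ : Represents f (1 + z) (Y + Z) := by
    refine ⟨z1, (1 - l) / (1 - m), div_ne_zero l1' m1', ?_⟩
    rw [hm]
    ext
    · simp only [hY, hZ, hν, Prod.fst_add, Prod.smul_fst, smul_zero, zero_add, smul_smul]
      congr 1; field_simp
    · simp only [hY, hZ, hν, Prod.snd_add, Prod.smul_snd, smul_eq_mul, mul_one]
      field_simp; ring
  have rXYZ : Represents f (x + 1 + z) (X + Y + Z) :=
    rXY.add hcol rZ rX rYZ (by simpa using nxz 1) (by ring) (by abel) fun a b c h => by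
      obtain ⟨e1, e2, e3⟩ := ind (a + c) a b (by rw [← h]; module)
      subst e2
      exact ⟨rfl, e3, by simpa using e1⟩
  have rXZ : Represents f (x + z) (X + Z) :=
    rX.add hcol rZ rXYZ (neg rY) xz (by ring) (by abel) fun a b c h => by
      obtain ⟨e1, e2, e3⟩ := ind (a + c) c (b + c) (by rw [← h]; module)
      subst e2
      exact ⟨by simpa using e1, by simpa using e3, rfl⟩
  have key : ∀ n : ℕ, Represents f ((n + 1) • x + 1) ((n + 1) • X + Y) ∧
      Represents f ((n + 1) • x + 1 + z) ((n + 1) • X + Y + Z) := by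
    intro n
    induction n with
    | zero => simpa using ⟨rXY, rXYZ⟩
    | succ n ih =>
      obtain ⟨rA, rB⟩ := ih
      have e : (n + 1 + 1) • x + 1 + z = ((n + 1) • x + 1) + (x + z) := by
        rw [succ_nsmul _ (n + 1)]; ring
      have e' : (n + 1 + 1) • X + Y + Z = ((n + 1) • X + Y) + (X + Z) := by
        rw [succ_nsmul _ (n + 1)]; abel
      have rB' : Represents f ((n + 1 + 1) • x + 1 + z) ((n + 1 + 1) • X + Y + Z) := by
        rw [e, e']
        refine rA.add hcol rXZ rX rB (e ▸ nxz _) (by ring) (by abel) fun a b c h => ?_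
        rw [← Nat.cast_smul_eq_nsmul 𝔽] at h
        obtain ⟨e1, e2, e3⟩ := ind (a * (n + 1 : ℕ) + b + c) a b (by rw [← h]; module)
        subst e2; subst e3
        exact ⟨rfl, rfl, by simpa using e1⟩
      have f1 : (n + 1 + 1) • x + 1 = x + ((n + 1) • x + 1) := by
        rw [succ_nsmul _ (n + 1)]; ring
      have f2 : (n + 1 + 1) • X + Y = X + ((n + 1) • X + Y) := by
        rw [succ_nsmul _ (n + 1)]; abel
      refine ⟨?_, rB'⟩
      rw [f1, f2]
      refine rX.add hcol rA rB' (neg rZ) (f1 ▸ nx _) (by rw [← f1]; ring)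
        (by rw [← f2]; abel) fun a b c h => ?_
      rw [← Nat.cast_smul_eq_nsmul 𝔽, ← Nat.cast_smul_eq_nsmul 𝔽] at h
      obtain ⟨e1, e2, e3⟩ := ind (a + b * (n + 1 : ℕ) + c * (n + 1 + 1 : ℕ)) (b + c) c
        (by rw [← h]; module)
      subst e3
      have : b = 0 := by simpa using e2
      subst this
      exact ⟨by simpa using e1, rfl, rfl⟩
  obtain ⟨n, hn⟩ := hn
  obtain _ | n := n
  · rw [Nat.cast_zero, zero_mul] at hn
    exact l1 (sub_eq_zero.1 hn.symm)
  obtain ⟨-, c, hc, e⟩ := (key n).1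
  have := congrArg Prod.snd e
  rw [← Nat.cast_smul_eq_nsmul 𝔽] at this
  simp only [hX, hY, Prod.snd_add, Prod.smul_snd, smul_eq_mul, mul_one] at this
  rw [hn] at this
  exact hc (by rw [← this]; ring)

end Collinear

section LocalAction

open MulAction

/-- The subfield of elements fixed by a subgroup. -/
def fixedSubfield {G Ω : Type*} [Group G] [Field Ω] [MulSemiringAction G Ω] (H : Subgroup G) :
    Subfield Ω where
  carrier := {x | ∀ σ ∈ H, σ • x = x}
  mul_mem' hx hy σ hσ := by rw [smul_mul', hx σ hσ, hy σ hσ]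
  one_mem' σ _ := smul_one σ
  add_mem' hx hy σ hσ := by rw [smul_add, hx σ hσ, hy σ hσ]
  zero_mem' σ _ := smul_zero σ
  neg_mem' hx σ hσ := by rw [smul_neg, hx σ hσ]
  inv_mem' x hx σ hσ := by rw [smul_inv'', hx σ hσ]

/-- An action of a group `G` on a field `Ω` together with a `G`-stable subfield `E`
carrying a `G`-invariant nonarchimedean absolute value `N`, such that the fixed subfields in `E`
of finite index subgroups are local fields of residue characteristic `p`. -/
structure LocalAction (p : ℕ) (G Ω : Type*) [Group G] [Field Ω] [MulSemiringAction G Ω] where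
  E : Subfield Ω
  N : Ω → ℝ
  smul_mem : ∀ (g : G) {x : Ω}, x ∈ E → g • x ∈ E
  mem_of_pow : ∀ {x : Ω} {n : ℕ}, n ≠ 0 → x ^ n ∈ E → x ∈ E
  finiteIndex_of_mem : ∀ {x : Ω}, x ∈ E → (stabilizer G x).FiniteIndex
  exists_stabilizer_le : ∀ x : Ω, ∃ e ∈ E, stabilizer G e ≤ stabilizer G x
  N_zero : N 0 = 0
  N_pos : ∀ {x : Ω}, x ∈ E → x ≠ 0 → 0 < N x
  N_mul : ∀ {x y : Ω}, x ∈ E → y ∈ E → N (x * y) = N x * N y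
  N_add : ∀ {x y : Ω}, x ∈ E → y ∈ E → N (x + y) ≤ max (N x) (N y)
  N_smul : ∀ (g : G) {x : Ω}, x ∈ E → N (g • x) = N x
  N_p : N p < 1
  exists_unif : ∀ H : Subgroup G, H.FiniteIndex → ∃ π ∈ fixedSubfield H ⊓ E, 0 < N π ∧ N π < 1 ∧
    ∀ c ∈ fixedSubfield H ⊓ E, c ≠ 0 → ∃ j : ℤ, N c = N π ^ j
  exists_residue : ∀ H : Subgroup G, H.FiniteIndex → ∃ (κ : Type) (_ : Field κ) (_ : Finite κ)
    (r : Ω → κ), r 1 = 1 ∧ (∀ a, ∃ x ∈ fixedSubfield H ⊓ E, N x ≤ 1 ∧ r x = a) ∧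
    (∀ x ∈ fixedSubfield H ⊓ E, N x ≤ 1 → (r x = 0 ↔ N x < 1)) ∧
    (∀ x ∈ fixedSubfield H ⊓ E, ∀ y ∈ fixedSubfield H ⊓ E, N x ≤ 1 → N y ≤ 1 →
      r (x + y) = r x + r y ∧ r (x * y) = r x * r y)
  complete : ∀ H : Subgroup G, H.FiniteIndex → ∀ (t : ℝ) (c : ℕ → Ω), 0 < t → t < 1 →
    (∀ n, c n ∈ fixedSubfield H ⊓ E) → (∀ n, N (c (n + 1) - c n) ≤ t ^ n) →
    ∃ a ∈ fixedSubfield H ⊓ E, ∀ n, N (a - c n) ≤ t ^ n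

lemma mem_fixedSubfield {G Ω : Type*} [Group G] [Field Ω] [MulSemiringAction G Ω]
    {H : Subgroup G} {x : Ω} : x ∈ fixedSubfield H ↔ ∀ σ ∈ H, σ • x = x := Iff.rfl

lemma fixedSubfield_anti {G Ω : Type*} [Group G] [Field Ω] [MulSemiringAction G Ω]
    {H H' : Subgroup G} (h : H' ≤ H) : (fixedSubfield H : Subfield Ω) ≤ fixedSubfield H' :=
  fun _ hx σ hσ => hx σ (h hσ)

namespace LocalAction

variable {p : ℕ} {G Ω : Type*} [Group G] [Field Ω] [MulSemiringAction G Ω]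
  (D : LocalAction p G Ω)

/-- The local field at level `H`. -/
abbrev loc (H : Subgroup G) : Subfield Ω := fixedSubfield H ⊓ D.E

variable {D}

lemma loc_anti {H H' : Subgroup G} (h : H' ≤ H) : D.loc H ≤ D.loc H' :=
  inf_le_inf_right _ (fixedSubfield_anti h)

lemma N_one : D.N 1 = 1 := by
  have h := D.N_mul (one_mem D.E) (one_mem D.E)
  have h2 := D.N_pos (one_mem D.E) one_ne_zero
  rw [mul_one] at h
  exact (mul_left_cancel₀ h2.ne' (by rw [mul_one]; exact h)).symm

lemma N_nonneg {x : Ω} (hx : x ∈ D.E) : 0 ≤ D.N x := by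
  by_cases h : x = 0
  · rw [h, D.N_zero]
  · exact (D.N_pos hx h).le

lemma N_eq_zero {x : Ω} (hx : x ∈ D.E) : D.N x = 0 ↔ x = 0 :=
  ⟨fun h => by_contra fun h0 => (D.N_pos hx h0).ne' h, fun h => by rw [h, D.N_zero]⟩

/-- The absolute value on `E` bundled as an `AbsoluteValue`. -/
def abv (D : LocalAction p G Ω) : AbsoluteValue D.E ℝ where
  toFun x := D.N x
  map_mul' x y := D.N_mul x.2 y.2
  nonneg' x := N_nonneg x.2
  eq_zero' x := by rw [N_eq_zero x.2]; exact_mod_cast Iff.rfl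
  add_le' x y := (D.N_add x.2 y.2).trans (max_le_add_of_nonneg (N_nonneg x.2) (N_nonneg y.2))

lemma N_neg {x : Ω} (hx : x ∈ D.E) : D.N (-x) = D.N x := map_neg_eq_map D.abv ⟨x, hx⟩

lemma N_sub {x y : Ω} (hx : x ∈ D.E) (hy : y ∈ D.E) : D.N (x - y) ≤ max (D.N x) (D.N y) := by
  rw [sub_eq_add_neg, ← N_neg hy]; exact D.N_add hx (neg_mem hy)

lemma N_sub_comm {x y : Ω} (hx : x ∈ D.E) (hy : y ∈ D.E) : D.N (x - y) = D.N (y - x) := by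
  rw [← neg_sub, N_neg (sub_mem hy hx)]

lemma N_pow {x : Ω} (hx : x ∈ D.E) (n : ℕ) : D.N (x ^ n) = D.N x ^ n :=
  map_pow D.abv ⟨x, hx⟩ n

lemma N_inv {x : Ω} (hx : x ∈ D.E) : D.N x⁻¹ = (D.N x)⁻¹ := map_inv₀ D.abv ⟨x, hx⟩

lemma N_div {x y : Ω} (hx : x ∈ D.E) (hy : y ∈ D.E) : D.N (x / y) = D.N x / D.N y :=
  map_div₀ D.abv ⟨x, hx⟩ ⟨y, hy⟩

lemma N_zpow {x : Ω} (hx : x ∈ D.E) (n : ℤ) : D.N (x ^ n) = D.N x ^ n :=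
  map_zpow₀ D.abv ⟨x, hx⟩ n

lemma N_prod {ι : Type*} (s : Finset ι) (g : ι → Ω) (hg : ∀ i ∈ s, g i ∈ D.E) :
    D.N (∏ i ∈ s, g i) = ∏ i ∈ s, D.N (g i) := by
  classical
  induction s using Finset.induction_on with
  | empty => simp [N_one]
  | insert a s ha ih =>
    have hs : ∀ i ∈ s, g i ∈ D.E := fun i hi => hg i (Finset.mem_insert_of_mem hi)
    rw [Finset.prod_insert ha, Finset.prod_insert ha,
      D.N_mul (hg a (Finset.mem_insert_self a s)) (prod_mem hs), ih hs]

lemma N_sum_le {ι : Type*} (s : Finset ι) (g : ι → Ω) (hg : ∀ i ∈ s, g i ∈ D.E) {B : ℝ}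
    (hB : 0 ≤ B) (h : ∀ i ∈ s, D.N (g i) ≤ B) : D.N (∑ i ∈ s, g i) ≤ B := by
  classical
  induction s using Finset.induction_on with
  | empty => simpa [D.N_zero]
  | insert a s ha ih =>
    have hs : ∀ i ∈ s, g i ∈ D.E := fun i hi => hg i (Finset.mem_insert_of_mem hi)
    rw [Finset.sum_insert ha]
    exact (D.N_add (hg a (Finset.mem_insert_self a s)) (sum_mem hs)).trans
      (max_le (h a (Finset.mem_insert_self a s))
        (ih hs fun i hi => h i (Finset.mem_insert_of_mem hi)))

lemma N_sum_lt {ι : Type*} (s : Finset ι) (g : ι → Ω) (hg : ∀ i ∈ s, g i ∈ D.E) {B : ℝ}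
    (hB : 0 < B) (h : ∀ i ∈ s, D.N (g i) < B) : D.N (∑ i ∈ s, g i) < B := by
  classical
  induction s using Finset.induction_on with
  | empty => simpa [D.N_zero]
  | insert a s ha ih =>
    have hs : ∀ i ∈ s, g i ∈ D.E := fun i hi => hg i (Finset.mem_insert_of_mem hi)
    rw [Finset.sum_insert ha]
    exact (D.N_add (hg a (Finset.mem_insert_self a s)) (sum_mem hs)).trans_lt
      (max_lt (h a (Finset.mem_insert_self a s))
        (ih hs fun i hi => h i (Finset.mem_insert_of_mem hi)))

lemma N_add_eq {x y : Ω} (hx : x ∈ D.E) (hy : y ∈ D.E) (h : D.N y < D.N x) :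
    D.N (x + y) = D.N x := by
  apply le_antisymm ((D.N_add hx hy).trans (max_le le_rfl h.le))
  by_contra! h2
  have := N_sub (D := D) (add_mem hx hy) hy
  rw [add_sub_cancel_right] at this
  exact absurd this (not_le.2 (max_lt h2 h))

lemma N_eq_of_sub_lt {x y : Ω} (hx : x ∈ D.E) (hy : y ∈ D.E) (h : D.N (x - y) < D.N y) :
    D.N x = D.N y := by
  have := N_add_eq hy (sub_mem hx hy) h
  rwa [add_sub_cancel] at this

lemma N_natCast_le (n : ℕ) : D.N n ≤ 1 := by
  induction n with
  | zero => simp [D.N_zero]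
  | succ n ih =>
    rw [Nat.cast_succ]
    exact (D.N_add (natCast_mem D.E n) (one_mem _)).trans (max_le ih N_one.le)

lemma N_intCast_le (n : ℤ) : D.N n ≤ 1 := by
  obtain ⟨m, rfl | rfl⟩ := n.eq_nat_or_neg
  · simpa using N_natCast_le m
  · rw [Int.cast_neg, N_neg (intCast_mem D.E _)]; simpa using N_natCast_le m

lemma N_natCast_eq {n : ℕ} (h : n.Coprime p) : D.N n = 1 := by
  refine le_antisymm (N_natCast_le n) ?_
  by_contra! h1
  have h2 : ((n.gcd p : ℤ) : Ω) = n * (n.gcdA p : ℤ) + p * (n.gcdB p : ℤ) := by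
    rw [Nat.gcd_eq_gcd_ab]; push_cast; ring
  rw [h.gcd_eq_one, Nat.cast_one, Int.cast_one] at h2
  have h3 := D.N_add (mul_mem (natCast_mem D.E n) (intCast_mem D.E (n.gcdA p)))
    (mul_mem (natCast_mem D.E p) (intCast_mem D.E (n.gcdB p)))
  rw [← h2, N_one, D.N_mul (natCast_mem D.E n) (intCast_mem D.E _),
    D.N_mul (natCast_mem D.E p) (intCast_mem D.E _)] at h3
  have a1 := mul_le_of_le_one_right (N_nonneg (natCast_mem D.E n)) (N_intCast_le (D := D) (n.gcdA p))
  have a2 := mul_le_of_le_one_right (N_nonneg (natCast_mem D.E p)) (N_intCast_le (D := D) (n.gcdB p))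
  have a3 := D.N_p
  rcases le_max_iff.1 h3 with h4 | h4 <;> linarith

lemma N_sub_one_lt_mul {x y : Ω} (hx : x ∈ D.E) (hy : y ∈ D.E) (h1 : D.N (x - 1) < 1)
    (h2 : D.N (y - 1) < 1) : D.N (x * y - 1) < 1 := by
  have hx1 : D.N x = 1 := by
    rw [N_eq_of_sub_lt hx (one_mem _) (by rwa [N_one]), N_one]
  rw [show x * y - 1 = x * (y - 1) + (x - 1) by ring]
  refine (D.N_add (mul_mem hx (sub_mem hy (one_mem _))) (sub_mem hx (one_mem _))).trans_lt
    (max_lt ?_ h1)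
  rw [D.N_mul hx (sub_mem hy (one_mem _)), hx1, one_mul]; exact h2

lemma N_prod_sub_one_lt {ι : Type*} (s : Finset ι) (g : ι → Ω) (hg : ∀ i ∈ s, g i ∈ D.E)
    (h : ∀ i ∈ s, D.N (g i - 1) < 1) : D.N (∏ i ∈ s, g i - 1) < 1 := by
  classical
  induction s using Finset.induction_on with
  | empty => simp [D.N_zero]
  | insert a s ha ih =>
    have hs : ∀ i ∈ s, g i ∈ D.E := fun i hi => hg i (Finset.mem_insert_of_mem hi)
    rw [Finset.prod_insert ha]
    exact N_sub_one_lt_mul (hg a (Finset.mem_insert_self a s)) (prod_mem hs)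
      (h a (Finset.mem_insert_self a s)) (ih hs fun i hi => h i (Finset.mem_insert_of_mem hi))

lemma N_pow_sub_one_lt {x : Ω} (hx : x ∈ D.E) (h : D.N (x - 1) < 1) (n : ℕ) :
    D.N (x ^ n - 1) < 1 := by
  simpa using N_prod_sub_one_lt (Finset.range n) (fun _ => x) (fun _ _ => hx) fun _ _ => h

lemma mem_of_pow_eq_one {x : Ω} {n : ℕ} (hn : n ≠ 0) (h : x ^ n = 1) : x ∈ D.E :=
  D.mem_of_pow hn (h ▸ one_mem _)

lemma N_eq_one_of_pow {x : Ω} (hx : x ∈ D.E) {n : ℕ} (hn : n ≠ 0) (h : D.N (x ^ n) = 1) :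
    D.N x = 1 := by
  rw [N_pow hx] at h
  exact (pow_eq_one_iff_of_nonneg (N_nonneg hx) hn).1 h

end LocalAction

end LocalAction

section RootsOfUnity

lemma IsPrimitiveRoot.of_pow_prime_eq_one {Ω : Type*} [Field Ω] {q : ℕ} (hq : q.Prime) {ω : Ω}
    (h : ω ^ q = 1) (h1 : ω ≠ 1) : IsPrimitiveRoot ω q := by
  rw [IsPrimitiveRoot.iff_orderOf]
  have := Fact.mk hq
  exact orderOf_eq_prime h h1

lemma IsPrimitiveRoot.pow_sub_pow_eq_prod_range {Ω : Type*} [Field Ω] {q : ℕ} (hq : 0 < q) {ζ : Ω}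
    (h : IsPrimitiveRoot ζ q) (x y : Ω) :
    x ^ q - y ^ q = ∏ j ∈ Finset.range q, (x - ζ ^ j * y) := by
  rw [h.pow_sub_pow_eq_prod_sub_mul x y hq]
  symm
  refine Finset.prod_nbij (fun j => ζ ^ j) ?_ ?_ ?_ ?_
  · intro j _
    rw [Polynomial.mem_nthRootsFinset hq, ← pow_mul, mul_comm, pow_mul, h.pow_eq_one, one_pow]
  · intro i hi j hj e
    exact h.pow_inj (by simpa using hi) (by simpa using hj) e
  · intro ω hω
    have : NeZero q := ⟨hq.ne'⟩
    obtain ⟨i, hi, e⟩ := h.eq_pow_of_pow_eq_one ((Polynomial.mem_nthRootsFinset hq 1).1 hω)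
    exact ⟨i, by simpa using hi, e⟩
  · intros; rfl

end RootsOfUnity

section Kummer

open MulAction

namespace LocalAction

variable {p : ℕ} {G Ω : Type*} [Group G] [Field Ω] [MulSemiringAction G Ω]
  {D : LocalAction p G Ω}

lemma finiteIndex_stabilizer (D : LocalAction p G Ω) (x : Ω) : (stabilizer G x).FiniteIndex := by
  obtain ⟨e, he, hle⟩ := D.exists_stabilizer_le x
  have := D.finiteIndex_of_mem he
  exact Subgroup.finiteIndex_of_le hle

/-- A vector of the span of finitely many distinct characters of `ℕ` does not vanish. -/
lemma exists_sum_mul_pow_ne_zero {ι : Type*} [Fintype ι] (f a : ι → Ω)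
    (hf : Function.Injective f) (ha : ∃ i, a i ≠ 0) : ∃ j : ℕ, ∑ i, a i * f i ^ j ≠ 0 := by
  by_contra! h
  obtain ⟨i, hi⟩ := ha
  have e := Fintype.equivFin ι
  have := Matrix.eq_zero_of_forall_pow_sum_mul_pow_eq_zero (f := f ∘ e.symm) (v := a ∘ e.symm)
    (hf.comp e.symm.injective) (fun j => by
      have := h j
      rw [← Equiv.sum_comp e.symm] at this
      exact this)
  exact hi (by simpa using congrFun this (e i))

/-- Hilbert's Theorem 90 for the Kummer cocycle of `y`. -/
lemma exists_mul_mem_fixedSubfield (D : LocalAction p G Ω) {H : Subgroup G} [H.FiniteIndex] {y : Ω}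
    (hy : y ≠ 0) {n : ℕ} (hn : n ≠ 0) (hyn : y ^ n ∈ fixedSubfield H) :
    ∃ z ∈ D.E, z ≠ 0 ∧ z * y ∈ fixedSubfield H := by
  classical
  obtain ⟨e, he, hle⟩ := D.exists_stabilizer_le y
  have := D.finiteIndex_of_mem he
  have hfin : Finite (orbit H e) := by
    have : Finite (orbit G e) :=
      Finite.of_equiv (G ⧸ stabilizer G e) (orbitEquivQuotientStabilizer G e).symm
    refine Set.Finite.subset (Set.toFinite (orbit G e)) ?_
    rintro _ ⟨σ, rfl⟩
    exact ⟨σ.1, rfl⟩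
  let _ := Fintype.ofFinite (orbit H e)
  have hch : ∀ e' : orbit H e, ∃ τ : H, τ • e = e' := fun e' => e'.2
  choose τ hτ using hch
  let a : orbit H e → Ω := fun e' => τ e' • y / y
  have ha : ∀ σ : H, ∀ e' : orbit H e, (σ : H) • e = e' → a e' = σ • y / y := by
    intro σ e' h
    have h1 : ((σ⁻¹ * τ e' : H) : G) ∈ stabilizer G e := by
      rw [mem_stabilizer_iff]
      change (σ⁻¹ * τ e') • e = e
      rw [mul_smul, hτ, ← h, inv_smul_smul]
    have h2 : (σ⁻¹ * τ e') • y = y := hle h1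
    rw [mul_smul, inv_smul_eq_iff] at h2
    simp only [a, h2]
  have hsm : ∀ (σ : H) {x : Ω}, x ∈ fixedSubfield H → σ • x = x := fun σ x hx => hx σ.1 σ.2
  have haE : ∀ e', a e' ∈ D.E := fun e' => by
    refine mem_of_pow_eq_one hn ?_
    simp only [a]
    rw [div_pow, ← smul_pow', hsm _ hyn, div_self (pow_ne_zero n hy)]
  obtain ⟨j, hj⟩ := exists_sum_mul_pow_ne_zero (fun e' : orbit H e => (e' : Ω)) a
    Subtype.val_injective ⟨⟨e, mem_orbit_self e⟩, by
      rw [ha 1 _ (one_smul _ _), one_smul, div_self hy]; exact one_ne_zero⟩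
  refine ⟨_, ?_, hj, ?_⟩
  · refine sum_mem fun e' _ => mul_mem (haE e') (pow_mem ?_ j)
    rw [← hτ e']
    exact D.smul_mem _ he
  · intro σ hσ
    set σ' : H := ⟨σ, hσ⟩
    change σ' • (_ * y) = _ * y
    rw [smul_mul', Finset.smul_sum, Finset.sum_mul, Finset.sum_mul]
    rw [← Equiv.sum_comp (MulAction.toPerm σ' : Equiv.Perm (orbit H e))
      (fun e' => a e' * (e' : Ω) ^ j * y)]
    refine Finset.sum_congr rfl fun e' _ => ?_
    have h1 : a (σ' • e') = (σ' * τ e') • y / y := ha _ _ (by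
      rw [mul_smul, hτ]; rfl)
    simp only [MulAction.toPerm_apply]
    rw [h1, smul_mul', smul_pow']
    have h2 : (σ' • a e') * (σ' • y) = (σ' * τ e') • y := by
      rw [← smul_mul', ha (τ e') e' (hτ e'), div_mul_cancel₀ _ hy, mul_smul]
    rw [show ((σ' • e' : orbit H e) : Ω) = σ' • (e' : Ω) from rfl]
    rw [mul_right_comm, h2]
    field_simp

/-- Every element of the fixed field is an `n`-th power up to an element of the local field. -/
lemma exists_eq_mul_pow [IsAlgClosed Ω] (D : LocalAction p G Ω) {H : Subgroup G} [H.FiniteIndex]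
    {x : Ω} (hx : x ∈ fixedSubfield H) (h0 : x ≠ 0) {n : ℕ} (hn : n ≠ 0) :
    ∃ c ∈ D.loc H, c ≠ 0 ∧ ∃ y ∈ fixedSubfield H, y ≠ 0 ∧ x = c * y ^ n := by
  obtain ⟨y, hy⟩ := IsAlgClosed.exists_pow_nat_eq x (Nat.pos_of_ne_zero hn)
  have y0 : y ≠ 0 := by rintro rfl; exact h0 (by rw [← hy, zero_pow hn])
  obtain ⟨z, hzE, z0, hz⟩ := D.exists_mul_mem_fixedSubfield y0 hn (hy ▸ hx)
  refine ⟨(z ^ n)⁻¹, ⟨?_, D.E.inv_mem (pow_mem hzE n)⟩, inv_ne_zero (pow_ne_zero n z0), z * y, hz,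
    mul_ne_zero z0 y0, ?_⟩
  · rw [show (z ^ n)⁻¹ = x / (z * y) ^ n by rw [mul_pow, hy]; field_simp]
    exact (fixedSubfield H).div_mem hx (pow_mem hz n)
  · rw [mul_pow, hy]; field_simp

lemma eq_one_of_pow_eq_one {q : ℕ} (hq : q.Prime) (hqp : q.Coprime p) {ω : Ω} (h : ω ^ q = 1)
    (h1 : D.N (ω - 1) < 1) : ω = 1 := by
  by_contra hω
  have hE := mem_of_pow_eq_one (D := D) hq.ne_zero h
  have hs := (IsPrimitiveRoot.of_pow_prime_eq_one hq h hω).geom_sum_eq_zero hq.one_lt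
  have h2 : D.N (∑ i ∈ Finset.range q, (ω ^ i - 1)) < 1 :=
    N_sum_lt _ _ (fun i _ => sub_mem (pow_mem hE i) (one_mem _)) one_pos
      fun i _ => N_pow_sub_one_lt hE h1 i
  rw [Finset.sum_sub_distrib, hs, zero_sub, Finset.sum_const, Finset.card_range, nsmul_one,
    N_neg (natCast_mem D.E q), N_natCast_eq hqp] at h2
  exact lt_irrefl _ h2

/-- Hensel's lemma for `q`-th powers of principal units, `q` prime to the residue
characteristic. -/
lemma exists_pow_eq_of_sub_one_lt [IsAlgClosed Ω] {q : ℕ} (hq : q.Prime) (hqp : q.Coprime p)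
    {ζ : Ω} (hζ : IsPrimitiveRoot ζ q) {H : Subgroup G} {c : Ω} (hc : c ∈ D.loc H)
    (h : D.N (c - 1) < 1) : ∃ t ∈ D.loc H, t ^ q = c := by
  obtain ⟨t, ht⟩ := IsAlgClosed.exists_pow_nat_eq c hq.pos
  have htE : t ∈ D.E := D.mem_of_pow hq.ne_zero (ht ▸ hc.2)
  have hζE := mem_of_pow_eq_one (D := D) hq.ne_zero hζ.pow_eq_one
  have hζN : D.N ζ = 1 := N_eq_one_of_pow hζE hq.ne_zero (by rw [hζ.pow_eq_one, N_one])
  have hcN : D.N c = 1 := by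
    rw [N_eq_of_sub_lt hc.2 (one_mem _) (by rwa [N_one]), N_one]
  have htN : D.N t = 1 := N_eq_one_of_pow htE hq.ne_zero (by rw [ht, hcN])
  have hjE : ∀ j : ℕ, t - ζ ^ j * 1 ∈ D.E := fun j => by
    rw [mul_one]; exact sub_mem htE (pow_mem hζE j)
  have : ∃ j : ℕ, D.N (t - ζ ^ j * 1) < 1 := by
    by_contra! hcon
    have h1 := congrArg D.N (hζ.pow_sub_pow_eq_prod_range hq.pos t 1)
    rw [N_prod _ _ fun j _ => hjE j, ht, one_pow] at h1
    have h2 : (1 : ℝ) ≤ ∏ j ∈ Finset.range q, D.N (t - ζ ^ j * 1) := Finset.one_le_prod fun j _ => hcon j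
    linarith
  obtain ⟨j, hj⟩ := this
  have hζj : ζ ^ j ∈ D.E := pow_mem hζE j
  have hζ0 : ζ ^ j ≠ 0 := pow_ne_zero j (hζ.ne_zero hq.ne_zero)
  have hζjN : D.N (ζ ^ j) = 1 := by rw [N_pow hζE, hζN, one_pow]
  set u := t / ζ ^ j with hu
  have huE : u ∈ D.E := div_mem htE hζj
  have huq : u ^ q = c := by
    rw [hu, div_pow, ht, ← pow_mul, mul_comm, pow_mul, hζ.pow_eq_one, one_pow, div_one]
  have hu1 : D.N (u - 1) < 1 := by
    rw [show u - 1 = (t - ζ ^ j * 1) / ζ ^ j by rw [hu]; field_simp, N_div (hjE j) hζj, hζjN,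
      div_one]
    exact hj
  have hu0 : u ≠ 0 := by
    rintro h0
    rw [h0, zero_sub, N_neg (one_mem _), N_one] at hu1
    exact lt_irrefl _ hu1
  have huN : D.N u = 1 := by
    rw [N_eq_of_sub_lt huE (one_mem _) (by rwa [N_one]), N_one]
  refine ⟨u, ⟨fun σ hσ => ?_, huE⟩, huq⟩
  have e1 : (σ • u / u) ^ q = 1 := by
    rw [div_pow, ← smul_pow', huq, hc.1 σ hσ, div_self]
    rw [← huq]; exact pow_ne_zero q hu0
  have e2 := eq_one_of_pow_eq_one (D := D) hq hqp e1 (by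
    have hs : σ • u ∈ D.E := D.smul_mem σ huE
    rw [show σ • u / u - 1 = ((σ • u - 1) - (u - 1)) / u by field_simp; ring,
      N_div (sub_mem (sub_mem hs (one_mem _)) (sub_mem huE (one_mem _))) huE, huN, div_one]
    refine (N_sub (sub_mem hs (one_mem _)) (sub_mem huE (one_mem _))).trans_lt (max_lt ?_ hu1)
    rw [← smul_one σ, ← smul_sub, D.N_smul σ (sub_mem huE (one_mem _))]
    exact hu1)
  rwa [div_eq_one_iff_eq hu0] at e2

/-- Units modulo `q`-th powers form a cyclic group. -/
lemma exists_eq_zpow_mul_pow [IsAlgClosed Ω] {q : ℕ} (hq : q.Prime) (hqp : q.Coprime p)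
    {ζ : Ω} (hζ : IsPrimitiveRoot ζ q) {H : Subgroup G} [H.FiniteIndex] {a b : Ω}
    (ha : a ∈ D.loc H) (hb : b ∈ D.loc H) (haN : D.N a = 1) (hbN : D.N b = 1)
    (hna : ¬ ∃ t ∈ D.loc H, t ^ q = a) : ∃ i : ℤ, ∃ t ∈ D.loc H, b = a ^ i * t ^ q := by
  obtain ⟨κ, _, _, r, r1, rsurj, r0, rhom⟩ := D.exists_residue H inferInstance
  have nz : ∀ {x : Ω}, x ∈ D.loc H → D.N x = 1 → x ≠ 0 := fun _ h h0 => by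
    rw [h0, D.N_zero] at h; exact zero_ne_one h
  have rne : ∀ {x : Ω}, x ∈ D.loc H → D.N x = 1 → r x ≠ 0 := fun hx h h0 => by
    have := (r0 _ hx h.le).1 h0
    exact absurd h this.ne
  have rmul : ∀ {x y : Ω}, x ∈ D.loc H → y ∈ D.loc H → D.N x = 1 → D.N y = 1 →
      r (x * y) = r x * r y := fun hx hy h h' => (rhom _ hx _ hy h.le h'.le).2
  have rpow : ∀ {x : Ω} (n : ℕ), x ∈ D.loc H → D.N x = 1 → r (x ^ n) = r x ^ n := by
    intro x n hx h
    induction n with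
    | zero => simp [r1]
    | succ n ih =>
      rw [pow_succ, pow_succ, rmul (pow_mem hx n) hx (by rw [N_pow hx.2, h, one_pow]) h, ih]
  have rinv : ∀ {x : Ω}, x ∈ D.loc H → D.N x = 1 → r x⁻¹ = (r x)⁻¹ := by
    intro x hx h
    refine eq_inv_of_mul_eq_one_left ?_
    rw [← rmul (inv_mem hx) hx (by rw [N_inv hx.2, h, inv_one]) h,
      inv_mul_cancel₀ (nz hx h), r1]
  have rzpow : ∀ {x : Ω} (n : ℤ), x ∈ D.loc H → D.N x = 1 → r (x ^ n) = r x ^ n := by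
    intro x n hx h
    obtain ⟨m, rfl | rfl⟩ := n.eq_nat_or_neg
    · rw [zpow_natCast, zpow_natCast, rpow m hx h]
    · rw [zpow_neg, zpow_neg, zpow_natCast, zpow_natCast, rinv (pow_mem hx m)
        (by rw [N_pow hx.2, h, one_pow]), rpow m hx h]
  have lift : ∀ u : κˣ, ∃ x ∈ D.loc H, D.N x = 1 ∧ r x = u := by
    intro u
    obtain ⟨x, hx, hN, e⟩ := rsurj u
    refine ⟨x, hx, le_antisymm hN ?_, e⟩
    by_contra! hlt
    exact u.ne_zero (e ▸ (r0 x hx hN).2 hlt)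
  have hens : ∀ {x y : Ω}, x ∈ D.loc H → y ∈ D.loc H → D.N x = 1 → D.N y = 1 → r x = r y →
      ∃ t ∈ D.loc H, x = y * t ^ q := by
    intro x y hx hy hxN hyN e
    have hd : x / y ∈ D.loc H := div_mem hx hy
    have hdN : D.N (x / y) = 1 := by rw [N_div hx.2 hy.2, hxN, hyN, div_one]
    obtain ⟨t, ht, h⟩ := exists_pow_eq_of_sub_one_lt hq hqp hζ hd (by
      have h1 := (rhom _ hd _ (one_mem _) hdN.le N_one.le).1
      have h2 := rhom _ hd (-1) (neg_mem (one_mem _)) hdN.le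
        (by rw [N_neg (one_mem _), N_one])
      rw [sub_eq_add_neg]
      rw [← r0 _ (add_mem hd (neg_mem (one_mem _)))
        ((D.N_add hd.2 (neg_mem (one_mem _))).trans
          (max_le hdN.le (by rw [N_neg (one_mem _), N_one]))), h2.1, div_eq_mul_inv,
        rmul hx (inv_mem hy) hxN (by rw [N_inv hy.2, hyN, inv_one]), rinv hy hyN, e,
        mul_inv_cancel₀ (rne hy hyN)]
      have h3 := (rhom 1 (one_mem _) (-1) (neg_mem (one_mem _)) N_one.le
        (by rw [N_neg (one_mem _), N_one])).1
      rw [add_neg_cancel, r1] at h3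
      rw [← h3, r0 0 (zero_mem _) (by rw [D.N_zero]; exact zero_le_one), D.N_zero]
      exact one_pos)
    exact ⟨t, ht, by rw [h, mul_div_cancel₀ _ (nz hy hyN)]⟩
  obtain ⟨g, hg⟩ := IsCyclic.exists_generator (α := κˣ)
  obtain ⟨m, hm⟩ := hg (Units.mk0 _ (rne ha haN))
  obtain ⟨n, hn⟩ := hg (Units.mk0 _ (rne hb hbN))
  obtain ⟨x, hx, hxN, hxg⟩ := lift g
  have hm' : r a = r x ^ m := by
    rw [hxg]; simpa using (congrArg Units.val hm).symm
  have hn' : r b = r x ^ n := by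
    rw [hxg]; simpa using (congrArg Units.val hn).symm
  have hx0 := nz hx hxN
  have hxz : ∀ j : ℤ, D.N (x ^ j) = 1 := fun j => by rw [N_zpow hx.2, hxN, one_zpow]
  have hcop : IsCoprime m (q : ℤ) := by
    rw [isCoprime_comm, Prime.coprime_iff_not_dvd (Nat.prime_iff_prime_int.1 hq)]
    rintro ⟨d, rfl⟩
    obtain ⟨t, ht, e⟩ := hens ha (zpow_mem hx (q * d)) haN (hxz _)
      (by rw [hm', rzpow _ hx hxN])
    refine hna ⟨x ^ d * t, mul_mem (zpow_mem hx d) ht, ?_⟩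
    rw [e, mul_pow, mul_comm (q : ℤ), zpow_mul, zpow_natCast]
  obtain ⟨u, v, huv⟩ := hcop
  have haz : D.N (a ^ (n * u)) = 1 := by rw [N_zpow ha.2, haN, one_zpow]
  obtain ⟨t, ht, e⟩ := hens hb (mul_mem (zpow_mem ha (n * u)) (zpow_mem hx (n * v * q))) hbN
    (by rw [D.N_mul (zpow_mem ha _).2 (zpow_mem hx _).2, haz, hxz, one_mul]) (by
      rw [rmul (zpow_mem ha _) (zpow_mem hx _) haz (hxz _), rzpow _ ha haN, rzpow _ hx hxN, hm', hn',
        ← zpow_mul, ← zpow_add₀ (rne hx hxN)]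
      congr 1
      linear_combination (-n) * huv)
  refine ⟨n * u, x ^ (n * v) * t, mul_mem (zpow_mem hx _) ht, ?_⟩
  rw [e, mul_pow, ← zpow_natCast (x ^ (n * v)), ← zpow_mul, mul_assoc]

end LocalAction

end Kummer

section KummerStep

open MulAction

/-- A cyclic Kummer extension of degree `q`, generated over the fixed field of `H` by `θ`. -/
structure KummerStep {G Ω : Type*} [Group G] [Field Ω] [MulSemiringAction G Ω] (H : Subgroup G)
    (q : ℕ) (ζ θ : Ω) (τ : G) : Prop where
  pos : 0 < q
  prim : IsPrimitiveRoot ζ q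
  mem : ζ ∈ fixedSubfield H
  ne_zero : θ ≠ 0
  pow_mem : θ ^ q ∈ fixedSubfield H
  gen_mem : τ ∈ H
  gen_smul : τ • θ = ζ * θ

namespace KummerStep

variable {G Ω : Type*} [Group G] [Field Ω] [MulSemiringAction G Ω] {H : Subgroup G}
    {q : ℕ} {ζ θ : Ω} {τ : G} (S : KummerStep H q ζ θ τ)

/-- The norm of a Kummer extension. -/
def nrm (q : ℕ) (τ : G) (z : Ω) : Ω := ∏ j ∈ Finset.range q, τ ^ j • z

/-- The trace of a Kummer extension. -/
def tr (q : ℕ) (τ : G) (z : Ω) : Ω := ∑ j ∈ Finset.range q, τ ^ j • z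

lemma nrm_mul (x y : Ω) : nrm q τ (x * y) = nrm q τ x * nrm q τ y := by
  simp only [nrm, smul_mul', Finset.prod_mul_distrib]

lemma nrm_pow (x : Ω) (n : ℕ) : nrm q τ (x ^ n) = nrm q τ x ^ n := by
  simp only [nrm, smul_pow', Finset.prod_pow]

lemma nrm_ne_zero {x : Ω} (hx : x ≠ 0) : nrm q τ x ≠ 0 :=
  Finset.prod_ne_zero_iff.2 fun j _ => by rwa [Ne, smul_eq_zero_iff_eq]

include S

lemma pow_smul (i : ℕ) : τ ^ i • θ = ζ ^ i * θ := by
  induction i with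
  | zero => simp
  | succ i ih =>
    rw [pow_succ', mul_smul, ih, smul_mul', smul_pow', S.mem τ S.gen_mem, S.gen_smul, pow_succ]
    ring

lemma exists_smul_eq {σ : G} (hσ : σ ∈ H) : ∃ i < q, σ • θ = ζ ^ i * θ := by
  have : NeZero q := ⟨S.pos.ne'⟩
  obtain ⟨i, hi, e⟩ := S.prim.eq_pow_of_pow_eq_one (ξ := σ • θ / θ) (by
    rw [div_pow, ← smul_pow', S.pow_mem σ hσ, div_self (pow_ne_zero q S.ne_zero)])
  exact ⟨i, hi, by rw [e, div_mul_cancel₀ _ S.ne_zero]⟩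

lemma smul_eq_pow_smul {σ : G} (hσ : σ ∈ H) {i : ℕ} (h : σ • θ = ζ ^ i * θ) {z : Ω}
    (hz : z ∈ fixedSubfield (H ⊓ stabilizer G θ)) : σ • z = τ ^ i • z := by
  have := hz ((τ ^ i)⁻¹ * σ) ⟨H.mul_mem (H.inv_mem (H.pow_mem S.gen_mem i)) hσ, mem_stabilizer_iff.2 <| by
    rw [mul_smul, h, ← S.pow_smul, inv_smul_smul]⟩
  rwa [mul_smul, inv_smul_eq_iff] at this

lemma gen_pow_smul {z : Ω} (hz : z ∈ fixedSubfield (H ⊓ stabilizer G θ)) : τ ^ q • z = z := by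
  rw [S.smul_eq_pow_smul (i := 0) (H.pow_mem S.gen_mem q) (by
    rw [S.pow_smul, S.prim.pow_eq_one, pow_zero]) hz, pow_zero, one_smul]

lemma smul_mem {z : Ω} (hz : z ∈ fixedSubfield (H ⊓ stabilizer G θ)) {σ : G} (hσ : σ ∈ H) :
    σ • z ∈ fixedSubfield (H ⊓ stabilizer G θ) := by
  intro ρ hρ
  obtain ⟨i, -, hi⟩ := S.exists_smul_eq hσ
  rw [← mul_smul, S.smul_eq_pow_smul (i := i) (H.mul_mem hρ.1 hσ) _ hz,
    S.smul_eq_pow_smul hσ hi hz]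
  rw [mul_smul, hi, smul_mul', smul_pow', S.mem ρ hρ.1, mem_stabilizer_iff.1 hρ.2]

lemma smul_tr {z : Ω} (hz : z ∈ fixedSubfield (H ⊓ stabilizer G θ)) : τ • tr q τ z = tr q τ z := by
  rw [tr, Finset.smul_sum]
  have h1 := Finset.sum_range_succ (fun j => τ ^ j • z) q
  rw [Finset.sum_range_succ', S.gen_pow_smul hz, pow_zero, one_smul] at h1
  rw [← add_right_cancel h1]
  exact Finset.sum_congr rfl fun j _ => by rw [pow_succ', mul_smul]

lemma smul_nrm {z : Ω} (hz : z ∈ fixedSubfield (H ⊓ stabilizer G θ)) :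
    τ • nrm q τ z = nrm q τ z := by
  by_cases z0 : z = 0
  · subst z0; simp [nrm, S.pos.ne']
  rw [nrm, Finset.smul_prod']
  have h1 := Finset.prod_range_succ (fun j => τ ^ j • z) q
  rw [Finset.prod_range_succ', S.gen_pow_smul hz, pow_zero, one_smul] at h1
  rw [← mul_right_cancel₀ z0 h1]
  exact Finset.prod_congr rfl fun j _ => by rw [pow_succ', mul_smul]

lemma mem_of_gen_smul {z : Ω} (hz : z ∈ fixedSubfield (H ⊓ stabilizer G θ)) (h : τ • z = z) :
    z ∈ fixedSubfield H := by
  intro σ hσ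
  obtain ⟨i, -, hi⟩ := S.exists_smul_eq hσ
  rw [S.smul_eq_pow_smul hσ hi hz]
  clear hi
  induction i with
  | zero => simp
  | succ i ih => rw [pow_succ, mul_smul, h, ih]

lemma tr_mem {z : Ω} (hz : z ∈ fixedSubfield (H ⊓ stabilizer G θ)) : tr q τ z ∈ fixedSubfield H :=
  S.mem_of_gen_smul (sum_mem fun j _ => S.smul_mem hz (H.pow_mem S.gen_mem j)) (S.smul_tr hz)

lemma nrm_mem {z : Ω} (hz : z ∈ fixedSubfield (H ⊓ stabilizer G θ)) :
    nrm q τ z ∈ fixedSubfield H :=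
  S.mem_of_gen_smul (prod_mem fun j _ => S.smul_mem hz (H.pow_mem S.gen_mem j)) (S.smul_nrm hz)

lemma nrm_of_mem {c : Ω} (hc : c ∈ fixedSubfield H) : nrm q τ c = c ^ q := by
  rw [nrm, Finset.prod_congr rfl fun j _ => hc _ (H.pow_mem S.gen_mem j), Finset.prod_const,
    Finset.card_range]

lemma nrm_one_sub : nrm q τ (1 - θ) = 1 - θ ^ q := by
  have := S.prim.pow_sub_pow_eq_prod_range S.pos 1 θ
  rw [one_pow] at this
  rw [this, nrm]
  exact Finset.prod_congr rfl fun j _ => by rw [smul_sub, smul_one, S.pow_smul]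

omit S in
lemma theta_mem : θ ∈ fixedSubfield (H ⊓ stabilizer G θ) := fun _ h => h.2

lemma pow_eq_nrm (hq : Odd q) : nrm q τ θ = θ ^ q := by
  have := S.prim.pow_sub_pow_eq_prod_range S.pos 0 θ
  rw [zero_pow S.pos.ne', zero_sub] at this
  have h2 : ∏ j ∈ Finset.range q, (0 - ζ ^ j * θ) = - nrm q τ θ := by
    rw [nrm]
    simp only [zero_sub, ← S.pow_smul, Finset.prod_neg, Finset.card_range, hq.neg_one_pow]
    ring
  rw [h2] at this
  exact (neg_injective this).symm

/-- The expansion of an element in powers of `θ`. -/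
lemma eq_sum [CharZero Ω] (z : Ω) :
    z = ∑ i ∈ Finset.range q, (tr q τ (z * (θ ^ i)⁻¹) / q) * θ ^ i := by
  have hq : (q : Ω) ≠ 0 := Nat.cast_ne_zero.2 S.pos.ne'
  have h1 : ∀ i, (tr q τ (z * (θ ^ i)⁻¹) / q) * θ ^ i =
      ∑ j ∈ Finset.range q, (τ ^ j • z) / q * (ζ⁻¹ ^ j) ^ i := by
    intro i
    rw [tr, Finset.sum_div, Finset.sum_mul]
    refine Finset.sum_congr rfl fun j _ => ?_
    rw [smul_mul', smul_inv'', smul_pow', S.pow_smul, mul_pow, inv_pow, inv_pow]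
    have := S.ne_zero
    have := S.prim.ne_zero S.pos.ne'
    field_simp
  rw [Finset.sum_congr rfl fun i _ => h1 i, Finset.sum_comm]
  simp_rw [← Finset.mul_sum]
  rw [Finset.sum_eq_single_of_mem 0 (Finset.mem_range.2 S.pos)]
  · simp [hq]
  · intro j hj hj0
    have h2 : (ζ⁻¹ ^ j) ≠ 1 := by
      rw [inv_pow, Ne, inv_eq_one]
      exact S.prim.pow_ne_one_of_pos_of_lt hj0 (Finset.mem_range.1 hj)
    have h3 := mul_neg_geom_sum (ζ⁻¹ ^ j) q
    rw [← pow_mul, mul_comm j, pow_mul, inv_pow ζ q, S.prim.pow_eq_one, inv_one, one_pow,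
      sub_self] at h3
    rw [(mul_eq_zero.1 h3).resolve_left (sub_ne_zero.2 h2.symm), mul_zero]

lemma coeff_mem {z : Ω} (hz : z ∈ fixedSubfield (H ⊓ stabilizer G θ)) (i : ℕ) :
    tr q τ (z * (θ ^ i)⁻¹) / q ∈ fixedSubfield H :=
  (fixedSubfield H).div_mem (S.tr_mem (mul_mem hz ((fixedSubfield _).inv_mem
    (_root_.pow_mem theta_mem i)))) (natCast_mem _ q)

end KummerStep

namespace LocalAction

variable {p : ℕ} {G Ω : Type*} [Group G] [Field Ω] [MulSemiringAction G Ω]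
  {D : LocalAction p G Ω} {H : Subgroup G} {q : ℕ} {ζ θ : Ω} {τ : G}

lemma N_nrm {z : Ω} (hz : z ∈ D.E) : D.N (KummerStep.nrm q τ z) = D.N z ^ q := by
  rw [KummerStep.nrm, N_prod _ _ fun j _ => D.smul_mem _ hz,
    Finset.prod_congr rfl fun j _ => D.N_smul _ hz, Finset.prod_const, Finset.card_range]

lemma nrm_mem_E {z : Ω} (hz : z ∈ D.E) : KummerStep.nrm q τ z ∈ D.E :=
  prod_mem fun _ _ => D.smul_mem _ hz

lemma theta_mem_E (S : KummerStep H q ζ θ τ) (h : θ ^ q ∈ D.E) : θ ∈ D.E :=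
  D.mem_of_pow S.pos.ne' h

lemma tr_mem_E {z : Ω} (hz : z ∈ D.E) : KummerStep.tr q τ z ∈ D.E :=
  sum_mem fun _ _ => D.smul_mem _ hz

lemma nrm_mem_loc (S : KummerStep H q ζ θ τ) {z : Ω} (hz : z ∈ D.loc (H ⊓ stabilizer G θ)) :
    KummerStep.nrm q τ z ∈ D.loc H := ⟨S.nrm_mem hz.1, nrm_mem_E hz.2⟩

lemma N_tr_le {z : Ω} (hz : z ∈ D.E) : D.N (KummerStep.tr q τ z) ≤ D.N z :=
  N_sum_le _ _ (fun _ _ => D.smul_mem _ hz) (N_nonneg hz) fun _ _ => (D.N_smul _ hz).le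

end LocalAction

end KummerStep

section TameCollinear

open MulAction KummerStep

namespace LocalAction

variable {p : ℕ} {G Ω : Type*} [Group G] [Field Ω] [MulSemiringAction G Ω]
  {D : LocalAction p G Ω} {H : Subgroup G} {q : ℕ} {ζ θ : Ω} {τ : G}

lemma finiteIndex_inf (D : LocalAction p G Ω) [H.FiniteIndex] (θ : Ω) :
    (H ⊓ stabilizer G θ).FiniteIndex := by
  have := D.finiteIndex_stabilizer θ
  infer_instance

lemma loc_ne_zero_of_N {x : Ω} (h : D.N x = 1) : x ≠ 0 := fun h0 => by
  rw [h0, D.N_zero] at h; exact zero_ne_one h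

/-- In a tame Kummer extension of local fields, norms are powers of the generator up to `q`-th
powers: the case of a unit. -/
lemma exists_nrm_eq_of_unit [IsAlgClosed Ω] [CharZero Ω] [H.FiniteIndex] (hq : q.Prime)
    (hqp : q.Coprime p) (S : KummerStep H q ζ θ τ) (hθ : θ ^ q ∈ D.E)
    (hn : ¬ ∃ t ∈ D.loc H, t ^ q = θ ^ q) {e : Ω} (he : e ∈ D.loc (H ⊓ stabilizer G θ))
    (heN : D.N e = 1) : ∃ i : ℤ, ∃ s ∈ D.loc H, nrm q τ e = (θ ^ q) ^ i * s ^ q := by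
  have hnN : D.N (nrm q τ e) = 1 := by rw [N_nrm he.2, heN, one_pow]
  have hnm := nrm_mem_loc S he
  have hc : θ ^ q ∈ D.loc H := ⟨S.pow_mem, hθ⟩
  have hc0 : θ ^ q ≠ 0 := pow_ne_zero q S.ne_zero
  have hθE := theta_mem_E S hθ
  by_cases hd : ∃ d ∈ D.loc H, D.N d ^ q = D.N (θ ^ q)
  · obtain ⟨d, hd, hdN⟩ := hd
    have hdq : D.N (d ^ q) = D.N (θ ^ q) := by rw [N_pow hd.2, hdN]
    have hd0 : d ≠ 0 := by
      rintro rfl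
      rw [D.N_zero, zero_pow hq.ne_zero] at hdN
      exact hc0 ((N_eq_zero hθ).1 hdN.symm)
    obtain ⟨i, s, hs, h⟩ := exists_eq_zpow_mul_pow hq hqp S.prim
      (a := θ ^ q / d ^ q) (b := nrm q τ e) ((D.loc H).div_mem hc (pow_mem hd q)) hnm
      (by rw [N_div hθ (pow_mem hd.2 q), hdq, div_self ((N_eq_zero hθ).not.2 hc0)]) hnN
      (by
        rintro ⟨t, ht, h⟩
        exact hn ⟨t * d, mul_mem ht hd, by rw [mul_pow, h, div_mul_cancel₀ _ (pow_ne_zero q hd0)]⟩)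
    refine ⟨i, (d ^ i)⁻¹ * s, mul_mem ((D.loc H).inv_mem (zpow_mem hd i)) hs, ?_⟩
    rw [h, div_zpow, mul_pow, inv_pow, ← zpow_natCast (d ^ i), ← zpow_mul, ← zpow_natCast d,
      ← zpow_mul, mul_comm i]
    ring
  · -- the extension is ramified and `e` is congruent to an element of the base field
    have hq1 : D.N (q : Ω) = 1 := N_natCast_eq hqp
    have hqE : (q : Ω) ∈ D.E := natCast_mem _ q
    set a : ℕ → Ω := fun i => tr q τ (e * (θ ^ i)⁻¹) / q with ha
    have haE : ∀ i, a i ∈ D.loc H := fun i => ⟨S.coeff_mem he.1 i,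
      D.E.div_mem (tr_mem_E (mul_mem he.2 (D.E.inv_mem (pow_mem hθE i)))) hqE⟩
    have hle : ∀ i, D.N (a i * θ ^ i) ≤ 1 := fun i => by
      have hei : e * (θ ^ i)⁻¹ ∈ D.E := mul_mem he.2 (D.E.inv_mem (pow_mem hθE i))
      have h1 := N_tr_le (q := q) (τ := τ) hei
      have h2 := D.N_pos (pow_mem hθE i) (pow_ne_zero i S.ne_zero)
      rw [← div_eq_mul_inv, N_div he.2 (pow_mem hθE i), le_div_iff₀ h2, heN] at h1
      rw [D.N_mul (haE i).2 (pow_mem hθE i), ha]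
      simp only
      rwa [N_div (tr_mem_E hei) hqE, hq1, div_one, ← div_eq_mul_inv]
    have hlt : ∀ i, i ≠ 0 → i < q → D.N (a i * θ ^ i) < 1 := fun i hi0 hiq => by
      refine lt_of_le_of_ne (hle i) fun h1 => hd ?_
      have hai0 : a i ≠ 0 := by
        intro h0; rw [h0, zero_mul, D.N_zero] at h1; exact zero_ne_one h1
      have hcop : IsCoprime (i : ℤ) (q : ℤ) := by
        rw [Nat.isCoprime_iff_coprime]
        exact (Nat.Coprime.symm ((Nat.Prime.coprime_iff_not_dvd hq).2
          (Nat.not_dvd_of_pos_of_lt (Nat.pos_of_ne_zero hi0) hiq)))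
      obtain ⟨u, v, huv⟩ := hcop
      refine ⟨a i ^ (-u) * (θ ^ q) ^ v, mul_mem (zpow_mem (haE i) _) (zpow_mem hc _), ?_⟩
      have hA := D.N_pos (haE i).2 hai0
      have hT := D.N_pos hθE S.ne_zero
      rw [D.N_mul (haE i).2 (pow_mem hθE i), N_pow hθE] at h1
      rw [D.N_mul (zpow_mem (haE i) _).2 (zpow_mem hc _).2, N_zpow (haE i).2, N_zpow hθ, N_pow hθE]
      have h2 : D.N (a i) = D.N θ ^ (-(i : ℤ)) := by
        rw [zpow_neg, zpow_natCast]; exact eq_inv_of_mul_eq_one_left h1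
      rw [h2, ← zpow_natCast (D.N θ) q, ← zpow_natCast _ q, ← zpow_mul, ← zpow_mul,
        ← zpow_add₀ hT.ne', ← zpow_mul]
      congr 1
      linear_combination (q : ℤ) * huv
    have hsum : e = a 0 + ∑ i ∈ Finset.range (q - 1), a (i + 1) * θ ^ (i + 1) := by
      conv_lhs => rw [S.eq_sum e]
      obtain ⟨m, rfl⟩ : ∃ m, q = m + 1 := ⟨q - 1, (Nat.succ_pred_prime hq).symm⟩
      rw [Finset.sum_range_succ', add_comm]
      simp [ha]
    have hsmall : D.N (e - a 0) < 1 := by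
      rw [hsum, add_sub_cancel_left]
      exact N_sum_lt _ _ (fun i _ => mul_mem (haE _).2 (pow_mem hθE _)) one_pos fun i hi =>
        hlt _ (Nat.succ_ne_zero i) (by have := Finset.mem_range.1 hi; omega)
    have ha0N : D.N (a 0) = 1 := by
      rw [← heN]
      exact N_eq_of_sub_lt (haE 0).2 he.2 (by rw [N_sub_comm (haE 0).2 he.2, heN]; exact hsmall)
    have ha0 := loc_ne_zero_of_N ha0N
    have hδ : D.N (e / a 0 - 1) < 1 := by
      rw [show e / a 0 - 1 = (e - a 0) / a 0 by field_simp, N_div (sub_mem he.2 (haE 0).2) (haE 0).2,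
        ha0N, div_one]
      exact hsmall
    have hdE : e / a 0 ∈ D.loc (H ⊓ stabilizer G θ) :=
      (D.loc _).div_mem he (loc_anti inf_le_left (haE 0))
    obtain ⟨t, ht, h⟩ := exists_pow_eq_of_sub_one_lt hq hqp S.prim (nrm_mem_loc S hdE)
      (N_prod_sub_one_lt _ _ (fun j _ => D.smul_mem _ hdE.2) fun j _ => by
        rw [← smul_one (τ ^ j), ← smul_sub, D.N_smul _ (sub_mem hdE.2 (one_mem _))]
        exact hδ)
    refine ⟨0, a 0 * t, mul_mem (haE 0) ht, ?_⟩
    rw [mul_pow, h, zpow_zero, one_mul, ← S.nrm_of_mem (haE 0).1, ← nrm_mul, mul_div_cancel₀ _ ha0]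

lemma exists_nrm_eq [IsAlgClosed Ω] [CharZero Ω] [H.FiniteIndex] (hq : q.Prime) (hodd : Odd q)
    (hqp : q.Coprime p) (S : KummerStep H q ζ θ τ) (hθ : θ ^ q ∈ D.E)
    (hn : ¬ ∃ t ∈ D.loc H, t ^ q = θ ^ q) {e : Ω} (he : e ∈ D.loc (H ⊓ stabilizer G θ))
    (he0 : e ≠ 0) : ∃ i : ℤ, ∃ s ∈ D.loc H, nrm q τ e = (θ ^ q) ^ i * s ^ q := by
  have hθE := theta_mem_E S hθ
  have hq1 : D.N (q : Ω) = 1 := N_natCast_eq hqp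
  have hqE : (q : Ω) ∈ D.E := natCast_mem _ q
  set a : ℕ → Ω := fun i => tr q τ (e * (θ ^ i)⁻¹) / q with ha
  have haE : ∀ i, a i ∈ D.loc H := fun i => ⟨S.coeff_mem he.1 i,
    D.E.div_mem (tr_mem_E (mul_mem he.2 (D.E.inv_mem (pow_mem hθE i)))) hqE⟩
  have hle : ∀ i, D.N (a i * θ ^ i) ≤ D.N e := fun i => by
    have hei : e * (θ ^ i)⁻¹ ∈ D.E := mul_mem he.2 (D.E.inv_mem (pow_mem hθE i))
    have h1 := N_tr_le (q := q) (τ := τ) hei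
    have h2 := D.N_pos (pow_mem hθE i) (pow_ne_zero i S.ne_zero)
    rw [← div_eq_mul_inv, N_div he.2 (pow_mem hθE i), le_div_iff₀ h2] at h1
    rw [D.N_mul (haE i).2 (pow_mem hθE i), ha]
    simp only
    rwa [N_div (tr_mem_E hei) hqE, hq1, div_one, ← div_eq_mul_inv]
  have heN := D.N_pos he.2 he0
  obtain ⟨i, -, hi⟩ : ∃ i ∈ Finset.range q, D.N e ≤ D.N (a i * θ ^ i) := by
    by_contra! hcon
    have := N_sum_lt (D := D) (Finset.range q) (fun i => a i * θ ^ i)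
      (fun i _ => mul_mem (haE _).2 (pow_mem hθE _)) heN hcon
    rw [← S.eq_sum e] at this
    exact lt_irrefl _ this
  have hiN := le_antisymm (hle i) hi
  have hb : a i * θ ^ i ∈ D.loc (H ⊓ stabilizer G θ) :=
    mul_mem (loc_anti inf_le_left (haE i)) (_root_.pow_mem (show θ ∈ D.loc _ from ⟨theta_mem, hθE⟩) i)
  have hb0 : a i * θ ^ i ≠ 0 := fun h0 => by rw [h0, D.N_zero] at hiN; exact heN.ne hiN
  obtain ⟨j, s, hs, h⟩ := exists_nrm_eq_of_unit hq hqp S hθ hn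
    (e := e / (a i * θ ^ i)) ((D.loc _).div_mem he hb)
    (by rw [N_div he.2 hb.2, hiN, div_self heN.ne'])
  refine ⟨j + i, a i * s, mul_mem (haE i) hs, ?_⟩
  calc nrm q τ e = nrm q τ (a i) * nrm q τ θ ^ i * nrm q τ (e / (a i * θ ^ i)) := by
        rw [← nrm_pow, ← nrm_mul, ← nrm_mul, mul_div_cancel₀ _ hb0]
    _ = _ := by
        rw [h, S.nrm_of_mem (haE i).1, S.pow_eq_nrm hodd,
          zpow_add₀ (pow_ne_zero q S.ne_zero), zpow_natCast]
        ring

/-- If `x` is not a `q`-th power then `1 - x` is a power of `x` up to `q`-th powers. -/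
lemma exists_one_sub_eq [IsAlgClosed Ω] [CharZero Ω] [H.FiniteIndex] (hq : q.Prime) (hodd : Odd q)
    (D : LocalAction p G Ω)
    (hqp : q.Coprime p) (hζ : IsPrimitiveRoot ζ q) (hζH : ζ ∈ fixedSubfield H) {x : Ω}
    (hx : x ∈ fixedSubfield H) (hn : ¬ ∃ t ∈ fixedSubfield H, t ^ q = x) (x1 : x ≠ 1) :
    ∃ i : ℤ, ∃ s ∈ fixedSubfield H, 1 - x = x ^ i * s ^ q := by
  have x0 : x ≠ 0 := by rintro rfl; exact hn ⟨0, zero_mem _, zero_pow hq.ne_zero⟩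
  obtain ⟨c, hc, c0, y, hy, y0, rfl⟩ := D.exists_eq_mul_pow hx x0 hq.ne_zero
  obtain ⟨t, rfl⟩ := IsAlgClosed.exists_pow_nat_eq c hq.pos
  have t0 : t ≠ 0 := by rintro rfl; exact c0 (zero_pow hq.ne_zero)
  have htH : t ∉ fixedSubfield H := fun ht => hn ⟨t * y, mul_mem ht hy, mul_pow _ _ _⟩
  obtain ⟨τ, hτ, hτt⟩ : ∃ τ ∈ H, τ • t ≠ t := by
    rw [mem_fixedSubfield] at htH; push Not at htH; exact htH
  set ω := τ • t / t with hω
  have hωq : ω ^ q = 1 := by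
    rw [hω, div_pow, ← smul_pow', hc.1 τ hτ, div_self c0]
  have hω1 : ω ≠ 1 := by rwa [hω, Ne, div_eq_one_iff_eq t0]
  have hωp := IsPrimitiveRoot.of_pow_prime_eq_one hq hωq hω1
  have : NeZero q := ⟨hq.ne_zero⟩
  obtain ⟨i, -, hi⟩ := hζ.eq_pow_of_pow_eq_one hωq
  have hωH : ω ∈ fixedSubfield H := hi ▸ pow_mem hζH i
  have hτω : τ • t = ω * t := by rw [hω, div_mul_cancel₀ _ t0]
  have S : KummerStep H q ω t τ := ⟨hq.pos, hωp, hωH, t0, hc.1, hτ, hτω⟩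
  have S' : KummerStep H q ω (t * y) τ := ⟨hq.pos, hωp, hωH, mul_ne_zero t0 y0, by
    rw [mul_pow]; exact hx, hτ, by rw [smul_mul', hy τ hτ, hτω, mul_assoc]⟩
  have hfi := D.finiteIndex_inf (H := H) t
  have hty : t * y ∈ fixedSubfield (H ⊓ stabilizer G t) :=
    mul_mem theta_mem (fixedSubfield_anti inf_le_left hy)
  have h10 : 1 - t * y ≠ 0 := by
    intro h0
    rw [sub_eq_zero] at h0
    exact x1 (by rw [← mul_pow, ← h0, one_pow])
  obtain ⟨e, he, e0, w, hw, w0, hew⟩ := D.exists_eq_mul_pow (sub_mem (one_mem _) hty) h10 hq.ne_zero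
  obtain ⟨j, s, hs, h⟩ := exists_nrm_eq hq hodd hqp S hc.2 (by
    rintro ⟨u, hu, h⟩
    exact hn ⟨u * y, mul_mem hu.1 hy, by rw [mul_pow, h]⟩) he e0
  refine ⟨j, s * nrm q τ w * (y ^ j)⁻¹, mul_mem (mul_mem hs.1 (S.nrm_mem hw))
    ((fixedSubfield H).inv_mem (zpow_mem hy j)), ?_⟩
  rw [← mul_pow, ← S'.nrm_one_sub, hew, nrm_mul, nrm_pow, h]
  have hyj : y ^ j ≠ 0 := zpow_ne_zero j y0
  have e2 : ((t * y) ^ q) ^ j = (t ^ q) ^ j * (y ^ j) ^ q := by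
    rw [mul_pow, mul_zpow]
    congr 1
    rw [← zpow_natCast, ← zpow_natCast, ← zpow_mul, ← zpow_mul, mul_comm]
  rw [e2, mul_pow (s * _), inv_pow, mul_pow s]
  field_simp

end LocalAction

end TameCollinear

section Residue

open MulAction

namespace LocalAction

variable {p : ℕ} {G Ω : Type*} [Group G] [Field Ω] [MulSemiringAction G Ω]

/-- The ring of integers of the local field at level `H`. -/
def int (D : LocalAction p G Ω) (H : Subgroup G) : Subring Ω where
  carrier := {x | x ∈ D.loc H ∧ D.N x ≤ 1}
  mul_mem' hx hy := ⟨mul_mem hx.1 hy.1, by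
    rw [D.N_mul hx.1.2 hy.1.2]; exact mul_le_one₀ hx.2 (N_nonneg hy.1.2) hy.2⟩
  one_mem' := ⟨one_mem _, N_one.le⟩
  add_mem' hx hy := ⟨add_mem hx.1 hy.1, (D.N_add hx.1.2 hy.1.2).trans (max_le hx.2 hy.2)⟩
  zero_mem' := ⟨zero_mem _, by rw [D.N_zero]; exact zero_le_one⟩
  neg_mem' hx := ⟨neg_mem hx.1, by rw [N_neg hx.1.2]; exact hx.2⟩

lemma mem_int {D : LocalAction p G Ω} {H : Subgroup G} {x : Ω} :
    x ∈ D.int H ↔ x ∈ D.loc H ∧ D.N x ≤ 1 := Iff.rfl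

variable (D : LocalAction p G Ω) (H : Subgroup G) [hH : H.FiniteIndex]

/-- The residue field at a level. -/
lemma exists_residueHom : ∃ (κ : Type) (_ : Field κ) (_ : Finite κ) (r : D.int H →+* κ),
    Function.Surjective r ∧ ∀ x, r x = 0 ↔ D.N x < 1 := by
  obtain ⟨κ, _, _, r, r1, rsurj, r0, rhom⟩ := D.exists_residue H hH
  refine ⟨κ, inferInstance, inferInstance,
    { toFun := fun x => r x
      map_one' := r1
      map_zero' := (r0 0 (zero_mem _) (zero_mem (D.int H)).2).2 (by rw [D.N_zero]; exact one_pos)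
      map_add' := fun x y => (rhom x x.2.1 y y.2.1 x.2.2 y.2.2).1
      map_mul' := fun x y => (rhom x x.2.1 y y.2.1 x.2.2 y.2.2).2 },
    fun a => ?_, fun x => r0 x x.2.1 x.2.2⟩
  obtain ⟨x, hx, hN, e⟩ := rsurj a
  exact ⟨⟨x, hx, hN⟩, e⟩

/-- The multiplicity of the residue field acts trivially on units modulo principal units. -/
lemma exists_pow_sub_one_lt : ∃ n : ℕ, n ≠ 0 ∧ ∀ x ∈ D.loc H, D.N x = 1 → D.N (x ^ n - 1) < 1 := by
  obtain ⟨κ, _, _, r, -, r0⟩ := D.exists_residueHom H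
  refine ⟨Nat.card κˣ, Nat.card_pos.ne', fun x hx hN => ?_⟩
  set y : D.int H := ⟨x, hx, hN.le⟩ with hy
  have hr : r y ≠ 0 := fun h => by have := (r0 y).1 h; exact absurd hN this.ne
  have := (r0 (y ^ Nat.card κˣ - 1)).1 (by
    rw [map_sub, map_pow, map_one, sub_eq_zero]
    have h1 := congrArg Units.val (pow_card_eq_one' (x := Units.mk0 _ hr))
    rwa [Units.val_pow_eq_pow_val, Units.val_mk0, Units.val_one] at h1)
  simpa [hy] using this

/-- The residue characteristic is `p` and the residue field is perfect. -/
lemma exists_pow_p_sub_lt (hp : p.Prime) {x : Ω} (hx : x ∈ D.loc H) (hN : D.N x = 1) :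
    ∃ y ∈ D.loc H, D.N y = 1 ∧ D.N (x / y ^ p - 1) < 1 := by
  obtain ⟨κ, _, _, r, rs, r0⟩ := D.exists_residueHom H
  have : Fact p.Prime := ⟨hp⟩
  have : CharP κ p := by
    refine (CharP.charP_iff_prime_eq_zero hp).2 ?_
    have := (r0 (p : D.int H)).2 (by simpa using D.N_p)
    simpa using this
  obtain ⟨b, hb⟩ := (PerfectRing.bijective_frobenius (R := κ) (p := p)).2 (r ⟨x, hx, hN.le⟩)
  obtain ⟨y, rfl⟩ := rs b
  replace hb : r y ^ p = r ⟨x, hx, hN.le⟩ := hb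
  have hrx : r ⟨x, hx, hN.le⟩ ≠ 0 := fun h => by
    have := (r0 _).1 h; exact absurd hN this.ne
  have hyN : D.N y = 1 := by
    refine le_antisymm y.2.2 ?_
    by_contra! h
    rw [(r0 y).2 h, zero_pow hp.ne_zero] at hb
    exact hrx hb.symm
  refine ⟨y, y.2.1, hyN, ?_⟩
  have h1 := (r0 (⟨x, hx, hN.le⟩ - y ^ p)).1 (by
    rw [map_sub, map_pow, ← hb, sub_self])
  have y0 : (y : Ω) ≠ 0 := loc_ne_zero_of_N hyN
  rw [show x / (y : Ω) ^ p - 1 = (x - y ^ p) / y ^ p by field_simp,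
    N_div (sub_mem hx.2 (pow_mem y.2.1.2 p)) (pow_mem y.2.1.2 p), N_pow y.2.1.2, hyN, one_pow, div_one]
  simpa using h1

/-- There is a residue class outside the image of the Artin-Schreier map. -/
lemma exists_artinSchreier (hp : p.Prime) : ∃ α ∈ D.loc H, D.N α = 1 ∧
    ∀ x ∈ D.loc H, D.N x ≤ 1 → D.N (x ^ p - x - α) = 1 := by
  obtain ⟨κ, _, _, r, rs, r0⟩ := D.exists_residueHom H
  obtain ⟨b, hb⟩ : ∃ b : κ, ∀ x, x ^ p - x ≠ b := by
    by_contra! h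
    have hi : Function.Injective fun x : κ => x ^ p - x := Finite.injective_iff_surjective.2 h
    exact zero_ne_one (hi (a₁ := 0) (a₂ := 1) (by simp [hp.ne_zero]))
  obtain ⟨α, rfl⟩ := rs b
  refine ⟨α, α.2.1, le_antisymm α.2.2 ?_, fun x hx hxN => ?_⟩
  · by_contra! h
    refine hb 0 ?_
    rw [(r0 α).2 h]; simp [hp.ne_zero]
  · set y : D.int H := ⟨x, hx, hxN⟩ with hy
    refine le_antisymm ((y ^ p - y - α).2.2) ?_
    by_contra! h
    refine hb (r y) ?_
    have := (r0 (y ^ p - y - α)).2 h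
    rw [map_sub, map_sub, map_pow, sub_eq_zero] at this
    exact this

end LocalAction

end Residue

section QuotHom

variable {F : Type*} [Field F]

/-- The quotient of the multiplicative group of a field by a subgroup, with a zero added. -/
noncomputable def quotHom (T : Subgroup Fˣ) : F →*₀ WithZero (Fˣ ⧸ T) := by
  classical
  exact (WithZero.map' (QuotientGroup.mk' T)).comp
    (WithZero.withZeroUnitsEquiv (G := F)).symm.toMonoidWithZeroHom

lemma quotHom_unit (T : Subgroup Fˣ) (u : Fˣ) :
    quotHom T u = ((QuotientGroup.mk' T u : Fˣ ⧸ T) : WithZero (Fˣ ⧸ T)) := by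
  classical
  simp [quotHom, WithZero.withZeroUnitsEquiv]

lemma quotHom_eq_one {T : Subgroup Fˣ} {x : F} (hx : x ≠ 0) :
    quotHom T x = 1 ↔ Units.mk0 x hx ∈ T := by
  have := quotHom_unit T (Units.mk0 x hx)
  rw [Units.val_mk0] at this
  rw [this, ← WithZero.coe_one, WithZero.coe_inj]
  simp

lemma isRigidHom_quotHom {T : Subgroup Fˣ} (h1 : -1 ∈ T) (h2 : ∀ u, u ^ 2 ∈ T → u ∈ T)
    (h3 : ∀ u v : Fˣ, u ∉ T → 1 + (u : F) = v → v ∈ T ∨ v / u ∈ T) : IsRigidHom (M := WithZero (Fˣ ⧸ T)) (quotHom T) where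
  map_neg_one := by
    rw [quotHom_eq_one (neg_ne_zero.2 one_ne_zero)]
    convert h1
    ext; simp
  sq x hx := by
    have x0 : x ≠ 0 := by
      rintro rfl
      rw [map_zero] at hx
      exact zero_ne_one ((zero_pow (M₀ := WithZero (Fˣ ⧸ T)) two_ne_zero).symm.trans hx)
    rw [← map_pow, quotHom_eq_one (pow_ne_zero 2 x0)] at hx
    rw [quotHom_eq_one x0]
    refine h2 _ ?_
    convert hx
    ext; simp
  one_add x hx h := by
    have hu := (quotHom_eq_one hx).not.1 h
    have h10 : 1 + x ≠ 0 := by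
      intro h0
      rw [add_comm, add_eq_zero_iff_eq_neg] at h0
      refine hu ?_
      convert h1
      ext; simpa using h0
    refine (h3 _ (Units.mk0 _ h10) hu rfl).imp (quotHom_eq_one h10).2 fun h4 => ?_
    have : quotHom T ((1 + x) / x) = 1 := by
      rw [quotHom_eq_one (div_ne_zero h10 hx)]
      convert h4
      ext; simp
    rwa [map_div₀, div_eq_one_iff_eq ((map_ne_zero _).2 hx)] at this

/-- In a finite field with a primitive `ℓ`-th root of unity the `ℓ`-th powers are not rigid. -/
lemma exists_not_pow_of_finite {κ : Type*} [Field κ] [Finite κ] {l : ℕ} (hl : l.Prime)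
    (hodd : Odd l) {ζ : κ} (hζ : IsPrimitiveRoot ζ l) :
    ∃ ε v : κ, ε ≠ 0 ∧ v ≠ 0 ∧ 1 + ε = v ∧ (∀ t, t ^ l ≠ ε) ∧ (∀ t, t ^ l ≠ v) ∧
      ∀ t, ε * t ^ l ≠ v := by
  by_contra! hcon
  set T : Subgroup κˣ := (powMonoidHom l : κˣ →* κˣ).range with hT
  have hmem : ∀ u : κˣ, u ∈ T ↔ ∃ t : κ, t ^ l = u := fun u => by
    constructor
    · rintro ⟨t, rfl⟩; exact ⟨t, by simp⟩
    · rintro ⟨t, ht⟩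
      have t0 : t ≠ 0 := by
        rintro rfl; rw [zero_pow hl.ne_zero] at ht; exact u.ne_zero ht.symm
      exact ⟨Units.mk0 t t0, by ext; simpa using ht⟩
  have hf : IsRigidHom (M := WithZero (κˣ ⧸ T)) (quotHom T) := isRigidHom_quotHom
    ((hmem _).2 ⟨-1, by simp [hodd.neg_one_pow]⟩)
    (fun u hu => by
      obtain ⟨m, rfl⟩ := hodd
      have h1 : u ^ (2 * m + 1) ∈ T := ⟨u, rfl⟩
      rw [pow_succ, pow_mul] at h1
      exact (T.mul_mem_cancel_left (T.pow_mem hu m)).1 h1)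
    (fun u v hu huv => by
      rw [hmem] at hu ⊢
      push Not at hu
      by_cases hv : ∃ t : κ, t ^ l = v
      · exact Or.inl hv
      push Not at hv
      obtain ⟨t, ht⟩ := hcon u v u.ne_zero v.ne_zero huv hu hv
      refine Or.inr ((hmem _).2 ⟨t, ?_⟩)
      rw [Units.val_div_eq_div_val, ← ht, mul_div_cancel_left₀ _ u.ne_zero])
  have hne : ∃ u : κˣ, u ∉ T := by
    by_contra! h
    have hs : Function.Surjective (powMonoidHom l : κˣ →* κˣ) := fun u => h u
    have hi := Finite.injective_iff_surjective.2 hs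
    have hu := (hζ.isUnit hl.ne_zero).unit_spec
    have := @hi (hζ.isUnit hl.ne_zero).unit 1 (by ext; simp [hζ.pow_eq_one])
    apply hζ.ne_one hl.one_lt
    rw [← hu, this, Units.val_one]
  obtain ⟨u, hu⟩ := hne
  have key : ∀ x : κ, ¬ RigidMax (M := WithZero (κˣ ⧸ T)) (quotHom T) x := fun x hx => by
    have hpow : ∀ n : ℕ, RigidMax (M := WithZero (κˣ ⧸ T)) (quotHom T) (x ^ (n + 1)) := fun n => by
      induction n with
      | zero => simpa using hx
      | succ n ih => rw [pow_succ]; exact hf.max_mul ih hx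
    have x0 := IsRigidHom.max_ne_zero hx
    have h1 := hpow (Nat.card κˣ - 1)
    rw [Nat.sub_add_cancel Nat.card_pos] at h1
    have h2 := congrArg Units.val (pow_card_eq_one' (x := Units.mk0 _ x0))
    rw [Units.val_pow_eq_pow_val, Units.val_mk0, Units.val_one] at h2
    rw [h2] at h1
    exact IsRigidHom.not_max_one h1
  rcases hf.small_or_inv u.ne_zero (fun h => hu (by
    rw [quotHom_eq_one u.ne_zero] at h; simpa using h)) with h | h
  · exact key _ (Or.inl h)
  · exact key _ (Or.inl h)

end QuotHom

section PowerClass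

variable {L : Type*} [Field L]

/-- The multiplicative group of a field modulo `l`-th powers, written additively. -/
def PowerClassGroup (L : Type*) [Field L] (l : ℕ) : Type _ :=
  Additive (Lˣ ⧸ (powMonoidHom l : Lˣ →* Lˣ).range)

instance (L : Type*) [Field L] (l : ℕ) : AddCommGroup (PowerClassGroup L l) :=
  inferInstanceAs (AddCommGroup (Additive (Lˣ ⧸ (powMonoidHom l : Lˣ →* Lˣ).range)))

/-- The class of a unit modulo `l`-th powers. -/
def powerClassHom (L : Type*) [Field L] (l : ℕ) : Additive Lˣ →+ PowerClassGroup L l :=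
  MonoidHom.toAdditive (QuotientGroup.mk' (powMonoidHom l : Lˣ →* Lˣ).range)

lemma powerClassHom_eq_zero {L : Type*} [Field L] {l : ℕ} {u : Lˣ} :
    powerClassHom L l (Additive.ofMul u) = 0 ↔ ∃ t : Lˣ, t ^ l = u :=
  QuotientGroup.eq_one_iff (N := (powMonoidHom l : Lˣ →* Lˣ).range) u

open Classical in
/-- The class of a field element modulo `l`-th powers (and `0` at `0`). -/
noncomputable def powerClass (l : ℕ) (x : L) : PowerClassGroup L l :=
  if h : x = 0 then 0 else powerClassHom L l (Additive.ofMul (Units.mk0 x h))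

lemma powerClass_mul (l : ℕ) {x y : L} (hx : x ≠ 0) (hy : y ≠ 0) :
    powerClass l (x * y) = powerClass l x + powerClass l y := by
  rw [powerClass, powerClass, powerClass, dif_neg hx, dif_neg hy, dif_neg (mul_ne_zero hx hy),
    ← map_add, ← ofMul_mul, Units.mk0_mul]

lemma powerClass_one (l : ℕ) : powerClass l (1 : L) = 0 := by
  have := powerClass_mul (L := L) l one_ne_zero one_ne_zero
  rw [mul_one] at this
  simpa using this

lemma powerClass_pow (l : ℕ) {x : L} (hx : x ≠ 0) (n : ℕ) :
    powerClass l (x ^ n) = n • powerClass l x := by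
  induction n with
  | zero => simp [powerClass_one]
  | succ n ih => rw [pow_succ, powerClass_mul l (pow_ne_zero n hx) hx, ih, succ_nsmul]

lemma powerClass_inv (l : ℕ) {x : L} (hx : x ≠ 0) : powerClass l x⁻¹ = - powerClass l x := by
  rw [eq_neg_iff_add_eq_zero, ← powerClass_mul l (inv_ne_zero hx) hx, inv_mul_cancel₀ hx,
    powerClass_one]

lemma powerClass_zpow (l : ℕ) {x : L} (hx : x ≠ 0) (n : ℤ) :
    powerClass l (x ^ n) = n • powerClass l x := by
  obtain ⟨m, rfl | rfl⟩ := n.eq_nat_or_neg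
  · rw [zpow_natCast, powerClass_pow l hx, natCast_zsmul]
  · rw [zpow_neg, zpow_natCast, powerClass_inv l (pow_ne_zero m hx), powerClass_pow l hx, neg_zsmul,
      natCast_zsmul]

lemma powerClass_eq_zero {l : ℕ} (hl : l ≠ 0) {x : L} (hx : x ≠ 0) :
    powerClass l x = 0 ↔ ∃ t, t ^ l = x := by
  rw [powerClass, dif_neg hx, powerClassHom_eq_zero]
  constructor
  · rintro ⟨t, ht⟩
    exact ⟨t, by simpa using congrArg Units.val ht⟩
  · rintro ⟨t, ht⟩
    have t0 : t ≠ 0 := by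
      rintro rfl; rw [zero_pow hl] at ht; exact hx ht.symm
    exact ⟨Units.mk0 t t0, by ext; simpa using ht⟩

lemma nsmul_powerClass (l : ℕ) (v : PowerClassGroup L l) : l • v = 0 := by
  obtain ⟨u, rfl⟩ : ∃ u : Lˣ, powerClassHom L l (Additive.ofMul u) = v :=
    QuotientGroup.mk'_surjective (powMonoidHom l : Lˣ →* Lˣ).range v
  rw [← map_nsmul, ← ofMul_pow, powerClassHom_eq_zero]
  exact ⟨u, rfl⟩

/-- A field in which `1 - x` is always a power of `x` up to `l`-th powers, unless `x` is an `l`-th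
power, cannot have independent `x` and `z` such that `1 + x` and `1 + z` are in general position. -/
theorem false_of_one_sub_eq {l : ℕ} (hl : l.Prime) (hodd : Odd l)
    (hK : ∀ x : L, (¬ ∃ t, t ^ l = x) → x ≠ 1 → ∃ i : ℤ, ∃ s, 1 - x = x ^ i * s ^ l)
    {x z : L} (x0 : x ≠ 0) (z0 : z ≠ 0) (x1 : 1 + x ≠ 0) (z1 : 1 + z ≠ 0) (xz : x + z ≠ 0)
    (hind : ∀ a b : ℤ, (∃ t, t ^ l = x ^ a * z ^ b) → (l : ℤ) ∣ a ∧ (l : ℤ) ∣ b)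
    (hx1 : ¬ ∃ t, t ^ l = 1 + x) (hx2 : ¬ ∃ t, t ^ l = (1 + x) / x)
    (hz1 : ¬ ∃ t, t ^ l = 1 + z) (hz2 : ¬ ∃ t, t ^ l = (1 + z) / z)
    (nx : ∀ n : ℕ, n • x + 1 ≠ 0) (nxz : ∀ n : ℕ, n • x + 1 + z ≠ 0) : False := by
  have : Fact l.Prime := ⟨hl⟩
  let : Module (ZMod l) (PowerClassGroup L l) :=
    AddCommGroup.zmodModule (nsmul_powerClass l)
  have hmul : ∀ {x y : L}, x ≠ 0 → y ≠ 0 →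
    powerClass l (x * y) = powerClass l x + powerClass l y := powerClass_mul l
  have hzpow : ∀ {x : L} (n : ℤ), x ≠ 0 → powerClass l (x ^ n) = (n : ZMod l) • powerClass l x :=
    fun n hx => by rw [powerClass_zpow l hx, Int.cast_smul_eq_zsmul]
  have hpow : ∀ t : L, t ≠ 0 → powerClass l (t ^ l) = 0 := fun t ht =>
    (powerClass_eq_zero hl.ne_zero (pow_ne_zero l ht)).2 ⟨t, rfl⟩
  have hdiv : ∀ {x y : L}, x ≠ 0 → y ≠ 0 →
      powerClass l (x / y) = powerClass l x - powerClass l y := fun hx hy => by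
    rw [div_eq_mul_inv, hmul hx (inv_ne_zero hy), powerClass_inv l hy, sub_eq_add_neg]
  have hneg1 : powerClass l (-1 : L) = 0 :=
    (powerClass_eq_zero hl.ne_zero (neg_ne_zero.2 one_ne_zero)).2 ⟨-1, hodd.neg_one_pow⟩
  have hneg : ∀ x : L, powerClass l (-x) = powerClass l x := fun x => by
    by_cases hx : x = 0
    · rw [hx, neg_zero]
    · rw [← neg_one_mul, hmul (neg_ne_zero.2 one_ne_zero) hx, hneg1, zero_add]
  have hK' : ∀ x : L, x ≠ 0 → 1 + x ≠ 0 → (¬ ∃ t, t ^ l = x) →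
      ∃ i : ZMod l, powerClass l (1 + x) = i • powerClass l x := fun x hx hx1 hn => by
    obtain ⟨i, s, h⟩ := hK (-x) (by
      rintro ⟨t, ht⟩
      exact hn ⟨-t, by rw [hodd.neg_pow, ht, neg_neg]⟩)
      (fun h => hx1 (by rw [← neg_neg x, h, add_neg_cancel]))
    rw [sub_neg_eq_add] at h
    have s0 : s ≠ 0 := by
      rintro rfl; rw [zero_pow hl.ne_zero, mul_zero] at h; exact hx1 h
    exact ⟨i, by rw [h, hmul (zpow_ne_zero i (neg_ne_zero.2 hx)) (pow_ne_zero l s0), hpow s s0,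
      add_zero, hzpow i (neg_ne_zero.2 hx), hneg]⟩
  have hcol : ∀ x y : L, x ≠ 0 → y ≠ 0 → x + y ≠ 0 → powerClass l x ≠ powerClass l y →
      ∃ i : ZMod l, powerClass l (x + y) = i • powerClass l x + (1 - i) • powerClass l y := by
    intro x y hx hy hxy hne
    obtain ⟨i, hi⟩ := hK' (x / y) (div_ne_zero hx hy)
      (by rw [show 1 + x / y = (x + y) / y by field_simp; ring]; exact div_ne_zero hxy hy) (by
        rw [← powerClass_eq_zero hl.ne_zero (div_ne_zero hx hy), hdiv hx hy, sub_eq_zero]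
        exact hne)
    refine ⟨i, ?_⟩
    rw [show 1 + x / y = (x + y) / y by field_simp; ring, hdiv hxy hy, hdiv hx hy, sub_eq_iff_eq_add]
      at hi
    rw [hi, smul_sub, sub_smul, one_smul]
    abel
  have hcop : ¬ (l : ℤ) ∣ 1 := fun h => hl.ne_one (by
    have := Int.le_of_dvd one_pos h
    have := hl.two_le
    omega)
  have hxn : ¬ ∃ t, t ^ l = x := fun ⟨t, ht⟩ =>
    hcop (hind 1 0 ⟨t, by rw [ht, zpow_one, zpow_zero, mul_one]⟩).1
  have hzn : ¬ ∃ t, t ^ l = z := fun ⟨t, ht⟩ =>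
    hcop (hind 0 1 ⟨t, by rw [ht, zpow_one, zpow_zero, one_mul]⟩).2
  obtain ⟨a, ha⟩ := hK' x x0 x1 hxn
  obtain ⟨b, hb⟩ := hK' z z0 z1 hzn
  have key : ∀ {u : L} {i : ZMod l}, u ≠ 0 → 1 + u ≠ 0 → (¬ ∃ t, t ^ l = 1 + u) →
      (¬ ∃ t, t ^ l = (1 + u) / u) → powerClass l (1 + u) = i • powerClass l u → i ≠ 0 ∧ i ≠ 1 := by
    intro u i u0 u1 h1 h2 h
    constructor
    · rintro rfl
      rw [zero_smul, powerClass_eq_zero hl.ne_zero u1] at h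
      exact h1 h
    · rintro rfl
      rw [one_smul, ← sub_eq_zero, ← hdiv u1 u0,
        powerClass_eq_zero hl.ne_zero (div_ne_zero u1 u0)] at h
      exact h2 h
  obtain ⟨a0, a1⟩ := key x0 x1 hx1 hx2 ha
  obtain ⟨b0, b1⟩ := key z0 z1 hz1 hz2 hb
  refine false_of_collinear (𝔽 := ZMod l) (f := powerClass l) hneg (powerClass_one l) hcol
    (by rw [add_comm]; exact ha) hb a0 a1 b0 b1 (fun c d h => ?_) x0 z0 z1 xz nx nxz
    ⟨((a - 1) / a).val, by rw [ZMod.natCast_val, ZMod.cast_id, div_mul_cancel₀ _ a0]⟩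
  obtain ⟨c, rfl⟩ := ZMod.intCast_surjective c
  obtain ⟨d, rfl⟩ := ZMod.intCast_surjective d
  rw [← hzpow c x0, ← hzpow d z0, ← hmul (zpow_ne_zero c x0) (zpow_ne_zero d z0),
    powerClass_eq_zero hl.ne_zero (mul_ne_zero (zpow_ne_zero c x0) (zpow_ne_zero d z0))] at h
  simpa [ZMod.intCast_zmod_eq_zero_iff_dvd] using hind c d h

end PowerClass

section Tame

open MulAction

lemma Subfield.coe_zpow' {Ω : Type*} [Field Ω] {L : Subfield Ω} (x : L) (n : ℤ) :
    ((x ^ n : L) : Ω) = (x : Ω) ^ n := map_zpow₀ L.subtype x n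

namespace LocalAction

variable {p : ℕ} {G Ω : Type*} [Group G] [Field Ω] [MulSemiringAction G Ω]
  (D : LocalAction p G Ω) (l : ℕ) (H : Subgroup G)

lemma exists_rigid_unit {D : LocalAction p G Ω} {l : ℕ} {H : Subgroup G} [IsAlgClosed Ω]
    [H.FiniteIndex] (hl : l.Prime) (hodd : Odd l) (hlp : l.Coprime p)
    {ζ : Ω} (hζ : IsPrimitiveRoot ζ l) (hζH : ζ ∈ fixedSubfield H) :
    ∃ ε ∈ D.loc H, D.N ε = 1 ∧ 1 + ε ≠ 0 ∧ (¬ ∃ t ∈ fixedSubfield H, t ^ l = ε) ∧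
      (¬ ∃ t ∈ fixedSubfield H, t ^ l = 1 + ε) ∧ ¬ ∃ t ∈ fixedSubfield H, t ^ l = (1 + ε) / ε := by
  obtain ⟨κ, _, _, r, rs, r0⟩ := D.exists_residueHom H
  have r1 : ∀ x : D.int H, r x ≠ 0 → D.N x = 1 := fun x hx =>
    le_antisymm x.2.2 (not_lt.1 fun h => hx ((r0 x).2 h))
  have hpw : ∀ {t c : Ω}, t ∈ fixedSubfield H → c ∈ D.loc H → D.N c = 1 → t ^ l = c →
      t ∈ D.int H := fun {t c} ht hc hN h => by
    have htE : t ∈ D.E := D.mem_of_pow hl.ne_zero (h ▸ hc.2)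
    exact ⟨⟨ht, htE⟩, (N_eq_one_of_pow htE hl.ne_zero (h ▸ hN)).le⟩
  have hζi := hpw hζH (one_mem _) N_one hζ.pow_eq_one
  have hζr : IsPrimitiveRoot (r ⟨ζ, hζi⟩) l := by
    refine IsPrimitiveRoot.of_pow_prime_eq_one hl ?_ fun h => hζ.ne_one hl.one_lt ?_
    · rw [← map_pow, ← map_one r]
      congr 1
      ext; exact hζ.pow_eq_one
    · refine eq_one_of_pow_eq_one hl hlp hζ.pow_eq_one ((r0 (⟨ζ, hζi⟩ - 1)).1 ?_)
      rw [map_sub, h, map_one, sub_self]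
  obtain ⟨e, v, he0, hv0, hev, h1, h2, h3⟩ := exists_not_pow_of_finite hl hodd hζr
  obtain ⟨ε, rfl⟩ := rs e
  have hεN := r1 _ he0
  have h1εN : D.N (1 + ε) = 1 := r1 (1 + ε) (by rw [map_add, map_one, hev]; exact hv0)
  have hε0 := loc_ne_zero_of_N hεN
  have h1ε : 1 + (ε : Ω) ∈ D.loc H := add_mem (one_mem _) ε.2.1
  refine ⟨ε, ε.2.1, hεN, loc_ne_zero_of_N h1εN, ?_, ?_, ?_⟩
  · rintro ⟨t, ht, h⟩
    refine h1 (r ⟨t, hpw ht ε.2.1 hεN h⟩) ?_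
    rw [← map_pow]; congr 1; ext; exact h
  · rintro ⟨t, ht, h⟩
    refine h2 (r ⟨t, hpw ht h1ε h1εN h⟩) ?_
    rw [← hev, ← map_pow, ← map_one r, ← map_add]; congr 1; ext; exact h
  · rintro ⟨t, ht, h⟩
    refine h3 (r ⟨t, hpw ht ((D.loc H).div_mem h1ε ε.2.1)
      (by rw [N_div h1ε.2 ε.2.1.2, h1εN, hεN, div_one]) h⟩) ?_
    rw [← hev, ← map_pow, ← map_one r, ← map_add, ← map_mul]; congr 1; ext
    change (ε : Ω) * t ^ l = 1 + ε
    rw [h, mul_div_cancel₀ _ hε0]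

/-- Products of local units and `l`-th powers. -/
def TameUnit (x : Ω) : Prop :=
  ∃ c ∈ D.loc H, D.N c = 1 ∧ ∃ s ∈ fixedSubfield H, s ≠ 0 ∧ x = c * s ^ l

/-- The subgroup of elements satisfying `TameUnit`. -/
def tameSubgroup : Subgroup (fixedSubfield H : Subfield Ω)ˣ where
  carrier := {u | D.TameUnit l H (u : (fixedSubfield H : Subfield Ω))}
  mul_mem' := by
    rintro u v ⟨c, hc, hN, s, hs, s0, h⟩ ⟨d, hd, hdN, t, ht, t0, h'⟩
    refine ⟨c * d, mul_mem hc hd, by rw [D.N_mul hc.2 hd.2, hN, hdN, one_mul], s * t,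
      mul_mem hs ht, mul_ne_zero s0 t0, ?_⟩
    push_cast
    rw [h, h']
    ring
  one_mem' := ⟨1, one_mem _, N_one, 1, one_mem _, one_ne_zero, by simp⟩
  inv_mem' := by
    rintro u ⟨c, hc, hN, s, hs, s0, h⟩
    refine ⟨c⁻¹, (D.loc H).inv_mem hc, by rw [N_inv hc.2, hN, inv_one], s⁻¹,
      (fixedSubfield H).inv_mem hs, inv_ne_zero s0, ?_⟩
    push_cast
    rw [h, mul_inv, inv_pow]

variable {D l H}

lemma mem_tameSubgroup {u : (fixedSubfield H : Subfield Ω)ˣ} :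
    u ∈ D.tameSubgroup l H ↔ D.TameUnit l H (u : (fixedSubfield H : Subfield Ω)) := Iff.rfl

lemma TameUnit.ne_zero {x : Ω} (h : D.TameUnit l H x) : x ≠ 0 := by
  obtain ⟨c, hc, hN, s, hs, s0, rfl⟩ := h
  exact mul_ne_zero (loc_ne_zero_of_N hN) (pow_ne_zero l s0)

lemma tameUnit_of_unit {c : Ω} (hc : c ∈ D.loc H) (hN : D.N c = 1) : D.TameUnit l H c :=
  ⟨c, hc, hN, 1, one_mem _, one_ne_zero, by simp⟩

lemma tameUnit_of_pow {x t : Ω} (ht : t ∈ fixedSubfield H) (hx : x ≠ 0) (hl : l ≠ 0)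
    (h : t ^ l = x) : D.TameUnit l H x :=
  ⟨1, one_mem _, N_one, t, ht, by rintro rfl; exact hx (by rw [← h, zero_pow hl]),
    by rw [h, one_mul]⟩

/-- If `x` is not a `TameUnit`, then `1 + x` is one, possibly after division by `x`. -/
lemma tame_one_add [IsAlgClosed Ω] [CharZero Ω] [H.FiniteIndex] (hl : l.Prime) (hodd : Odd l)
    (hlp : l.Coprime p) {ζ : Ω} (hζ : IsPrimitiveRoot ζ l) (hζH : ζ ∈ fixedSubfield H) {x : Ω}
    (hx : x ∈ fixedSubfield H) (x0 : x ≠ 0) (hn : ¬ D.TameUnit l H x) (x1 : 1 + x ≠ 0) :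
    D.TameUnit l H (1 + x) ∨ D.TameUnit l H ((1 + x) / x) := by
  by_cases hxE : x ∈ D.E
  · have hxl : x ∈ D.loc H := ⟨hx, hxE⟩
    rcases lt_trichotomy (D.N x) 1 with h | h | h
    · exact Or.inl (tameUnit_of_unit (add_mem (one_mem _) hxl)
        (by rw [N_add_eq (one_mem _) hxE (by rwa [N_one]), N_one]))
    · exact absurd (tameUnit_of_unit hxl h) hn
    · refine Or.inr (tameUnit_of_unit ((D.loc H).div_mem (add_mem (one_mem _) hxl) hxl) ?_)
      rw [N_div (add_mem (one_mem _) hxE) hxE, add_comm, N_add_eq hxE (one_mem _) (by rwa [N_one]),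
        div_self (zero_lt_one.trans h).ne']
  · by_contra! hcon
    obtain ⟨ε, hε, hεN, hε1, hn1, hn2, hn3⟩ := exists_rigid_unit (D := D) hl hodd hlp hζ hζH
    have hε0 := loc_ne_zero_of_N hεN
    have hsub : ∀ {y : (fixedSubfield H : Subfield Ω)}, (∃ t, t ^ l = y) ↔
        ∃ t ∈ fixedSubfield H, t ^ l = (y : Ω) := fun {y} =>
      ⟨fun ⟨t, h⟩ => ⟨t, t.2, by rw [← h]; rfl⟩, fun ⟨t, ht, h⟩ => ⟨⟨t, ht⟩, by ext; exact h⟩⟩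
    have hnE : ∀ {n : ℕ} {c : Ω}, c ∈ D.E → c ≠ 0 → n • x + c ≠ 0 := by
      intro n c hc c0 h
      rcases eq_or_ne n 0 with rfl | hn0
      · rw [zero_smul, zero_add] at h; exact c0 h
      · refine hxE ?_
        have hn0' : (n : Ω) ≠ 0 := Nat.cast_ne_zero.2 hn0
        rw [show x = -c / n by rw [nsmul_eq_mul] at h; field_simp; linear_combination h]
        exact D.E.div_mem (neg_mem hc) (natCast_mem _ n)
    have hno : ∀ a : ℤ, ¬ (l : ℤ) ∣ a → ∀ d t : Ω, d ∈ D.loc H → D.N d = 1 → t ∈ fixedSubfield H →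
        t ^ l ≠ x ^ a * d := by
      intro a ha d t hd hdN ht h
      have hcop : IsCoprime a (l : ℤ) := by
        rw [isCoprime_comm, Prime.coprime_iff_not_dvd (Nat.prime_iff_prime_int.1 hl)]
        exact ha
      obtain ⟨u, v, huv⟩ := hcop
      have d0 := loc_ne_zero_of_N hdN
      have t0 : t ≠ 0 := by
        rintro rfl
        rw [zero_pow hl.ne_zero] at h
        exact mul_ne_zero (zpow_ne_zero a x0) d0 h.symm
      refine hn ⟨(d ^ u)⁻¹, (D.loc H).inv_mem (zpow_mem hd u), by
        rw [N_inv (zpow_mem hd u).2, N_zpow hd.2, hdN, one_zpow, inv_one], t ^ u * x ^ v,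
        mul_mem (zpow_mem ht u) (zpow_mem hx v),
        mul_ne_zero (zpow_ne_zero u t0) (zpow_ne_zero v x0), ?_⟩
      have e1 : (t ^ u) ^ l = (x ^ a * d) ^ u := by
        rw [← h, ← zpow_natCast, ← zpow_natCast, ← zpow_mul, ← zpow_mul, mul_comm]
      have e2 : x = x ^ (a * u) * x ^ (v * l) := by
        rw [← zpow_add₀ x0, show a * u + v * l = 1 by linear_combination huv, zpow_one]
      rw [mul_pow, e1, mul_zpow, ← zpow_mul, ← zpow_natCast (x ^ v), ← zpow_mul]
      conv_lhs => rw [e2]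
      field_simp
    have hεz : ∀ b : ℤ, D.N (ε ^ b) = 1 := fun b => by rw [N_zpow hε.2, hεN, one_zpow]
    have hcast : ∀ a : (fixedSubfield H : Subfield Ω), a ≠ 0 ↔ (a : Ω) ≠ 0 := fun a => by
      rw [Ne, ← ZeroMemClass.coe_eq_zero]
    refine false_of_one_sub_eq hl hodd (L := (fixedSubfield H : Subfield Ω)) (x := ⟨x, hx⟩)
      (z := ⟨ε, hε.1⟩) (fun y hy y1 => ?_) ((hcast _).2 x0) ((hcast _).2 hε0) ((hcast _).2 x1)
      ((hcast _).2 hε1) ((hcast _).2 ?_) (fun a b h => ?_) ?_ ?_ (by rw [hsub]; exact hn2)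
      (by rw [hsub]; exact hn3) (fun n => (hcast _).2 ?_) (fun n => (hcast _).2 ?_)
    · rw [hsub] at hy
      obtain ⟨i, s, hs, h⟩ := exists_one_sub_eq hl hodd D hlp hζ hζH y.2 hy
        (fun h => y1 (by ext; exact h))
      exact ⟨i, ⟨s, hs⟩, by
        ext; simpa [Subfield.coe_zpow'] using h⟩
    · have := hnE (n := 1) hε.2 hε0; rwa [one_smul] at this
    · have hla : (l : ℤ) ∣ a := by
        by_contra ha
        obtain ⟨t, ht⟩ := h
        exact hno a ha (ε ^ b) t (zpow_mem hε b) (hεz b) t.2 (by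
          have := congrArg Subtype.val ht; simpa [Subfield.coe_zpow'] using this)
      refine ⟨hla, ?_⟩
      by_contra hb
      obtain ⟨a', rfl⟩ := hla
      have hcop : IsCoprime b (l : ℤ) := by
        rw [isCoprime_comm, Prime.coprime_iff_not_dvd (Nat.prime_iff_prime_int.1 hl)]
        exact hb
      obtain ⟨u, v, huv⟩ := hcop
      obtain ⟨t, ht⟩ := h
      have ht' : (t : Ω) ^ l = x ^ (l * a') * ε ^ b := by
        have := congrArg Subtype.val ht; simpa [Subfield.coe_zpow'] using this
      refine hn1 ⟨(t / x ^ a') ^ u * ε ^ v, mul_mem (zpow_mem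
        ((fixedSubfield H).div_mem t.2 (zpow_mem hx a')) u) (zpow_mem hε v).1, ?_⟩
      have e1 : ((t : Ω) / x ^ a') ^ l = ε ^ b := by
        have := zpow_ne_zero a' x0
        rw [div_pow, ht', mul_comm (l : ℤ), zpow_mul, zpow_natCast, mul_div_cancel_left₀]
        exact pow_ne_zero l this
      rw [mul_pow, ← zpow_natCast, ← zpow_mul, mul_comm u, zpow_mul, zpow_natCast, e1,
        ← zpow_natCast (ε ^ v), ← zpow_mul, ← zpow_mul, ← zpow_add₀ hε0,
        show b * u + v * l = 1 by linear_combination huv, zpow_one]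
    · rw [hsub]; rintro ⟨t, ht, h⟩; exact hcon.1 (tameUnit_of_pow ht x1 hl.ne_zero h)
    · rw [hsub]; rintro ⟨t, ht, h⟩
      exact hcon.2 (tameUnit_of_pow ht (div_ne_zero x1 x0) hl.ne_zero h)
    · exact hnE (one_mem _) one_ne_zero
    · have := hnE (n := n) (add_mem (one_mem D.E) hε.2) hε1
      rw [← add_assoc] at this
      exact this

end LocalAction

end Tame

section Wild

/-- A valuation `v` on a field of residue characteristic `p`, with a subring `O` of its valuation
ring containing an element `π`, and a multiplicative predicate `T` (containing the `p`-th powers)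
which behaves like a norm group: it almost contains the principal units, but no element
`π ^ j * (1 + δ) * s ^ p` with `j` prime to `p`. -/
structure WildDatum {L Γ : Type*} [Field L] [LinearOrderedCommGroupWithZero Γ] (v : Valuation L Γ)
    (O : Subring L) (π : L) (p : ℕ) (T : L → Prop) : Prop where
  prime : p.Prime
  int_le : ∀ x ∈ O, v x ≤ 1
  unif_mem : π ∈ O
  unif_ne_zero : π ≠ 0
  unif_lt : v π < 1
  p_le : v p ≤ v π
  mul : ∀ {x y}, T x → T y → T (x * y)
  pow : ∀ {x}, x ≠ 0 → T (x ^ p)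
  decomp : ∀ x, x ≠ 0 → ∃ j : ℤ, ∃ δ ∈ O, ∃ s, s ≠ 0 ∧ x = π ^ j * (1 + π * δ) * s ^ p
  dvd : ∀ (j : ℤ) (δ s : L), δ ∈ O → s ≠ 0 → T (π ^ j * (1 + π * δ) * s ^ p) → (p : ℤ) ∣ j
  line : ∃ β, v β = 1 ∧ ∀ y, v y ≤ 1 → ∃ a, v a ≤ 1 ∧
    (1 + β * y + y ^ 2 * a ≠ 0 → T (1 + β * y + y ^ 2 * a))
  hensel : ∃ M : ℕ, ∀ y, v y < 1 → T (1 + π ^ M * y)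

namespace WildDatum

variable {L Γ : Type*} [Field L] [LinearOrderedCommGroupWithZero Γ] {v : Valuation L Γ}
    {O : Subring L} {π : L} {p : ℕ} {T : L → Prop} (W : WildDatum v O π p T)
include W

lemma unif_pos : 0 < v π := zero_lt_iff.2 ((v.ne_zero_iff).2 W.unif_ne_zero)

lemma one_add {y : L} {n : ℕ} (h : v y ^ n ≤ v π) : T (1 + y) := by
  obtain ⟨β, hβ, hline⟩ := W.line
  obtain ⟨M, hM⟩ := W.hensel
  have hβ0 : β ≠ 0 := (v.ne_zero_iff).1 (by rw [hβ]; exact one_ne_zero)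
  have hy : v y < 1 := by
    by_contra! h1
    exact absurd (h.trans_lt W.unif_lt) (not_lt.2 (one_le_pow₀ h1))
  have key : ∀ m : ℕ, ∃ y', v y' ≤ v y ^ 2 ^ m ∧ (T (1 + y') → T (1 + y)) := by
    intro m
    induction m with
    | zero => exact ⟨y, by simp, id⟩
    | succ m ih =>
      obtain ⟨y', hy', hT⟩ := ih
      have hy'1 : v y' < 1 := hy'.trans_lt (pow_lt_one₀ zero_le hy (by positivity))
      have hY : v (y' / β) = v y' := by rw [map_div₀, hβ, div_one]
      obtain ⟨a, ha, hG⟩ := hline (y' / β) (by rw [hY]; exact hy'1.le)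
      set Q := 1 + β * (y' / β) + (y' / β) ^ 2 * a with hQ
      have h2 : v ((y' / β) ^ 2 * a) ≤ v y' ^ 2 := by
        rw [map_mul, map_pow, hY]
        exact mul_le_of_le_one_right' ha
      have h2' : v y' ^ 2 < 1 := pow_lt_one₀ zero_le hy'1 two_ne_zero
      have hQ1 : v Q = 1 := by
        rw [hQ, mul_div_cancel₀ _ hβ0, add_assoc]
        exact v.map_one_add_of_lt (v.map_add_lt hy'1 (h2.trans_lt h2'))
      have hQ0 : Q ≠ 0 := (v.ne_zero_iff).1 (by rw [hQ1]; exact one_ne_zero)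
      refine ⟨-((y' / β) ^ 2 * a) / Q, ?_, fun h => hT ?_⟩
      · rw [map_div₀, hQ1, div_one, Valuation.map_neg, pow_succ 2 m, pow_mul]
        exact h2.trans (pow_le_pow_left₀ zero_le hy' 2)
      · have := W.mul (hG hQ0) h
        rwa [show Q * (1 + -((y' / β) ^ 2 * a) / Q) = 1 + y' by
          rw [mul_add, mul_div_cancel₀ _ hQ0, hQ, mul_div_cancel₀ _ hβ0]; ring] at this
  obtain ⟨y', hy', hT⟩ := key (n * (M + 1))
  refine hT ?_
  have h3 : v y' ≤ v π ^ (M + 1) := calc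
    v y' ≤ v y ^ 2 ^ (n * (M + 1)) := hy'
    _ ≤ v y ^ (n * (M + 1)) := pow_le_pow_right_of_le_one' hy.le Nat.lt_two_pow_self.le
    _ ≤ _ := by rw [pow_mul]; exact pow_le_pow_left₀ zero_le h _
  have hp := pow_ne_zero M W.unif_ne_zero
  rw [show y' = π ^ M * (y' / π ^ M) by field_simp]
  refine hM _ ?_
  rw [map_div₀, map_pow, div_lt_iff₀ (pow_pos W.unif_pos M)]
  refine h3.trans_lt ?_
  rw [pow_succ, mul_comm]
  exact mul_lt_mul_of_pos_right W.unif_lt (pow_pos W.unif_pos M)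

lemma add_pow_sub {z : L} (hz : v z ≤ 1) : ∃ a, v a ≤ 1 ∧ (1 + z) ^ p = 1 + z ^ p + p * z * a := by
  obtain ⟨m, hm⟩ : ∃ m, p = m + 2 := ⟨p - 2, by have := W.prime.two_le; omega⟩
  refine ⟨∑ i ∈ Finset.range (m + 1), z ^ i * ((p.choose (i + 1) / p : ℕ) : L), ?_, ?_⟩
  · refine v.map_sum_le fun i _ => ?_
    rw [map_mul, map_pow]
    refine mul_le_one₀ (pow_le_one₀ zero_le hz) zero_le ?_
    generalize p.choose (i + 1) / p = n
    induction n with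
    | zero => simp
    | succ n ih => rw [Nat.cast_succ]; exact v.map_add_le ih (by simp)
  · rw [add_comm 1 z, add_pow, hm, Finset.sum_range_succ, Finset.sum_range_succ', ← hm]
    have : ∀ i ∈ Finset.range (m + 1), z ^ (i + 1) * 1 ^ (p - (i + 1)) * ((p.choose (i + 1) : ℕ) : L)
        = p * z * (z ^ i * ((p.choose (i + 1) / p : ℕ) : L)) := fun i hi => by
      have hd : p ∣ p.choose (i + 1) := W.prime.dvd_choose_self (Nat.succ_ne_zero i)
        (by have := Finset.mem_range.1 hi; omega)
      obtain ⟨d, hd⟩ := hd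
      rw [hd, Nat.mul_div_cancel_left _ W.prime.pos]
      push_cast
      ring
    rw [Finset.sum_congr rfl this, ← Finset.mul_sum]
    simp
    ring

lemma delta_lt {δ : L} (hδ : δ ∈ O) : v (π * δ) ≤ v π := by
  rw [map_mul]; exact mul_le_of_le_one_right' (W.int_le δ hδ)

lemma v_one_add {δ : L} (hδ : δ ∈ O) : v (1 + π * δ) = 1 :=
  v.map_one_add_of_lt ((W.delta_lt hδ).trans_lt W.unif_lt)

/-- Extract a `p`-th root modulo `π`. -/
lemma exists_pow_sub_le {x δ s : L} (hδ : δ ∈ O) (hx : v (1 + x) = 1)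
    (h : 1 + x = (1 + π * δ) * s ^ p) : v (s - 1) ≤ 1 ∧ v ((s - 1) ^ p - x) ≤ v π := by
  have hs : v s ^ p = 1 := by
    rw [h, map_mul, W.v_one_add hδ, one_mul, map_pow] at hx; exact hx
  have hs1 : v s = 1 := (pow_eq_one_iff_of_nonneg zero_le W.prime.ne_zero).1 hs
  have hz : v (s - 1) ≤ 1 := (v.map_sub_le hs1.le (by simp))
  obtain ⟨a, ha, h2⟩ := W.add_pow_sub hz
  refine ⟨hz, ?_⟩
  rw [add_sub_cancel] at h2
  rw [show (s - 1) ^ p - x = -(p * (s - 1) * a) - π * δ * s ^ p by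
    linear_combination -h2 - h]
  refine v.map_sub_le ?_ ?_
  · rw [Valuation.map_neg, map_mul, map_mul, mul_assoc]
    exact (mul_le_of_le_one_right' (mul_le_one₀ hz zero_le ha)).trans W.p_le
  · rw [map_mul, map_pow, hs, mul_one]; exact W.delta_lt hδ

lemma exists_of_dvd {x : L} {j : ℤ} (hj : (p : ℤ) ∣ j) {δ s : L} (hs : s ≠ 0)
    (h : x = π ^ j * (1 + π * δ) * s ^ p) : ∃ s, s ≠ 0 ∧ x = (1 + π * δ) * s ^ p := by
  obtain ⟨i, rfl⟩ := hj
  refine ⟨π ^ i * s, mul_ne_zero (zpow_ne_zero i W.unif_ne_zero) hs, ?_⟩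
  rw [h, mul_pow, mul_comm (p : ℤ), zpow_mul, zpow_natCast]
  ring

lemma unif_ne_pow (s : L) : v π ≠ v s ^ p := by
  intro h
  have hp0 := W.prime.ne_zero
  have hs0 : s ≠ 0 := by
    rintro rfl
    rw [map_zero, zero_pow hp0] at h
    exact W.unif_pos.ne' h
  obtain ⟨j, δ, hδ, t, t0, hst⟩ := W.decomp s hs0
  set τ := s ^ j * t with hτ
  have hτ0 : τ ≠ 0 := mul_ne_zero (zpow_ne_zero j hs0) t0
  have hsτ : v s = v τ ^ p := by
    conv_lhs => rw [hst]
    rw [map_mul, map_mul, W.v_one_add hδ, mul_one, map_zpow₀, h, hτ, map_mul, map_zpow₀, map_pow,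
      mul_pow, ← zpow_natCast (v s ^ j) p, ← zpow_natCast (v s) p, ← zpow_mul, ← zpow_mul,
      mul_comm (p : ℤ)]
  have hτ1 : v τ < 1 := by
    by_contra! h1
    have h2 := W.unif_lt
    rw [h, hsτ] at h2
    exact absurd h2 (not_lt.2 (one_le_pow₀ (one_le_pow₀ h1)))
  have hτp : 0 < v τ := zero_lt_iff.2 ((v.ne_zero_iff).2 hτ0)
  have hπτ : v π = v τ ^ (p * p) := by rw [h, hsτ, pow_mul]
  have hp2 := W.prime.two_le
  set u := π / s ^ p with hu
  have hsp := pow_ne_zero p hs0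
  have hu1 : v u = 1 := by
    rw [hu, map_div₀, map_pow, ← h, div_self W.unif_pos.ne']
  have h1τ : v (τ ^ p * u) < 1 := by
    rw [map_mul, hu1, mul_one, map_pow]; exact pow_lt_one₀ zero_le hτ1 hp0
  have h1 : v (1 + τ ^ p * u) = 1 := v.map_one_add_of_lt h1τ
  have hT : T (1 + τ ^ p * u) := W.one_add (n := p) (by
    rw [map_mul, hu1, mul_one, map_pow, hπτ, pow_mul])
  obtain ⟨i, δ, hδ, r, r0, hr⟩ := W.decomp (1 + τ ^ p * u)
    ((v.ne_zero_iff).1 (by rw [h1]; exact one_ne_zero))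
  obtain ⟨r, r0, hr⟩ := W.exists_of_dvd (W.dvd i δ r hδ r0 (hr ▸ hT)) r0 hr
  obtain ⟨-, hz⟩ := W.exists_pow_sub_le hδ h1 hr
  set z := r - 1
  have hlt : v π < v (τ ^ p * u) := by
    rw [map_mul, hu1, mul_one, map_pow, hπτ]
    exact pow_lt_pow_right_of_lt_one₀ hτp hτ1 (by nlinarith)
  have hzv : v (z ^ p) = v (τ ^ p * u) := by
    refine v.map_eq_of_sub_lt ?_
    exact hz.trans_lt hlt
  have hz0 : z ^ p ≠ 0 := (v.ne_zero_iff).1 (by rw [hzv]; exact (W.unif_pos.trans hlt).ne')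
  have hz0' : z ≠ 0 := fun h => hz0 (by rw [h, zero_pow hp0])
  have hT2 : T (1 + (τ ^ p * u - z ^ p) / z ^ p) := by
    refine W.one_add (n := 2) ?_
    have hpos : 0 < v τ ^ p := pow_pos hτp p
    have hv : v (z ^ p) = v τ ^ p := by rw [hzv, map_mul, hu1, mul_one, map_pow]
    rw [map_div₀, Valuation.map_sub_swap, hv]
    calc (v (z ^ p - τ ^ p * u) / v τ ^ p) ^ 2 ≤ (v τ ^ (p * (p - 1))) ^ 2 := by
          refine pow_le_pow_left₀ zero_le ?_ 2
          rw [div_le_iff₀ hpos, ← pow_add]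
          refine hz.trans ?_
          rw [hπτ, show p * (p - 1) + p = p * p by
            obtain ⟨m, rfl⟩ : ∃ m, p = m + 1 := ⟨p - 1, by omega⟩
            simp; ring]
      _ ≤ v π := by
          rw [← pow_mul, hπτ]
          refine pow_le_pow_right_of_le_one' hτ1.le ?_
          obtain ⟨m, rfl⟩ : ∃ m, p = m + 2 := ⟨p - 2, by omega⟩
          simp; nlinarith
  have hTπ : T (π ^ (1 : ℤ) * (1 + π * 0) * 1 ^ p) := by
    have := W.mul (W.pow (x := s * (z / τ)) (mul_ne_zero hs0 (div_ne_zero hz0' hτ0))) hT2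
    convert this using 1
    rw [zpow_one, mul_zero, add_zero, mul_one, one_pow, mul_one]
    have : (τ ^ p) ≠ 0 := pow_ne_zero p hτ0
    rw [mul_pow, div_pow, hu]
    field_simp
    ring
  have := W.dvd 1 0 1 (zero_mem O) one_ne_zero hTπ
  have := Int.le_of_dvd one_pos this
  omega

lemma exists_of_unit {x : L} (hx : v x = 1) : ∃ δ ∈ O, ∃ s, s ≠ 0 ∧ x = (1 + π * δ) * s ^ p := by
  obtain ⟨j, δ, hδ, s, s0, h⟩ := W.decomp x ((v.ne_zero_iff).1 (by rw [hx]; exact one_ne_zero))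
  refine ⟨δ, hδ, W.exists_of_dvd ?_ s0 h⟩
  by_contra hj
  have hcop : IsCoprime j (p : ℤ) := by
    rw [isCoprime_comm, Prime.coprime_iff_not_dvd (Nat.prime_iff_prime_int.1 W.prime)]
    exact hj
  obtain ⟨a, b, hab⟩ := hcop
  rw [h, map_mul, map_mul, W.v_one_add hδ, mul_one, map_zpow₀, map_pow] at hx
  refine W.unif_ne_pow (s ^ (-a) * π ^ b) ?_
  have hs : v s ≠ 0 := (v.ne_zero_iff).2 s0
  have h1 : v π ^ j = (v s ^ p)⁻¹ := eq_inv_of_mul_eq_one_left hx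
  rw [map_mul, map_zpow₀, map_zpow₀, mul_pow]
  conv_lhs => rw [← zpow_one (v π), ← hab, zpow_add₀ W.unif_pos.ne', mul_comm a, zpow_mul, h1]
  rw [zpow_mul, zpow_natCast, zpow_neg, inv_zpow, inv_pow, ← zpow_natCast (v s), ← zpow_mul,
    mul_comm, mul_comm (p : ℤ), zpow_mul, zpow_natCast, mul_comm]

theorem le_unif {y : L} (hy : v y < 1) : v y ≤ v π := by
  by_contra! h
  have key : ∀ y, v π < v y → v y < 1 → ∃ z, v y = v z ^ p := fun y h hy => by
    obtain ⟨δ, hδ, s, -, hs⟩ := W.exists_of_unit (v.map_one_add_of_lt hy)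
    obtain ⟨-, h2⟩ := W.exists_pow_sub_le hδ (v.map_one_add_of_lt hy) hs
    exact ⟨s - 1, by rw [← map_pow]; exact (v.map_eq_of_sub_lt (h2.trans_lt h)).symm⟩
  have y0 : 0 < v y := W.unif_pos.trans h
  obtain ⟨z, hz⟩ := key y h hy
  obtain ⟨z', hz'⟩ := key (π / y)
    (by rw [map_div₀, lt_div_iff₀ y0]; exact mul_lt_of_lt_one_right W.unif_pos hy)
    (by rw [map_div₀, div_lt_one₀ y0]; exact h)
  refine W.unif_ne_pow (z * z') ?_
  rw [map_mul, mul_pow, ← hz, ← hz', map_div₀, mul_div_cancel₀ _ y0.ne']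

theorem exists_sub_le {x : L} (hx : v x ≤ 1) : ∃ c ∈ O, v (x - c) ≤ v π := by
  have hπx : v (π * x) < 1 := by
    rw [map_mul]; exact (mul_le_of_le_one_right' hx).trans_lt W.unif_lt
  have h1 := v.map_one_add_of_lt hπx
  obtain ⟨δ, hδ, s, -, hs⟩ := W.exists_of_unit h1
  obtain ⟨hz1, hz⟩ := W.exists_pow_sub_le hδ h1 hs
  refine ⟨δ, hδ, ?_⟩
  set z := s - 1 with hzd
  have hz2 : v z < 1 := by
    by_contra! h
    have h3 : v (z ^ p) ≤ v π := by
      rw [show z ^ p = (z ^ p - π * x) + π * x by ring]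
      exact v.map_add_le hz (by rw [map_mul]; exact mul_le_of_le_one_right' hx)
    rw [map_pow] at h3
    exact absurd (h3.trans_lt W.unif_lt) (not_lt.2 (one_le_pow₀ h))
  have hz3 := W.le_unif hz2
  obtain ⟨a, ha, h4⟩ := W.add_pow_sub hz1
  rw [hzd, add_sub_cancel] at h4
  have h5 : π * (x - δ) = (1 + π * δ) * (z ^ p + p * z * a) := by
    rw [hzd]; linear_combination hs + (1 + π * δ) * h4
  have h6 : v (π * (x - δ)) ≤ v π * v π := by
    rw [h5, map_mul, W.v_one_add hδ, one_mul]
    refine v.map_add_le ?_ ?_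
    · rw [map_pow, ← sq]
      exact (pow_le_pow_right_of_le_one' hz2.le W.prime.two_le).trans
        (pow_le_pow_left₀ zero_le hz3 2)
    · rw [map_mul, map_mul]
      exact (mul_le_of_le_one_right' ha).trans (mul_le_mul' W.p_le hz3)
  rw [map_mul] at h6
  exact le_of_mul_le_mul_left h6 W.unif_pos

end WildDatum

end Wild

section TameRing

open MulAction

lemma Subgroup.mem_of_pow_of_coprime {A : Type*} [Group A] {T : Subgroup A} {u : A} {m n : ℕ}
    (hm : u ^ m ∈ T) (hn : u ^ n ∈ T) (h : m.Coprime n) : u ∈ T := by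
  have h1 : u ^ ((m : ℤ) * m.gcdA n + n * m.gcdB n) = u := by
    rw [← Nat.gcd_eq_gcd_ab, h.gcd_eq_one, Nat.cast_one, zpow_one]
  rw [← h1, zpow_add, zpow_mul, zpow_mul, zpow_natCast, zpow_natCast]
  exact T.mul_mem (T.zpow_mem hm _) (T.zpow_mem hn _)

namespace LocalAction

variable {p : ℕ} {G Ω : Type*} [Group G] [Field Ω] [MulSemiringAction G Ω]
  {D : LocalAction p G Ω} {l : ℕ} {H H' : Subgroup G}

/-- The conditions on a prime `l` and a level `H` under which the tame ring is defined. -/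
structure TameLevel (p l : ℕ) (Ω : Type*) [Field Ω] [MulSemiringAction G Ω] (H : Subgroup G) :
    Prop where
  finiteIndex : H.FiniteIndex
  prime : l.Prime
  odd : Odd l
  coprime : l.Coprime p
  exists_prim : ∃ ζ : Ω, IsPrimitiveRoot ζ l ∧ ζ ∈ fixedSubfield H

lemma TameLevel.anti (h : TameLevel p l Ω H) (hH' : H'.FiniteIndex) (hle : H' ≤ H) :
    TameLevel p l Ω H' := by
  obtain ⟨ζ, h1, h2⟩ := h.exists_prim
  exact ⟨hH', h.prime, h.odd, h.coprime, ζ, h1, fixedSubfield_anti hle h2⟩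

variable (D l H) in
/-- An element `x` which is not a `TameUnit`, such that `1 + x` is one. -/
def TameSmall (x : Ω) : Prop :=
  x ∈ fixedSubfield H ∧ x ≠ 0 ∧ ¬ D.TameUnit l H x ∧ D.TameUnit l H (1 + x)

variable (D l H) in
/-- The nonzero elements of the maximal ideal of the tame ring. -/
def TameMax (x : Ω) : Prop :=
  D.TameSmall l H x ∨ ∃ g h, D.TameSmall l H g ∧ D.TameSmall l H h ∧ x = g * h

lemma mk0_mem_tameSubgroup {x : (fixedSubfield H : Subfield Ω)} (hx : x ≠ 0) :
    Units.mk0 x hx ∈ D.tameSubgroup l H ↔ D.TameUnit l H (x : Ω) := Iff.rfl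

lemma tameUnit_of_pow_of_coprime {x : Ω} (hx : x ∈ fixedSubfield H) {m : ℕ} (hl : l ≠ 0)
    (hm : m.Coprime l) (h : D.TameUnit l H (x ^ m)) (x0 : x ≠ 0) : D.TameUnit l H x := by
  have hx0 : (⟨x, hx⟩ : (fixedSubfield H : Subfield Ω)) ≠ 0 := by
    rw [Ne, Subtype.ext_iff]; exact x0
  rw [← mk0_mem_tameSubgroup (D := D) (l := l) hx0]
  refine Subgroup.mem_of_pow_of_coprime (m := m) (n := l) ?_ ?_ hm
  · rw [mem_tameSubgroup]; push_cast; exact h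
  · rw [mem_tameSubgroup]; push_cast; exact tameUnit_of_pow hx (pow_ne_zero l x0) hl rfl

variable (D) in
lemma TameLevel.isRigidHom [IsAlgClosed Ω] [CharZero Ω] (h : TameLevel p l Ω H) :
    IsRigidHom (M := WithZero ((fixedSubfield H : Subfield Ω)ˣ ⧸ D.tameSubgroup l H))
      (quotHom (D.tameSubgroup l H)) := by
  refine isRigidHom_quotHom ?_ ?_ ?_
  · rw [mem_tameSubgroup]
    push_cast
    exact tameUnit_of_unit (neg_mem (one_mem _)) (by rw [N_neg (one_mem _), N_one])
  · intro u hu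
    refine Subgroup.mem_of_pow_of_coprime hu (n := l) ?_ (Nat.coprime_two_left.2 h.odd)
    rw [mem_tameSubgroup]
    push_cast
    exact tameUnit_of_pow u.1.2 (pow_ne_zero l (by simp)) h.prime.ne_zero rfl
  · intro u v hu huv
    have := h.finiteIndex
    obtain ⟨ζ, h1, h2⟩ := h.exists_prim
    rw [mem_tameSubgroup] at hu
    have huv' : (1 : Ω) + (u : (fixedSubfield H : Subfield Ω)) =
      (v : (fixedSubfield H : Subfield Ω)) := by rw [← huv]; push_cast; rfl
    have := tame_one_add h.prime h.odd h.coprime h1 h2 u.1.2 (by simp) hu (by rw [huv']; simp)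
    rw [huv'] at this
    rw [mem_tameSubgroup, mem_tameSubgroup]
    push_cast
    exact this

variable (D) in
/-- The tame valuation ring at a level. -/
noncomputable def tameRing [IsAlgClosed Ω] [CharZero Ω] (h : TameLevel p l Ω H) :
    ValuationSubring (fixedSubfield H : Subfield Ω) := (h.isRigidHom D).valuationSubring

lemma tameSmall_iff {x : (fixedSubfield H : Subfield Ω)} :
    RigidSmall (M := WithZero ((fixedSubfield H : Subfield Ω)ˣ ⧸ D.tameSubgroup l H))
      (quotHom (D.tameSubgroup l H)) x ↔ D.TameSmall l H x := by
  by_cases hx : x = 0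
  · simp [RigidSmall, TameSmall, hx]
  by_cases h1 : 1 + x = 0
  · rw [RigidSmall, TameSmall, h1]
    have : (1 : Ω) + x = 0 := by exact_mod_cast congrArg Subtype.val h1
    rw [this]
    simp only [map_zero, zero_ne_one, and_false, false_iff, not_and]
    exact fun _ _ _ h => h.ne_zero rfl
  rw [RigidSmall, TameSmall, quotHom_eq_one h1, Ne, Ne, quotHom_eq_one hx, mk0_mem_tameSubgroup,
    mk0_mem_tameSubgroup]
  push_cast
  simp [hx]

lemma tameMax_iff {x : (fixedSubfield H : Subfield Ω)} :
    RigidMax (M := WithZero ((fixedSubfield H : Subfield Ω)ˣ ⧸ D.tameSubgroup l H))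
      (quotHom (D.tameSubgroup l H)) x ↔ D.TameMax l H x := by
  rw [RigidMax, TameMax, tameSmall_iff]
  refine or_congr Iff.rfl ⟨?_, ?_⟩
  · rintro ⟨g, h, hg, hh, rfl⟩
    exact ⟨g, h, tameSmall_iff.1 hg, tameSmall_iff.1 hh, rfl⟩
  · rintro ⟨g, h, hg, hh, e⟩
    exact ⟨⟨g, hg.1⟩, ⟨h, hh.1⟩, tameSmall_iff.2 hg, tameSmall_iff.2 hh, Subtype.ext e⟩

variable (h : TameLevel p l Ω H)

lemma tameRing_valuation_lt_one [IsAlgClosed Ω] [CharZero Ω]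
    {x : (fixedSubfield H : Subfield Ω)} (hx : x ≠ 0) :
    (D.tameRing h).valuation x < 1 ↔ D.TameMax l H x := by
  have hv : (D.tameRing h).valuation x ≠ 0 := ((D.tameRing h).valuation.ne_zero_iff).2 hx
  rw [← tameMax_iff, ← not_le, ← inv_le_one₀ (zero_lt_iff.2 hv), ← map_inv₀,
    ValuationSubring.valuation_le_one_iff]
  have := IsRigidHom.mem_valuationSubring (h.isRigidHom D) (x := x⁻¹)
  rw [inv_inv] at this
  rw [tameRing, this, not_not]

lemma unif_not_tameUnit (hl : l ≠ 1) {π : Ω} (h0 : 0 < D.N π) (h1 : D.N π < 1)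
    (hπ' : ∀ c ∈ D.loc H, c ≠ 0 → ∃ j : ℤ, D.N c = D.N π ^ j) (hπ : π ∈ D.loc H) (hl0 : l ≠ 0) :
    ¬ D.TameUnit l H π := by
  rintro ⟨c, hc, hN, s, hs, s0, e⟩
  have c0 := loc_ne_zero_of_N hN
  have hsE : s ∈ D.E := D.mem_of_pow hl0 (by
    rw [show s ^ l = π / c by rw [e]; field_simp]; exact div_mem hπ.2 hc.2)
  obtain ⟨j, hj⟩ := hπ' s ⟨hs, hsE⟩ s0
  have h2 : D.N π ^ (1 : ℤ) = D.N π ^ (j * l) := by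
    rw [zpow_one, zpow_mul, ← hj, zpow_natCast]
    conv_lhs => rw [e, D.N_mul hc.2 (pow_mem hsE l), hN, one_mul, N_pow hsE]
  have h3 := zpow_right_injective₀ h0 h1.ne h2
  have : (l : ℤ) ∣ 1 := ⟨j, by rw [h3]; ring⟩
  exact hl (by exact_mod_cast Int.eq_one_of_dvd_one (by positivity) this)

lemma tameMax_of_N_lt {c : Ω} (hc : c ∈ D.loc H) (c0 : c ≠ 0) (hN : D.N c < 1)
    (h : TameLevel p l Ω H) : D.TameMax l H c := by
  have small : ∀ c ∈ D.loc H, c ≠ 0 → D.N c < 1 → ¬ D.TameUnit l H c → D.TameSmall l H c :=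
    fun c hc c0 hN hT => ⟨hc.1, c0, hT, tameUnit_of_unit (add_mem (one_mem _) hc)
      (by rw [N_add_eq (one_mem _) hc.2 (by rwa [N_one]), N_one])⟩
  by_cases hT : D.TameUnit l H c
  swap
  · exact Or.inl (small c hc c0 hN hT)
  obtain ⟨π, hπ, h0, h1, hπ'⟩ := D.exists_unif H h.finiteIndex
  have hπ0 : π ≠ 0 := fun h => by rw [h, D.N_zero] at h0; exact h0.false
  have hπT := unif_not_tameUnit h.prime.ne_one h0 h1 hπ' hπ h.prime.ne_zero
  have hcT : ¬ D.TameUnit l H (c / π) := by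
    intro hd
    refine hπT ?_
    have a1 : (⟨c, hc.1⟩ : (fixedSubfield H : Subfield Ω)) ≠ 0 := by
      rw [Ne, Subtype.ext_iff]; exact c0
    have a2 : (⟨π, hπ.1⟩ : (fixedSubfield H : Subfield Ω)) ≠ 0 := by
      rw [Ne, Subtype.ext_iff]; exact hπ0
    have a3 := (D.tameSubgroup l H).div_mem (x := Units.mk0 _ a1)
      (y := Units.mk0 _ a1 / Units.mk0 _ a2) hT (by rw [mem_tameSubgroup]; push_cast; exact hd)
    rwa [div_div_cancel] at a3
  refine Or.inr ⟨π, c / π, small π hπ hπ0 h1 hπT, small _ (div_mem hc hπ) (div_ne_zero c0 hπ0) ?_ hcT,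
    by field_simp⟩
  rw [N_div hc.2 hπ.2, div_lt_one₀ h0]
  obtain ⟨j, hj⟩ := hπ' c hc c0
  by_contra! hle
  have hj1 : j ≤ 1 := by
    rw [hj] at hle
    by_contra! h2
    refine absurd hle (not_le.2 ?_)
    conv_rhs => rw [← zpow_one (D.N π)]
    exact zpow_lt_zpow_right_of_lt_one₀ h0 h1 h2
  have hj0 : 0 < j := by
    by_contra! h2
    rw [hj] at hN
    exact absurd hN (not_lt.2 (one_le_zpow_of_nonpos₀ h0 h1.le h2))
  have hj : D.N (c / π) = 1 := by
    rw [N_div hc.2 hπ.2, hj, show j = 1 by omega, zpow_one, div_self h0.ne']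
  exact hcT (tameUnit_of_unit (div_mem hc hπ) hj)

lemma tameRing_valuation_lt_one_of_N [IsAlgClosed Ω] [CharZero Ω]
    {x : (fixedSubfield H : Subfield Ω)} (hx : (x : Ω) ∈ D.E)
    (hN : D.N x < 1) : (D.tameRing h).valuation x < 1 := by
  by_cases x0 : x = 0
  · simp [x0]
  · exact (tameRing_valuation_lt_one h x0).2
      (tameMax_of_N_lt ⟨x.2, hx⟩ (by simpa using x0) hN h)

lemma tameRing_valuation_eq_one_of_N [IsAlgClosed Ω] [CharZero Ω]
    {x : (fixedSubfield H : Subfield Ω)} (hx : (x : Ω) ∈ D.E)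
    (hN : D.N x = 1) : (D.tameRing h).valuation x = 1 := by
  have := h.finiteIndex
  obtain ⟨n, n0, hn⟩ := D.exists_pow_sub_one_lt H
  have := tameRing_valuation_lt_one_of_N (D := D) h (x := x ^ n - 1)
    (by push_cast; exact sub_mem (pow_mem hx n) (one_mem _))
    (by push_cast; exact hn x ⟨x.2, hx⟩ hN)
  have h1 := (D.tameRing h).valuation.map_one_add_of_lt this
  rw [add_sub_cancel, map_pow] at h1
  exact (pow_eq_one_iff_of_nonneg zero_le n0).1 h1

lemma tameRing_valuation_le_one_of_N [IsAlgClosed Ω] [CharZero Ω]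
    {x : (fixedSubfield H : Subfield Ω)} (hx : (x : Ω) ∈ D.E)
    (hN : D.N x ≤ 1) : (D.tameRing h).valuation x ≤ 1 := by
  rcases hN.lt_or_eq with hN | hN
  exacts [(tameRing_valuation_lt_one_of_N h hx hN).le, (tameRing_valuation_eq_one_of_N h hx hN).le]

/-- Elements of a group preserving the fixed field preserve the tame structure. -/
lemma TameUnit.smul {σ : G} (hσ : ∀ x ∈ (fixedSubfield H : Subfield Ω), σ • x ∈ fixedSubfield H)
    {x : Ω} (hx : D.TameUnit l H x) : D.TameUnit l H (σ • x) := by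
  obtain ⟨c, hc, hN, s, hs, s0, rfl⟩ := hx
  exact ⟨σ • c, ⟨hσ c hc.1, D.smul_mem σ hc.2⟩, by rw [D.N_smul σ hc.2, hN], σ • s, hσ s hs,
    (smul_ne_zero_iff_ne σ).2 s0, by rw [smul_mul', smul_pow']⟩

lemma TameMax.smul {σ : G} (hσ : ∀ x ∈ (fixedSubfield H : Subfield Ω), σ • x ∈ fixedSubfield H)
    (hσ' : ∀ x ∈ (fixedSubfield H : Subfield Ω), σ⁻¹ • x ∈ fixedSubfield H)
    {x : Ω} (hx : D.TameMax l H x) : D.TameMax l H (σ • x) := by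
  have small : ∀ x, D.TameSmall l H x → D.TameSmall l H (σ • x) := fun x hx =>
    ⟨hσ x hx.1, (smul_ne_zero_iff_ne σ).2 hx.2.1,
      fun h => hx.2.2.1 (by simpa using TameUnit.smul hσ' h),
      by simpa [smul_add] using TameUnit.smul hσ hx.2.2.2⟩
  rcases hx with hx | ⟨g, h, hg, hh, rfl⟩
  · exact Or.inl (small x hx)
  · exact Or.inr ⟨_, _, small g hg, small h hh, smul_mul' _ _ _⟩

lemma TameUnit.of_kummerStep {q : ℕ} {ζ θ : Ω} {τ : G} (S : KummerStep H q ζ θ τ) (hl : l ≠ 0)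
    (hql : q.Coprime l) {x : Ω} (hx : x ∈ fixedSubfield H)
    (h : D.TameUnit l (H ⊓ stabilizer G θ) x) : D.TameUnit l H x := by
  have x0 := h.ne_zero
  obtain ⟨c, hc, hN, s, hs, s0, e⟩ := h
  refine tameUnit_of_pow_of_coprime hx hl hql ?_ x0
  refine ⟨KummerStep.nrm q τ c, nrm_mem_loc S hc, by rw [N_nrm hc.2, hN, one_pow],
    KummerStep.nrm q τ s, S.nrm_mem hs, KummerStep.nrm_ne_zero s0, ?_⟩
  rw [← S.nrm_of_mem hx, e, KummerStep.nrm_mul, KummerStep.nrm_pow]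

lemma TameUnit.mono (hle : H' ≤ H) {x : Ω} (h : D.TameUnit l H x) : D.TameUnit l H' x := by
  obtain ⟨c, hc, hN, s, hs, s0, e⟩ := h
  exact ⟨c, loc_anti hle hc, hN, s, fixedSubfield_anti hle hs, s0, e⟩

lemma TameMax.of_kummerStep {q : ℕ} {ζ θ : Ω} {τ : G} (S : KummerStep H q ζ θ τ) (hl : l ≠ 0)
    (hql : q.Coprime l) {x : Ω} (hx : D.TameMax l H x) : D.TameMax l (H ⊓ stabilizer G θ) x := by
  have small : ∀ x, D.TameSmall l H x → D.TameSmall l (H ⊓ stabilizer G θ) x := fun x hx =>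
    ⟨fixedSubfield_anti inf_le_left hx.1, hx.2.1, fun h => hx.2.2.1 (h.of_kummerStep S hl hql hx.1),
      hx.2.2.2.mono inf_le_left⟩
  rcases hx with hx | ⟨g, h, hg, hh, rfl⟩
  · exact Or.inl (small x hx)
  · exact Or.inr ⟨_, _, small g hg, small h hh, rfl⟩

end LocalAction

end TameRing

section WildHensel

open MulAction

lemma exists_kummerStep {G Ω : Type*} [Group G] [Field Ω] [MulSemiringAction G Ω] {H : Subgroup G}
    {q : ℕ} (hq : q.Prime) {ζ θ : Ω} (hζ : IsPrimitiveRoot ζ q) (hζH : ζ ∈ fixedSubfield H)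
    (h0 : θ ≠ 0) (hθ : θ ^ q ∈ fixedSubfield H) (hn : θ ∉ fixedSubfield H) :
    ∃ τ, KummerStep H q ζ θ τ := by
  have := NeZero.mk hq.ne_zero
  rw [mem_fixedSubfield] at hn
  push Not at hn
  obtain ⟨σ, hσ, h⟩ := hn
  have h1 : ((σ • θ) / θ) ^ q = 1 := by
    rw [div_pow, ← smul_pow', hθ σ hσ, div_self (pow_ne_zero q h0)]
  have hprim := IsPrimitiveRoot.of_pow_prime_eq_one hq h1 (by rwa [Ne, div_eq_one_iff_eq h0])
  have hmem : (σ • θ) / θ ∈ fixedSubfield H := by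
    obtain ⟨i, -, hi⟩ := hζ.eq_pow_of_pow_eq_one h1
    rw [← hi]; exact pow_mem hζH i
  have S : KummerStep H q ((σ • θ) / θ) θ σ :=
    ⟨hq.pos, hprim, hmem, h0, hθ, hσ, by field_simp⟩
  obtain ⟨m, -, hm⟩ := hprim.eq_pow_of_pow_eq_one hζ.pow_eq_one
  exact ⟨σ ^ m, hq.pos, hζ, hζH, h0, hθ, H.pow_mem hσ m, by rw [S.pow_smul, hm]⟩

namespace LocalAction

variable {p : ℕ} {G Ω : Type*} [Group G] [Field Ω] [MulSemiringAction G Ω]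
  {D : LocalAction p G Ω} {l : ℕ} {H : Subgroup G} [IsAlgClosed Ω] [CharZero Ω]

/-- A weak form of Hensel's lemma for the tame valuation ring. -/
lemma exists_pow_eq_one_add_mul (h : TameLevel p l Ω H) (hp : p.Prime) {ζ : Ω}
    (hζ : IsPrimitiveRoot ζ p) (hζH : ζ ∈ fixedSubfield H)
    {π : (fixedSubfield H : Subfield Ω)} (hπ : (π : Ω) ∈ D.E) (hπ0 : 0 < D.N π)
    (hπ1 : D.N π < 1) : ∃ M : ℕ, ∀ y, (D.tameRing h).valuation y < 1 →
      1 + π ^ M * y ≠ 0 ∧ ∃ ρ, ρ ^ p = 1 + π ^ M * y := by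
  have hζE : ζ ∈ D.E := mem_of_pow_eq_one hp.ne_zero hζ.pow_eq_one
  have hζ1 : ζ - 1 ≠ 0 := sub_ne_zero.2 (hζ.ne_one hp.one_lt)
  obtain ⟨M, hM⟩ := exists_pow_lt_of_lt_one (D.N_pos (sub_mem hζE (one_mem _)) hζ1) hπ1
  have hπne : (π : Ω) ≠ 0 := fun h => by rw [h, D.N_zero] at hπ0; exact hπ0.false
  refine ⟨M * p, fun y hy => ?_⟩
  have hv1 : (D.tameRing h).valuation (1 + π ^ (M * p) * y) = 1 := by
    refine Valuation.map_one_add_of_lt _ ?_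
    rw [map_mul, map_pow]
    exact mul_lt_one_of_nonneg_of_lt_one_right (pow_le_one₀ zero_le
      (tameRing_valuation_lt_one_of_N h hπ hπ1).le) zero_le hy
  have hne : 1 + π ^ (M * p) * y ≠ 0 :=
    ((D.tameRing h).valuation.ne_zero_iff).1 (by rw [hv1]; exact one_ne_zero)
  refine ⟨hne, ?_⟩
  have hne' : (1 : Ω) + π ^ (M * p) * y ≠ 0 := by exact_mod_cast hne
  by_cases y0 : y = 0
  · exact ⟨1, by rw [y0]; simp⟩
  obtain ⟨ρ, hρ⟩ := IsAlgClosed.exists_pow_nat_eq ((1 : Ω) + π ^ (M * p) * y) hp.pos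
  have hρ0 : ρ ≠ 0 := by
    rintro rfl
    rw [zero_pow hp.ne_zero] at hρ
    exact hne' hρ.symm
  by_cases hρH : ρ ∈ fixedSubfield H
  · exact ⟨⟨ρ, hρH⟩, Subtype.ext (by push_cast; exact hρ)⟩
  exfalso
  have hρm : ρ ^ p ∈ fixedSubfield H := by
    rw [hρ]; exact add_mem (one_mem _) (mul_mem (pow_mem π.2 _) y.2)
  obtain ⟨τ, S⟩ := exists_kummerStep hp hζ hζH hρ0 hρm hρH
  have := h.finiteIndex
  have hle : H ⊓ stabilizer G ρ ≤ H := inf_le_left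
  have hF := fixedSubfield_anti (Ω := Ω) hle
  have h' : TameLevel p l Ω (H ⊓ stabilizer G ρ) := h.anti (D.finiteIndex_inf ρ) hle
  set v := (D.tameRing h').valuation with hv
  set π' : (fixedSubfield (H ⊓ stabilizer G ρ) : Subfield Ω) := ⟨π, hF π.2⟩ with hπ'
  set y' : (fixedSubfield (H ⊓ stabilizer G ρ) : Subfield Ω) := ⟨y, hF y.2⟩ with hy'
  set ζ' : (fixedSubfield (H ⊓ stabilizer G ρ) : Subfield Ω) := ⟨ζ, hF hζH⟩ with hζ'
  set ρ' : (fixedSubfield (H ⊓ stabilizer G ρ) : Subfield Ω) := ⟨ρ, KummerStep.theta_mem⟩ with hρ'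
  have π'0 : π' ≠ 0 := by rw [Ne, Subtype.ext_iff]; exact hπne
  have y'0 : y' ≠ 0 := fun e => y0 (Subtype.ext (congrArg Subtype.val e : (y : Ω) = 0))
  have hvy : v y' < 1 := by
    rw [hv, tameRing_valuation_lt_one h' y'0]
    exact ((tameRing_valuation_lt_one h y0).1 hy).of_kummerStep S h.prime.ne_zero h.coprime.symm
  have hvπ : v π' < 1 := tameRing_valuation_lt_one_of_N h' hπ hπ1
  have hρp : ρ' ^ p = 1 + π' ^ (M * p) * y' := Subtype.ext (by push_cast; exact hρ)
  have hvρ : v ρ' = 1 := by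
    refine (pow_eq_one_iff_of_nonneg zero_le hp.ne_zero).1 ?_
    rw [← map_pow, hρp]
    refine v.map_one_add_of_lt ?_
    rw [map_mul, map_pow]
    exact mul_lt_one_of_nonneg_of_lt_one_right (pow_le_one₀ zero_le hvπ.le) zero_le hvy
  have hζp : IsPrimitiveRoot ζ' p := by
    refine IsPrimitiveRoot.of_pow_prime_eq_one hp (Subtype.ext ?_) ?_
    · push_cast; exact hζ.pow_eq_one
    · rw [Ne, Subtype.ext_iff]; exact hζ.ne_one hp.one_lt
  obtain ⟨j, hj⟩ : ∃ j : ℕ, v ((ρ' - ζ' ^ j) / π' ^ M) < 1 := by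
    by_contra! hcon
    have e := hζp.pow_sub_pow_eq_prod_range hp.pos ρ' 1
    rw [hρp, one_pow, add_sub_cancel_left] at e
    have e2 : y' = ∏ j ∈ Finset.range p, ((ρ' - ζ' ^ j) / π' ^ M) := by
      rw [Finset.prod_div_distrib, Finset.prod_const, Finset.card_range, ← pow_mul,
        eq_div_iff (pow_ne_zero _ π'0), mul_comm, e]
      simp
    rw [e2, map_prod] at hvy
    exact absurd hvy (not_lt.2 (Finset.one_le_prod' fun j _ => hcon j))
  set z := (ρ' - ζ' ^ j) / π' ^ M with hz
  have z0 : z ≠ 0 := by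
    refine div_ne_zero (sub_ne_zero.2 fun e => hρH ?_) (pow_ne_zero _ π'0)
    have : ρ = ζ ^ j := by simpa [ρ', ζ'] using congrArg Subtype.val e
    rw [this]; exact pow_mem hζH j
  have hτ := fun x (hx : x ∈ (fixedSubfield (H ⊓ stabilizer G ρ) : Subfield Ω)) =>
    S.smul_mem hx S.gen_mem
  have hτz : v ⟨τ • z, hτ z z.2⟩ < 1 := by
    rw [hv, tameRing_valuation_lt_one h' (by
      rw [Ne, Subtype.ext_iff]; exact (smul_ne_zero_iff_ne τ).2 (by simpa using z0))]
    exact TameMax.smul hτ (fun x hx => S.smul_mem hx (inv_mem S.gen_mem))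
      ((tameRing_valuation_lt_one h' z0).1 hj)
  have hdiff : (⟨τ • z, hτ z z.2⟩ : (fixedSubfield (H ⊓ stabilizer G ρ) : Subfield Ω)) - z
      = (ζ' - 1) / π' ^ M * ρ' := by
    apply Subtype.ext
    have h1 : (z : Ω) = (ρ - ζ ^ j) / π ^ M := by
      rw [hz]; push_cast; rfl
    have h2 : τ • (ζ ^ j) = ζ ^ j := by rw [smul_pow', S.mem τ S.gen_mem]
    have h3 : τ • ((π : Ω) ^ M) = π ^ M := by rw [smul_pow', π.2 τ S.gen_mem]
    have h4 : (((ζ' - 1) / π' ^ M * ρ' : (fixedSubfield (H ⊓ stabilizer G ρ) : Subfield Ω)) : Ω)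
        = (ζ - 1) / π ^ M * ρ := by push_cast; rfl
    rw [h4]
    push_cast
    rw [h1, smul_div₀', smul_sub, h2, h3, S.gen_smul]
    ring
  have hlt := v.map_sub_lt hτz hj
  rw [hdiff, map_mul, hvρ, mul_one] at hlt
  have hpos := D.N_pos (sub_mem hζE (one_mem _)) hζ1
  have hlt2 : v (π' ^ M / (ζ' - 1)) < 1 := by
    refine tameRing_valuation_lt_one_of_N (D := D) h' ?_ ?_
    · push_cast
      exact div_mem (pow_mem hπ M) (sub_mem hζE (one_mem _))
    · push_cast
      rw [N_div (pow_mem hπ M) (sub_mem hζE (one_mem _)), div_lt_one₀ hpos, N_pow hπ]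
      exact hM
  have hmul := mul_lt_one_of_nonneg_of_lt_one_right hlt.le zero_le hlt2
  rw [← map_mul, div_mul_div_cancel₀ (pow_ne_zero M π'0), div_self, map_one] at hmul
  · exact hmul.false
  · rw [Ne, Subtype.ext_iff]; exact hζ1

end LocalAction

end WildHensel

section Unramified

open MulAction

lemma exists_one_add_X_pow {p : ℕ} (hp : p.Prime) : ∃ h : Polynomial ℤ,
    (1 + Polynomial.X : Polynomial ℤ) ^ p =
      1 + Polynomial.X ^ p + (p : Polynomial ℤ) * Polynomial.X * (1 + Polynomial.X * h) := by
  obtain ⟨m, hm⟩ : ∃ m, p = m + 2 := ⟨p - 2, by have := hp.two_le; omega⟩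
  refine ⟨∑ i ∈ Finset.range m, Polynomial.X ^ i * ((p.choose (i + 2) / p : ℕ) : Polynomial ℤ), ?_⟩
  rw [add_comm 1 Polynomial.X, add_pow, hm, Finset.sum_range_succ, Finset.sum_range_succ',
    Finset.sum_range_succ', ← hm]
  have : ∀ i ∈ Finset.range m,
      Polynomial.X ^ (i + 1 + 1) * 1 ^ (p - (i + 1 + 1)) * ((p.choose (i + 1 + 1) : ℕ) : Polynomial ℤ)
      = (p : Polynomial ℤ) * Polynomial.X * (Polynomial.X *
        (Polynomial.X ^ i * ((p.choose (i + 2) / p : ℕ) : Polynomial ℤ))) := fun i hi => by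
    have hd : p ∣ p.choose (i + 2) := hp.dvd_choose_self (Nat.succ_ne_zero _)
      (by have := Finset.mem_range.1 hi; omega)
    obtain ⟨d, hd⟩ := hd
    rw [add_assoc i 1 1, hd, Nat.mul_div_cancel_left _ hp.pos]
    push_cast
    ring
  rw [Finset.sum_congr rfl this, ← Finset.mul_sum, ← Finset.mul_sum]
  simp
  ring

lemma Polynomial.aeval_int_mem {R : Type*} [CommRing R] {A : Subring R} {z : R} (hz : z ∈ A)
    (h : Polynomial ℤ) : aeval z h ∈ A := by
  rw [aeval_eq_sum_range]
  exact sum_mem fun i _ => zsmul_mem (pow_mem hz i) _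

lemma one_add_pow_eq {p : ℕ} {h : Polynomial ℤ}
    (hh : (1 + Polynomial.X : Polynomial ℤ) ^ p =
      1 + Polynomial.X ^ p + (p : Polynomial ℤ) * Polynomial.X * (1 + Polynomial.X * h))
    {R : Type*} [CommRing R] (z : R) :
    (1 + z) ^ p = 1 + z ^ p + p * z * (1 + z * Polynomial.aeval z h) := by
  simpa using congrArg (Polynomial.aeval z) hh

namespace LocalAction

variable {p : ℕ} {G Ω : Type*} [Group G] [Field Ω] [MulSemiringAction G Ω]
  {D : LocalAction p G Ω} {H : Subgroup G}

lemma mem_int_bot {x : Ω} : x ∈ D.int ⊥ ↔ x ∈ D.E ∧ D.N x ≤ 1 := by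
  rw [mem_int]
  refine ⟨fun h => ⟨h.1.2, h.2⟩, fun h => ⟨⟨fun σ hσ => ?_, h.1⟩, h.2⟩⟩
  rw [Subgroup.mem_bot.1 hσ, one_smul]

lemma N_pow_sub_one_le {x : Ω} (hx : x ∈ D.E) (h : D.N x ≤ 1) (n : ℕ) :
    D.N (x ^ n - 1) ≤ D.N (x - 1) := by
  have hi : ∑ i ∈ Finset.range n, x ^ i ∈ D.int ⊥ :=
    sum_mem fun i _ => pow_mem (mem_int_bot.2 ⟨hx, h⟩) i
  rw [mem_int_bot] at hi
  rw [← geom_sum_mul, D.N_mul hi.1 (sub_mem hx (one_mem _))]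
  exact mul_le_of_le_one_left (N_nonneg (sub_mem hx (one_mem _))) hi.2

lemma N_prim_sub_one (hp : p.Prime) {ζ ξ : Ω} (hζ : IsPrimitiveRoot ζ p)
    (hξ : IsPrimitiveRoot ξ p) : D.N (ζ - 1) = D.N (ξ - 1) := by
  have key : ∀ {ζ ξ : Ω}, IsPrimitiveRoot ζ p → IsPrimitiveRoot ξ p →
      D.N (ζ - 1) ≤ D.N (ξ - 1) := fun {ζ ξ} h h' => by
    have := NeZero.mk hp.ne_zero
    obtain ⟨i, -, hi⟩ := h'.eq_pow_of_pow_eq_one h.pow_eq_one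
    have hE := mem_of_pow_eq_one (D := D) hp.ne_zero h'.pow_eq_one
    rw [← hi]
    exact N_pow_sub_one_le hE (N_eq_one_of_pow hE hp.ne_zero (by rw [h'.pow_eq_one, N_one])).le i
  exact le_antisymm (key hζ hξ) (key hξ hζ)

/-- The valuation of `ζ - 1`. -/
lemma prime_mul_eq (hp : p.Prime) {ζ : Ω} (hζ : IsPrimitiveRoot ζ p) {h : Polynomial ℤ}
    (hh : (1 + Polynomial.X : Polynomial ℤ) ^ p =
      1 + Polynomial.X ^ p + (p : Polynomial ℤ) * Polynomial.X * (1 + Polynomial.X * h)) :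
    p * (1 + (ζ - 1) * Polynomial.aeval (ζ - 1) h) = - (ζ - 1) ^ (p - 1) ∧ D.N (ζ - 1) < 1 ∧
    D.N (1 + (ζ - 1) * Polynomial.aeval (ζ - 1) h) = 1 := by
  have hE := mem_of_pow_eq_one (D := D) hp.ne_zero hζ.pow_eq_one
  have hN := N_eq_one_of_pow hE hp.ne_zero (by rw [hζ.pow_eq_one, N_one])
  have hE1 := sub_mem hE (one_mem D.E)
  have h1 : ζ - 1 ≠ 0 := sub_ne_zero.2 (hζ.ne_one hp.one_lt)
  have hi : ζ - 1 ∈ D.int ⊥ := sub_mem (mem_int_bot.2 ⟨hE, hN.le⟩) (one_mem _)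
  have ha := Polynomial.aeval_int_mem hi h
  have hb : 1 + (ζ - 1) * Polynomial.aeval (ζ - 1) h ∈ D.int ⊥ := add_mem (one_mem _) (mul_mem hi ha)
  rw [mem_int_bot] at ha hb
  have e : p * (1 + (ζ - 1) * Polynomial.aeval (ζ - 1) h) = - (ζ - 1) ^ (p - 1) := by
    have := one_add_pow_eq hh (ζ - 1)
    rw [add_sub_cancel, hζ.pow_eq_one] at this
    refine mul_right_cancel₀ h1 ?_
    rw [neg_mul, pow_sub_one_mul hp.ne_zero]
    linear_combination -this
  have hlt : D.N (ζ - 1) < 1 := by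
    by_contra! hge
    have h2 := congrArg D.N e
    rw [N_neg (pow_mem hE1 _), N_pow hE1, D.N_mul (natCast_mem _ _) hb.1] at h2
    have h3 := mul_le_of_le_one_right (N_nonneg (natCast_mem D.E p)) hb.2
    have := D.N_p
    have := one_le_pow₀ (n := p - 1) hge
    linarith
  refine ⟨e, hlt, ?_⟩
  rw [N_add_eq (one_mem _) (mul_mem hE1 ha.1), N_one]
  rw [N_one, D.N_mul hE1 ha.1]
  exact (mul_le_of_le_one_right (N_nonneg hE1) ha.2).trans_lt hlt

variable [IsAlgClosed Ω] [CharZero Ω]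

/-- The unramified extension of degree `p`. -/
lemma exists_unramified (D : LocalAction p G Ω) [H.FiniteIndex] (hp : p.Prime) {ζ : Ω}
    (hζ : IsPrimitiveRoot ζ p) (hζH : ζ ∈ fixedSubfield H) :
    ∃ θ τ α, KummerStep H p ζ θ τ ∧ θ ^ p = 1 + (ζ - 1) ^ p * α ∧ α ∈ D.loc H ∧ D.N α = 1 ∧
      ∀ e ∈ D.loc (H ⊓ stabilizer G θ), e ≠ 0 → ∃ c ∈ D.loc H, c ≠ 0 ∧ D.N e = D.N c := by
  obtain ⟨h, hh⟩ := exists_one_add_X_pow hp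
  obtain ⟨hpe, hl1, hb1⟩ := prime_mul_eq (D := D) hp hζ hh
  obtain ⟨α, hα, hαN, hαroot⟩ := D.exists_artinSchreier H hp
  have hE := mem_of_pow_eq_one (D := D) hp.ne_zero hζ.pow_eq_one
  have hζN := N_eq_one_of_pow hE hp.ne_zero (by rw [hζ.pow_eq_one, N_one])
  set Λ := ζ - 1 with hΛ
  have hΛE : Λ ∈ D.E := sub_mem hE (one_mem D.E)
  have hΛH : Λ ∈ fixedSubfield H := sub_mem hζH (one_mem _)
  have Λ0 : Λ ≠ 0 := sub_ne_zero.2 (hζ.ne_one hp.one_lt)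
  have hΛi : Λ ∈ D.int ⊥ := mem_int_bot.2 ⟨hΛE, hl1.le⟩
  set b := 1 + Λ * Polynomial.aeval Λ h with hb
  have hbi : b ∈ D.int ⊥ := add_mem (one_mem _) (mul_mem hΛi (Polynomial.aeval_int_mem hΛi h))
  have hbE : b ∈ D.E := (mem_int_bot.1 hbi).1
  have b0 : b ≠ 0 := loc_ne_zero_of_N hb1
  have hΛpos := D.N_pos hΛE Λ0
  obtain ⟨θ, hθ⟩ := IsAlgClosed.exists_pow_nat_eq (1 + Λ ^ p * α) hp.pos
  have hsmall : D.N (Λ ^ p * α) < 1 := by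
    rw [D.N_mul (pow_mem hΛE p) hα.2, hαN, mul_one, N_pow hΛE]
    exact pow_lt_one₀ (N_nonneg hΛE) hl1 hp.ne_zero
  have hΛα : Λ ^ p * α ∈ D.E := mul_mem (pow_mem hΛE p) hα.2
  have hθE : θ ∈ D.E := D.mem_of_pow hp.ne_zero (by rw [hθ]; exact add_mem (one_mem _) hΛα)
  have hθN : D.N θ = 1 := N_eq_one_of_pow hθE hp.ne_zero (by
    rw [hθ, N_add_eq (one_mem _) hΛα (by rwa [N_one]), N_one])
  have θ0 := loc_ne_zero_of_N hθN
  set η := (θ - 1) / Λ with hη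
  have hηE : η ∈ D.E := div_mem (sub_mem hθE (one_mem _)) hΛE
  have hηN : D.N η ≤ 1 := by
    by_contra! hgt
    have e1 : α = ∏ j ∈ Finset.range p, ((θ - ζ ^ j * 1) / Λ) := by
      rw [Finset.prod_div_distrib, Finset.prod_const, Finset.card_range,
        ← hζ.pow_sub_pow_eq_prod_range hp.pos, hθ]
      field_simp
      ring
    have e2 : ∀ j, (θ - ζ ^ j * 1) / Λ = η - (ζ ^ j - 1) / Λ := fun j => by rw [hη]; ring
    have hjE : ∀ j, (ζ ^ j - 1) / Λ ∈ D.E := fun j =>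
      div_mem (sub_mem (pow_mem hE j) (one_mem _)) hΛE
    have e3 : ∀ j, D.N ((θ - ζ ^ j * 1) / Λ) = D.N η := fun j => by
      rw [e2, sub_eq_add_neg]
      refine N_add_eq hηE (neg_mem (hjE j)) ?_
      rw [N_neg (hjE j), N_div (sub_mem (pow_mem hE j) (one_mem _)) hΛE]
      exact (div_le_one_of_le₀ (N_pow_sub_one_le hE hζN.le j) hΛpos.le).trans_lt hgt
    have e4 := congrArg D.N e1
    rw [N_prod _ _ (fun j _ => by rw [e2]; exact sub_mem hηE (hjE j)), hαN] at e4
    simp only [e3, Finset.prod_const, Finset.card_range] at e4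
    exact absurd (one_lt_pow₀ hgt hp.ne_zero) (not_lt.2 e4.ge)
  have hηi : η ∈ D.int ⊥ := mem_int_bot.2 ⟨hηE, hηN⟩
  have hθη : θ = 1 + Λ * η := by rw [hη]; field_simp; ring
  have hθH : θ ∉ fixedSubfield H := by
    intro hθH
    have hηL : η ∈ fixedSubfield H := div_mem (sub_mem hθH (one_mem _)) hΛH
    have hηH : η ∈ D.loc H := ⟨hηL, hηE⟩
    have hroot := hαroot η hηH hηN
    have hki : Polynomial.aeval Λ h ∈ D.int ⊥ := Polynomial.aeval_int_mem hΛi h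
    have hci : Polynomial.aeval (Λ * η) h ∈ D.int ⊥ :=
      Polynomial.aeval_int_mem (mul_mem hΛi hηi) h
    set f := Polynomial.aeval Λ h
    set g := Polynomial.aeval (Λ * η) h
    have hpΛ : Λ ^ p = - (p * Λ * b) := by
      have : Λ ^ p = Λ ^ (p - 1) * Λ := (pow_sub_one_mul hp.ne_zero Λ).symm
      rw [this]; linear_combination Λ * hpe
    have e : (η ^ p - η - α) * b = Λ * (η ^ 2 * g - η * f) := by
      have e0 := one_add_pow_eq hh (Λ * η)
      rw [← hθη, hθ, mul_pow] at e0
      have hpΛ0 : (p : Ω) * Λ ≠ 0 := mul_ne_zero (Nat.cast_ne_zero.2 hp.ne_zero) Λ0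
      refine mul_left_cancel₀ hpΛ0 ?_
      linear_combination e0 + (η ^ p - α) * hpΛ - (p : Ω) * Λ * η * hb
    have hr : η ^ 2 * g - η * f ∈ D.int ⊥ :=
      sub_mem (mul_mem (pow_mem hηi 2) hci) (mul_mem hηi hki)
    rw [mem_int_bot] at hr
    have e' := congrArg D.N e
    rw [D.N_mul (sub_mem (sub_mem (pow_mem hηE p) hηE) hα.2) hbE, hroot, hb1, D.N_mul hΛE hr.1] at e'
    have := mul_le_of_le_one_right hΛpos.le hr.2
    linarith
  have hθp : θ ^ p ∈ fixedSubfield H := by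
    rw [hθ]; exact add_mem (one_mem _) (mul_mem (pow_mem hΛH p) hα.1)
  obtain ⟨τ, S⟩ := exists_kummerStep hp hζ hζH θ0 hθp hθH
  refine ⟨θ, τ, α, S, hθ, hα, hαN, fun e he e0 => ?_⟩
  have hη' : η ∈ fixedSubfield (H ⊓ stabilizer G θ) :=
    div_mem (sub_mem KummerStep.theta_mem (one_mem _)) (fixedSubfield_anti inf_le_left hΛH)
  have hc : ∀ i, KummerStep.tr p τ (e * η ^ i) ∈ D.loc H := fun i =>
    ⟨S.tr_mem (mul_mem he.1 (pow_mem hη' i)), tr_mem_E (mul_mem he.2 (pow_mem hηE i))⟩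
  have epos := D.N_pos he.2 e0
  by_cases hex : ∃ i, D.N (KummerStep.tr p τ (e * η ^ i)) = D.N e
  · obtain ⟨i, hi⟩ := hex
    refine ⟨_, hc i, fun h0 => ?_, hi.symm⟩
    rw [h0, D.N_zero] at hi
    exact epos.ne hi
  exfalso
  have hlt : ∀ i, D.N (KummerStep.tr p τ (e * η ^ i)) < D.N e := fun i => by
    refine lt_of_le_of_ne ?_ fun h => hex ⟨i, h⟩
    refine (N_tr_le (mul_mem he.2 (pow_mem hηE i))).trans ?_
    rw [D.N_mul he.2 (pow_mem hηE i), N_pow hηE]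
    exact mul_le_of_le_one_right epos.le (pow_le_one₀ (N_nonneg hηE) hηN)
  have hτη : ∀ j : ℕ, τ ^ j • η ∈ D.int ⊥ := fun j =>
    mem_int_bot.2 ⟨D.smul_mem _ hηE, by rw [D.N_smul _ hηE]; exact hηN⟩
  set P : Polynomial (D.int ⊥) := ∏ j ∈ Finset.range (p - 1),
    (Polynomial.X - Polynomial.C ⟨τ ^ (j + 1) • η, hτη (j + 1)⟩) with hP
  have hev : ∀ z, P.eval₂ (D.int ⊥).subtype z =
      ∏ j ∈ Finset.range (p - 1), (z - τ ^ (j + 1) • η) := fun z => by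
    rw [hP, Polynomial.eval₂_finsetProd]
    simp
  have hdiff : ∀ j < p - 1, D.N (η - τ ^ (j + 1) • η) = 1 := fun j hj => by
    have e1 : η - τ ^ (j + 1) • η = (1 - ζ ^ (j + 1)) / Λ * θ := by
      have hΛτ : τ ^ (j + 1) • Λ = Λ := hΛH _ (H.pow_mem S.gen_mem _)
      rw [hη, smul_div₀', smul_sub, S.pow_smul, hΛτ, smul_one]
      ring
    have hz := hζ.pow_of_coprime (j + 1) ((Nat.coprime_of_lt_prime (by omega) (by omega) hp).symm)
    have hzE := pow_mem hE (j + 1)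
    rw [e1, D.N_mul (div_mem (sub_mem (one_mem _) hzE) hΛE) hθE,
      N_div (sub_mem (one_mem _) hzE) hΛE, N_sub_comm (one_mem _) hzE, N_prim_sub_one hp hz hζ,
      div_self hΛpos.ne', one_mul, hθN]
  have hτηE : ∀ j : ℕ, η - τ ^ (j + 1) • η ∈ D.E := fun j => sub_mem hηE (D.smul_mem _ hηE)
  have hsum : ∑ j ∈ Finset.range p, τ ^ j • e * P.eval₂ (D.int ⊥).subtype (τ ^ j • η)
      = e * P.eval₂ (D.int ⊥).subtype η := by
    have hp1 : Finset.range p = Finset.range (p - 1 + 1) := by rw [Nat.sub_add_cancel hp.one_le]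
    rw [hp1, Finset.sum_range_succ', Finset.sum_eq_zero]
    · simp
    · intro j hj
      rw [hev, Finset.prod_eq_zero hj (sub_self _), mul_zero]
  have hsum2 : ∑ j ∈ Finset.range p, τ ^ j • e * P.eval₂ (D.int ⊥).subtype (τ ^ j • η)
      = ∑ i ∈ Finset.range (P.natDegree + 1),
        (P.coeff i : Ω) * KummerStep.tr p τ (e * η ^ i) := by
    simp only [Polynomial.eval₂_eq_sum_range, KummerStep.tr, Finset.mul_sum]
    rw [Finset.sum_comm]
    refine Finset.sum_congr rfl fun i _ => Finset.sum_congr rfl fun j _ => ?_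
    rw [smul_mul', smul_pow']
    simp only [Subring.subtype_apply]
    ring
  have hfin : D.N (e * P.eval₂ (D.int ⊥).subtype η) = D.N e := by
    rw [hev, D.N_mul he.2 (prod_mem fun j _ => hτηE j), N_prod _ _ (fun j _ => hτηE j),
      Finset.prod_eq_one fun j hj => hdiff j (Finset.mem_range.1 hj), mul_one]
  rw [← hsum, hsum2] at hfin
  refine hfin.not_lt (N_sum_lt _ _ (fun i _ => mul_mem (mem_int_bot.1 (P.coeff i).2).1 (hc i).2)
    epos fun i _ => ?_)
  obtain ⟨h1, h2⟩ := mem_int_bot.1 (P.coeff i).2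
  rw [D.N_mul h1 (hc i).2]
  exact (mul_le_of_le_one_left (N_nonneg (hc i).2) h2).trans_lt (hlt i)

end LocalAction

end Unramified

section WildInstance

open MulAction

lemma KummerStep.nrm_sub {G Ω : Type*} [Group G] [Field Ω] [MulSemiringAction G Ω]
    {H : Subgroup G} {q : ℕ} {ζ θ : Ω} {τ : G} (S : KummerStep H q ζ θ τ) {c : Ω}
    (hc : c ∈ fixedSubfield H) : nrm q τ (c - θ) = c ^ q - θ ^ q := by
  rw [S.prim.pow_sub_pow_eq_prod_range S.pos c θ, nrm]
  exact Finset.prod_congr rfl fun j _ => by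
    rw [smul_sub, S.pow_smul, hc _ (H.pow_mem S.gen_mem j)]

lemma KummerStep.theta_notMem {G Ω : Type*} [Group G] [Field Ω] [MulSemiringAction G Ω]
    {H : Subgroup G} {q : ℕ} {ζ θ : Ω} {τ : G} (S : KummerStep H q ζ θ τ) (hq : q ≠ 1) :
    θ ∉ fixedSubfield H := fun hθ => by
  have h1 := hθ τ S.gen_mem
  rw [S.gen_smul] at h1
  have hζ : ζ = 1 := mul_right_cancel₀ S.ne_zero (by rw [h1, one_mul])
  have := S.prim
  rw [hζ] at this
  exact hq (this.eq_orderOf.trans orderOf_one)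

namespace LocalAction

variable {p l : ℕ} {G Ω : Type*} [Group G] [Field Ω] [MulSemiringAction G Ω]
  {D : LocalAction p G Ω} {H : Subgroup G}

lemma N_le_unif {π : Ω} (h0 : 0 < D.N π) (h1 : D.N π < 1)
    (hπ' : ∀ c ∈ D.loc H, c ≠ 0 → ∃ j : ℤ, D.N c = D.N π ^ j) {c : Ω} (hc : c ∈ D.loc H)
    (hN : D.N c < 1) : D.N c ≤ D.N π := by
  by_cases c0 : c = 0
  · rw [c0, D.N_zero]; exact h0.le
  obtain ⟨j, hj⟩ := hπ' c hc c0
  rw [hj] at hN ⊢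
  have hj1 : 1 ≤ j := by
    by_contra! h
    have : j ≤ 0 := by omega
    exact absurd hN (not_lt.2 (one_le_zpow_of_nonpos₀ h0 h1.le this))
  calc D.N π ^ j ≤ D.N π ^ (1 : ℤ) := zpow_le_zpow_right_of_le_one₀ h0 h1.le hj1
    _ = _ := zpow_one _

variable [IsAlgClosed Ω]

lemma exists_eq_unif_zpow_mul [H.FiniteIndex] (hp : p.Prime) {π : Ω} (hπ : π ∈ D.loc H)
    (h0 : 0 < D.N π) (h1 : D.N π < 1)
    (hπ' : ∀ c ∈ D.loc H, c ≠ 0 → ∃ j : ℤ, D.N c = D.N π ^ j) {x : Ω} (hx : x ∈ fixedSubfield H)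
    (x0 : x ≠ 0) : ∃ j : ℤ, ∃ δ ∈ D.int H, ∃ s ∈ fixedSubfield H, s ≠ 0 ∧
      x = π ^ j * (1 + π * δ) * s ^ p := by
  have π0 : π ≠ 0 := fun h => by rw [h, D.N_zero] at h0; exact h0.false
  obtain ⟨c, hc, c0, s, hs, s0, e⟩ := D.exists_eq_mul_pow hx x0 hp.ne_zero
  obtain ⟨j, hj⟩ := hπ' c hc c0
  have hπj : π ^ j ∈ D.loc H := zpow_mem hπ j
  have hu : c / π ^ j ∈ D.loc H := div_mem hc hπj
  obtain ⟨y, hy, hyN, hyu⟩ := D.exists_pow_p_sub_lt H hp hu (by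
    rw [N_div hc.2 hπj.2, N_zpow hπ.2, hj, div_self (zpow_ne_zero _ h0.ne')])
  have y0 := loc_ne_zero_of_N hyN
  have hδ : c / π ^ j / y ^ p - 1 ∈ D.loc H := sub_mem (div_mem hu (pow_mem hy p)) (one_mem _)
  have hle := N_le_unif h0 h1 hπ' hδ hyu
  refine ⟨j, (c / π ^ j / y ^ p - 1) / π, ⟨div_mem hδ hπ, ?_⟩, y * s, mul_mem hy.1 hs,
    mul_ne_zero y0 s0, ?_⟩
  · rw [N_div hδ.2 hπ.2]
    exact div_le_one_of_le₀ hle h0.le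
  · have := zpow_ne_zero j π0
    rw [e]
    field_simp
    ring

lemma dvd_of_nrm_eq [H.FiniteIndex] (hp : p.Prime) {ζ θ : Ω} {τ : G} (S : KummerStep H p ζ θ τ)
    (hur : ∀ e ∈ D.loc (H ⊓ stabilizer G θ), e ≠ 0 → ∃ c ∈ D.loc H, c ≠ 0 ∧ D.N e = D.N c)
    {π : Ω} (hπ : π ∈ D.loc H) (h0 : 0 < D.N π) (h1 : D.N π < 1)
    (hπ' : ∀ c ∈ D.loc H, c ≠ 0 → ∃ j : ℤ, D.N c = D.N π ^ j) {j : ℤ} {δ s z : Ω}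
    (hδ : δ ∈ D.int H) (hs : s ∈ fixedSubfield H) (s0 : s ≠ 0)
    (hz : z ∈ fixedSubfield (H ⊓ stabilizer G θ)) (z0 : z ≠ 0)
    (e : π ^ j * (1 + π * δ) * s ^ p = KummerStep.nrm p τ z) : (p : ℤ) ∣ j := by
  have := D.finiteIndex_inf (H := H) θ
  obtain ⟨c, hc, c0, w, hw, w0, rfl⟩ := D.exists_eq_mul_pow hz z0 hp.ne_zero
  rw [KummerStep.nrm_mul, KummerStep.nrm_pow] at e
  set y := KummerStep.nrm p τ w / s with hy
  set a := KummerStep.nrm p τ c with ha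
  have haE : a ∈ D.loc H := nrm_mem_loc S hc
  have ha0 : a ≠ 0 := KummerStep.nrm_ne_zero c0
  have hyH : y ∈ fixedSubfield H := div_mem (S.nrm_mem hw) hs
  have hy0 : y ≠ 0 := div_ne_zero (KummerStep.nrm_ne_zero w0) s0
  have hπδ : π * δ ∈ D.loc H := mul_mem hπ hδ.1
  have hπδN : D.N (π * δ) < 1 := by
    rw [D.N_mul hπ.2 hδ.1.2]
    exact (mul_le_of_le_one_right h0.le hδ.2).trans_lt h1
  have hu : 1 + π * δ ∈ D.loc H := add_mem (one_mem _) hπδ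
  have huN : D.N (1 + π * δ) = 1 := by
    rw [N_add_eq (one_mem _) hπδ.2 (by rwa [N_one]), N_one]
  have hπj : π ^ j ∈ D.loc H := zpow_mem hπ j
  have e' : π ^ j * (1 + π * δ) = a * y ^ p := by
    rw [hy, div_pow, ← mul_div_assoc, ← e, mul_div_cancel_right₀ _ (pow_ne_zero p s0)]
  have hyE : y ∈ D.E := D.mem_of_pow hp.ne_zero (by
    rw [show y ^ p = π ^ j * (1 + π * δ) / a by rw [e', mul_div_cancel_left₀ _ ha0]]
    exact div_mem (mul_mem hπj.2 hu.2) haE.2)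
  obtain ⟨c', hc', c0', hcc⟩ := hur c hc c0
  obtain ⟨i, hi⟩ := hπ' c' hc' c0'
  obtain ⟨i', hi'⟩ := hπ' y ⟨hyH, hyE⟩ hy0
  have eN := congrArg D.N e'
  rw [D.N_mul hπj.2 hu.2, huN, mul_one, N_zpow hπ.2, D.N_mul haE.2 (pow_mem hyE p), ha,
    N_nrm hc.2, N_pow hyE, hcc, hi, hi', ← mul_pow, ← zpow_add₀ h0.ne', ← zpow_natCast,
    ← zpow_mul] at eN
  exact ⟨i + i', by rw [zpow_right_injective₀ h0 h1.ne eN, mul_comm]⟩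

variable [CharZero Ω]

lemma exists_eq_nrm_of_line (h : TameLevel p l Ω H) (hp : p.Prime) {ζ θ α : Ω} {τ : G}
    (S : KummerStep H p ζ θ τ) (hθ : θ ^ p = 1 + (ζ - 1) ^ p * α) (hα : α ∈ D.loc H)
    (hαN : D.N α = 1) : ∃ β, (D.tameRing h).valuation β = 1 ∧
      ∀ y, (D.tameRing h).valuation y ≤ 1 → ∃ a, (D.tameRing h).valuation a ≤ 1 ∧
        ∃ z ∈ fixedSubfield (H ⊓ stabilizer G θ), z ≠ 0 ∧
          ((1 + β * y + y ^ 2 * a : (fixedSubfield H : Subfield Ω)) : Ω) =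
            KummerStep.nrm p τ z := by
  set v := (D.tameRing h).valuation with hv
  have hζ := S.prim
  obtain ⟨P, hP⟩ := exists_one_add_X_pow hp
  obtain ⟨hpe, hl1, hb1⟩ := prime_mul_eq (D := D) hp hζ hP
  have hE := mem_of_pow_eq_one (D := D) hp.ne_zero hζ.pow_eq_one
  set Λ : (fixedSubfield H : Subfield Ω) := ⟨ζ, S.mem⟩ - 1 with hΛ
  have hΛc : (Λ : Ω) = ζ - 1 := rfl
  have hΛE : (Λ : Ω) ∈ D.E := sub_mem hE (one_mem D.E)
  have Λ0 : Λ ≠ 0 := fun h0 => hζ.ne_one hp.one_lt (sub_eq_zero.1 (by rw [← hΛc, h0]; rfl))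
  have hvΛ : v Λ < 1 := tameRing_valuation_lt_one_of_N h hΛE hl1
  set b := 1 + Λ * Polynomial.aeval Λ P with hb
  have hcoe : ∀ z : (fixedSubfield H : Subfield Ω),
      ((Polynomial.aeval z P : (fixedSubfield H : Subfield Ω)) : Ω) = Polynomial.aeval (z : Ω) P :=
    fun z => by
      have := Polynomial.map_aeval_eq_aeval_map (S := (fixedSubfield H : Subfield Ω)) (T := ℤ)
        (U := Ω) (φ := RingHom.id ℤ) (ψ := (fixedSubfield H : Subfield Ω).subtype)
        (by ext; simp) P z
      simpa using this
  have hbc : (b : Ω) = 1 + (ζ - 1) * Polynomial.aeval (ζ - 1) P := by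
    rw [hb]; push_cast; rw [hcoe, hΛc]
  have hvaeval : ∀ z, v z ≤ 1 → v (Polynomial.aeval z P) ≤ 1 := fun z hz => by
    rw [hv, ValuationSubring.valuation_le_one_iff] at hz ⊢
    exact Polynomial.aeval_int_mem (A := (D.tameRing h).toSubring) hz P
  have hvb : v b = 1 := by
    rw [hb]
    refine v.map_one_add_of_lt ?_
    rw [map_mul]
    exact (mul_le_of_le_one_right' (hvaeval _ hvΛ.le)).trans_lt hvΛ
  set A : (fixedSubfield H : Subfield Ω) := ⟨α, hα.1⟩ with hA
  have hvA : v A = 1 := tameRing_valuation_eq_one_of_N h hα.2 hαN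
  have A0 : A ≠ 0 := (v.ne_zero_iff).1 (by rw [hvA]; exact one_ne_zero)
  have b0 : b ≠ 0 := (v.ne_zero_iff).1 (by rw [hvb]; exact one_ne_zero)
  have hpb : (p : (fixedSubfield H : Subfield Ω)) * b = -Λ ^ (p - 1) := by
    apply Subtype.ext
    push_cast
    rw [hbc, hpe, hΛc]
  have hpΛ : (p : (fixedSubfield H : Subfield Ω)) * Λ = -Λ ^ p / b := by
    rw [eq_div_iff b0, ← pow_sub_one_mul hp.ne_zero Λ]
    linear_combination Λ * hpb
  refine ⟨1 / (b * A), by rw [map_div₀, map_mul, hvb, hvA, map_one]; simp, fun y hy => ?_⟩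
  set g := Polynomial.aeval (Λ * y) P with hg
  have hvΛy : v (Λ * y) ≤ 1 := by
    rw [map_mul]; exact mul_le_one' hvΛ.le hy
  refine ⟨-(y ^ (p - 2) - Λ * g / b) / A, ?_, ?_⟩
  · rw [map_div₀, hvA, div_one, Valuation.map_neg]
    refine v.map_sub_le ?_ ?_
    · rw [map_pow]; exact pow_le_one₀ zero_le hy
    · rw [map_div₀, hvb, div_one, map_mul]
      exact mul_le_one' hvΛ.le (hvaeval _ hvΛy)
  have hn1 : ∀ c : Ω, c ∈ fixedSubfield H → c - θ ≠ 0 := fun c hc h0 =>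
    S.theta_notMem hp.ne_one (by rwa [← sub_eq_zero.1 h0])
  have hc : 1 + (Λ : Ω) * y ∈ fixedSubfield H := (1 + Λ * y).2
  have h1θ := hn1 1 (one_mem _)
  have hmem : ∀ c : Ω, c ∈ fixedSubfield H → c - θ ∈ fixedSubfield (H ⊓ stabilizer G θ) :=
    fun c hc => sub_mem (fixedSubfield_anti inf_le_left hc) KummerStep.theta_mem
  refine ⟨(1 + Λ * y - θ) / (1 - θ), div_mem (hmem _ hc) (hmem 1 (one_mem _)),
    div_ne_zero (hn1 _ hc) h1θ, ?_⟩
  refine mul_right_cancel₀ (KummerStep.nrm_ne_zero (q := p) (τ := τ) h1θ) ?_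
  rw [← KummerStep.nrm_mul, div_mul_cancel₀ _ h1θ, S.nrm_sub hc, S.nrm_one_sub, hθ, ← hΛc]
  have key : (1 + 1 / (b * A) * y + y ^ 2 * (-(y ^ (p - 2) - Λ * g / b) / A)) *
      (1 - (1 + Λ ^ p * A)) = (1 + Λ * y) ^ p - (1 + Λ ^ p * A) := by
    have e1 : y ^ 2 * y ^ (p - 2) = y ^ p := by
      rw [← pow_add, Nat.add_sub_cancel' hp.two_le]
    rw [one_add_pow_eq hP, ← hg, ← mul_assoc, hpΛ, mul_pow, ← e1]
    clear_value g
    field_simp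
    ring
  exact congrArg Subtype.val key

/-- The tame valuation carries a wild datum. -/
lemma exists_wildDatum (h : TameLevel p l Ω H) (hp : p.Prime) {ζ : Ω} (hζ : IsPrimitiveRoot ζ p)
    (hζH : ζ ∈ fixedSubfield H) {π : (fixedSubfield H : Subfield Ω)} (hπ : (π : Ω) ∈ D.E)
    (h0 : 0 < D.N π) (h1 : D.N π < 1)
    (hπ' : ∀ c ∈ D.loc H, c ≠ 0 → ∃ j : ℤ, D.N c = D.N π ^ j) :
    ∃ T, WildDatum (D.tameRing h).valuation ((D.int H).comap (fixedSubfield H).subtype) π p T := by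
  have := h.finiteIndex
  obtain ⟨θ, τ, α, S, hθ, hα, hαN, hur⟩ := D.exists_unramified hp hζ hζH
  have hπL : (π : Ω) ∈ D.loc H := ⟨π.2, hπ⟩
  have π0 : π ≠ 0 := fun h => by rw [h] at h0; simp [D.N_zero] at h0
  have hTpow : ∀ {x : (fixedSubfield H : Subfield Ω)}, x ≠ 0 →
      ∃ z ∈ fixedSubfield (H ⊓ stabilizer G θ), z ≠ 0 ∧ ((x ^ p : (fixedSubfield H : Subfield Ω)) : Ω)
        = KummerStep.nrm p τ z := fun {x} hx =>
    ⟨x, fixedSubfield_anti inf_le_left x.2, by simpa using hx, by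
      rw [S.nrm_of_mem x.2]; push_cast; rfl⟩
  refine ⟨fun x => ∃ z ∈ fixedSubfield (H ⊓ stabilizer G θ), z ≠ 0 ∧ (x : Ω) =
    KummerStep.nrm p τ z, ⟨hp, ?_, ?_, π0, tameRing_valuation_lt_one_of_N h hπ h1, ?_, ?_, hTpow,
      ?_, ?_, ?_, ?_⟩⟩
  · exact fun x hx => tameRing_valuation_le_one_of_N h hx.1.2 hx.2
  · exact ⟨hπL, h1.le⟩
  · have hpE : (p : Ω) ∈ D.loc H := natCast_mem _ _
    have hle := N_le_unif h0 h1 hπ' hpE D.N_p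
    have := tameRing_valuation_le_one_of_N (D := D) h
      (x := (p : (fixedSubfield H : Subfield Ω)) / π)
      (by push_cast; exact div_mem hpE.2 hπ) (by
        push_cast
        rw [N_div hpE.2 hπ]
        exact div_le_one_of_le₀ hle h0.le)
    rwa [map_div₀, div_le_one₀ (zero_lt_iff.2 ((Valuation.ne_zero_iff _).2 π0))] at this
  · rintro x y ⟨z, hz, z0, e⟩ ⟨w, hw, w0, e'⟩
    exact ⟨z * w, mul_mem hz hw, mul_ne_zero z0 w0, by
      rw [KummerStep.nrm_mul, ← e, ← e']; rfl⟩
  · intro x hx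
    obtain ⟨j, δ, hδ, s, hs, s0, e⟩ := exists_eq_unif_zpow_mul hp hπL h0 h1 hπ' x.2
      (by simpa using hx)
    refine ⟨j, ⟨δ, hδ.1.1⟩, hδ, ⟨s, hs⟩, fun h => s0 (congrArg Subtype.val h), Subtype.ext ?_⟩
    rw [e]
    push_cast [Subfield.coe_zpow']
    rfl
  · rintro j δ s hδ hs ⟨z, hz, z0, e⟩
    refine dvd_of_nrm_eq hp S hur hπL h0 h1 hπ' hδ s.2 (by simpa using hs) hz z0 ?_
    rw [← e]
    push_cast [Subfield.coe_zpow']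
    rfl
  · obtain ⟨β, hβ, hl⟩ := exists_eq_nrm_of_line h hp S hθ hα hαN
    refine ⟨β, hβ, fun y hy => ?_⟩
    obtain ⟨a, ha, hz⟩ := hl y hy
    exact ⟨a, ha, fun _ => hz⟩
  · obtain ⟨M, hM⟩ := exists_pow_eq_one_add_mul h hp hζ hζH hπ h0 h1
    refine ⟨M, fun y hy => ?_⟩
    obtain ⟨hne, ρ, hρ⟩ := hM y hy
    rw [← hρ]
    exact hTpow fun h => hne (by rw [← hρ, h, zero_pow hp.ne_zero])

end LocalAction

end WildInstance

section Coarsening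

open MulAction

/-- The coarsening of a valuation ring obtained by inverting an element of it. -/
def ValuationSubring.invert {L : Type*} [Field L] (A : ValuationSubring L) (π : L) (hπ : π ∈ A) :
    ValuationSubring L where
  carrier := {x | ∃ n : ℕ, π ^ n * x ∈ A}
  mul_mem' := by
    rintro x y ⟨n, hn⟩ ⟨m, hm⟩
    exact ⟨n + m, by convert A.mul_mem _ _ hn hm using 1; ring⟩
  one_mem' := ⟨0, by simp⟩
  add_mem' := by
    rintro x y ⟨n, hn⟩ ⟨m, hm⟩
    exact ⟨n + m, by
      convert A.add_mem _ _ (A.mul_mem _ _ (pow_mem hπ m) hn)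
        (A.mul_mem _ _ (pow_mem hπ n) hm) using 1; ring⟩
  zero_mem' := ⟨0, by simp⟩
  neg_mem' := by
    rintro x ⟨n, hn⟩
    exact ⟨n, by simpa using hn⟩
  mem_or_inv_mem' x := (A.mem_or_inv_mem x).imp (fun h => ⟨0, by simpa⟩) fun h => ⟨0, by simpa⟩

lemma ValuationSubring.mem_invert {L : Type*} [Field L] {A : ValuationSubring L} {π : L}
    {hπ : π ∈ A} {x : L} : x ∈ A.invert π hπ ↔ ∃ n : ℕ, π ^ n * x ∈ A := Iff.rfl

lemma ValuationSubring.invert_valuation_lt_one {L : Type*} [Field L] {A : ValuationSubring L}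
    {π : L} (hπ : π ∈ A) (π0 : π ≠ 0) (h1 : A.valuation π < 1) {x : L}
    (hx : ∀ n : ℕ, A.valuation x ≤ A.valuation π ^ n) :
    (A.invert π hπ).valuation x < 1 := by
  by_cases x0 : x = 0
  · simp [x0]
  have hpos : 0 < A.valuation π := zero_lt_iff.2 ((Valuation.ne_zero_iff _).2 π0)
  rw [← not_le, ← inv_le_one₀ (zero_lt_iff.2 ((Valuation.ne_zero_iff _).2 x0)), ← map_inv₀,
    ValuationSubring.valuation_le_one_iff, mem_invert]
  rintro ⟨n, hn⟩
  rw [← ValuationSubring.valuation_le_one_iff, map_mul, map_inv₀, map_pow, ← div_eq_mul_inv,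
    div_le_one₀ (zero_lt_iff.2 ((Valuation.ne_zero_iff _).2 x0))] at hn
  have := hn.trans (hx (n + 1))
  rw [pow_succ] at this
  exact absurd this (not_le.2 (mul_lt_of_lt_one_right (pow_pos hpos n) h1))

namespace LocalAction

variable {p l : ℕ} {G Ω : Type*} [Group G] [Field Ω] [MulSemiringAction G Ω]
  {D : LocalAction p G Ω} {H H' : Subgroup G}

/-- A valuation ring of the fixed field of `H` whose residue field is `D.loc H`. -/
structure IsCoarse (D : LocalAction p G Ω) (H : Subgroup G)
    (B : ValuationSubring (fixedSubfield H : Subfield Ω)) : Prop where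
  mem : ∀ c : (fixedSubfield H : Subfield Ω), (c : Ω) ∈ D.E → c ∈ B
  exists_sub : ∀ x ∈ B, ∃ c : (fixedSubfield H : Subfield Ω), (c : Ω) ∈ D.E ∧
    B.valuation (x - c) < 1

variable (D H) in
/-- The intrinsic description of the maximal ideal of a coarse valuation ring. -/
def Infinitesimal (x : Ω) : Prop :=
  x ∈ fixedSubfield H ∧ ∀ c ∈ D.loc H, ∀ n : ℕ, n ≠ 0 →
    ∃ s ∈ fixedSubfield H, s ≠ 0 ∧ 1 + c * x = s ^ n

namespace IsCoarse

variable {B : ValuationSubring (fixedSubfield H : Subfield Ω)} (hB : D.IsCoarse H B)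
include hB

lemma valuation_eq_one {c : (fixedSubfield H : Subfield Ω)} (hc : (c : Ω) ∈ D.E) (c0 : c ≠ 0) :
    B.valuation c = 1 := by
  have h1 := (B.valuation_le_one_iff _).2 (hB.mem c hc)
  have h2 := (B.valuation_le_one_iff _).2 (hB.mem c⁻¹ (D.E.inv_mem hc))
  rw [map_inv₀, inv_le_one₀ (zero_lt_iff.2 ((Valuation.ne_zero_iff _).2 c0))] at h2
  exact le_antisymm h1 h2

lemma eq_of_valuation_sub_lt {c d : (fixedSubfield H : Subfield Ω)} (hc : (c : Ω) ∈ D.E)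
    (hd : (d : Ω) ∈ D.E) (h : B.valuation (c - d) < 1) : c = d := by
  by_contra hne
  exact h.ne (hB.valuation_eq_one (c := c - d) (sub_mem hc hd) (sub_ne_zero.2 hne))

/-- A relation `c = s ^ n` modulo the maximal ideal comes from the residue field. -/
lemma exists_pow_eq {c s : (fixedSubfield H : Subfield Ω)} (hc : (c : Ω) ∈ D.E) {n : ℕ}
    (hn : n ≠ 0) (h : B.valuation (s ^ n - c) < 1) :
    ∃ a : (fixedSubfield H : Subfield Ω), (a : Ω) ∈ D.E ∧ a ^ n = c ∧ B.valuation (s - a) < 1 := by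
  have hsn : s ^ n ∈ B := by
    rw [← B.valuation_le_one_iff]
    have := B.valuation.map_add_le (x := s ^ n - c) (y := c) h.le
      ((B.valuation_le_one_iff _).2 (hB.mem c hc))
    rwa [sub_add_cancel] at this
  have hs : s ∈ B := by
    rw [← B.valuation_le_one_iff] at hsn ⊢
    rw [map_pow] at hsn
    exact (pow_le_one_iff hn).1 hsn
  obtain ⟨a, ha, hsa⟩ := hB.exists_sub s hs
  refine ⟨a, ha, ?_, hsa⟩
  refine hB.eq_of_valuation_sub_lt (pow_mem ha n) hc ?_
  have h3 : B.valuation (s ^ n - a ^ n) < 1 := by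
    have hi : ∑ i ∈ Finset.range n, s ^ i * a ^ (n - 1 - i) ∈ B :=
      sum_mem fun i _ => mul_mem (pow_mem hs _) (pow_mem (hB.mem a ha) _)
    rw [← Commute.geom_sum₂_mul (Commute.all s a) n, map_mul]
    exact (mul_le_of_le_one_left' ((B.valuation_le_one_iff _).2 hi)).trans_lt hsa
  have := B.valuation.map_sub_lt h h3
  rwa [sub_sub_sub_cancel_left] at this

lemma infinitesimal_of_valuation_lt_one [IsAlgClosed Ω] [H.FiniteIndex]
    {x : (fixedSubfield H : Subfield Ω)}
    (hx : B.valuation x < 1) : D.Infinitesimal H x := by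
  refine ⟨x.2, fun c hc n hn => ?_⟩
  set C : (fixedSubfield H : Subfield Ω) := ⟨c, hc.1⟩ with hC
  have hCx : B.valuation (C * x) < 1 := by
    rw [map_mul]
    exact (mul_le_of_le_one_left' ((B.valuation_le_one_iff _).2 (hB.mem C hc.2))).trans_lt hx
  have h1 : B.valuation (1 + C * x) = 1 := B.valuation.map_one_add_of_lt hCx
  have h10 : (1 + C * x) ≠ 0 := (B.valuation.ne_zero_iff).1 (by rw [h1]; exact one_ne_zero)
  obtain ⟨d, hd, d0, s, hs, s0, e⟩ := D.exists_eq_mul_pow (1 + C * x).2 (fun h => h10 (Subtype.ext h)) hn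
  set d' : (fixedSubfield H : Subfield Ω) := ⟨d, hd.1⟩
  set s' : (fixedSubfield H : Subfield Ω) := ⟨s, hs⟩
  have d0' : d' ≠ 0 := fun h => d0 (congrArg Subtype.val h)
  have e' : 1 + C * x = d' * s' ^ n := Subtype.ext e
  have hv := hB.valuation_eq_one (c := d'⁻¹) (D.E.inv_mem hd.2) (inv_ne_zero d0')
  obtain ⟨a, ha, han, -⟩ := hB.exists_pow_eq (c := d'⁻¹) (s := s') (D.E.inv_mem hd.2) hn (by
    have : s' ^ n - d'⁻¹ = d'⁻¹ * (C * x) := by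
      rw [show C * x = d' * s' ^ n - 1 by rw [← e']; ring]
      field_simp
    rw [this, map_mul, hv, one_mul]
    exact hCx)
  have a0 : a ≠ 0 := fun h => by
    rw [h, zero_pow hn] at han
    exact inv_ne_zero d0' han.symm
  refine ⟨s' / a, (s' / a).2, by simpa [s'] using ⟨s0, a0⟩, ?_⟩
  have : 1 + C * x = (s' / a) ^ n := by
    rw [e', div_pow, han]
    field_simp
  exact congrArg Subtype.val this

lemma valuation_lt_one_of_infinitesimal [IsAlgClosed Ω] [H.FiniteIndex] {H₁ : Subgroup G}
    (hle : H ≤ H₁) [H₁.FiniteIndex]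
    {x : (fixedSubfield H : Subfield Ω)} (hx : D.Infinitesimal H₁ x) : B.valuation x < 1 := by
  obtain ⟨π, hπ, π0, π1, -⟩ := D.exists_unif H₁ inferInstance
  obtain ⟨ϖ, hϖ, ϖ0, ϖ1, hdisc⟩ := D.exists_unif H inferInstance
  have hπ' : π ∈ D.loc H := loc_anti hle hπ
  have πne : π ≠ 0 := fun h => by rw [h, D.N_zero] at π0; exact π0.false
  -- no element of absolute value different from one has roots of all orders
  have key : ∀ c ∈ D.loc H, c ≠ 0 → D.N c ≠ 1 →
      ∃ n ≠ 0, ∀ b ∈ D.loc H, b ^ n ≠ c := fun c hc c0 hN => by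
    obtain ⟨j, hj⟩ := hdisc c hc c0
    refine ⟨j.natAbs + 1, Nat.succ_ne_zero _, fun b hb hbc => ?_⟩
    have b0 : b ≠ 0 := by rintro rfl; exact c0 (by rw [← hbc, zero_pow (Nat.succ_ne_zero _)])
    obtain ⟨i, hi⟩ := hdisc b hb b0
    rw [← hbc, N_pow hb.2, hi, ← zpow_natCast, ← zpow_mul] at hj
    have hij := zpow_right_injective₀ ϖ0 ϖ1.ne hj
    have hd : ((j.natAbs + 1 : ℕ) : ℤ) ∣ j := ⟨i, hij.symm.trans (mul_comm _ _)⟩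
    have hj0 : j = 0 := Int.eq_zero_of_abs_lt_dvd hd (by
      push_cast; exact lt_add_one _)
    rw [← hbc, N_pow hb.2, hi, ← zpow_natCast, ← zpow_mul, hij, hj0, zpow_zero] at hN
    exact hN rfl
  by_contra! hge
  have x0 : x ≠ 0 := by
    rintro rfl
    simp at hge
  rcases hge.eq_or_lt with h1 | hgt
  · obtain ⟨a, ha, hxa⟩ := hB.exists_sub x ((B.valuation_le_one_iff _).1 h1.ge)
    have a0 : a ≠ 0 := by
      rintro rfl
      rw [sub_zero, ← h1] at hxa
      exact hxa.false
    have aN := D.N_pos ha (by simpa using a0)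
    obtain ⟨m, hm⟩ := exists_pow_lt_of_lt_one aN π1
    set c : Ω := (π ^ m)⁻¹ with hc
    have hcE : c ∈ D.loc H₁ := inv_mem (pow_mem hπ m)
    have hcE' : c ∈ D.loc H := loc_anti hle hcE
    have caE : c * a ∈ D.loc H := mul_mem hcE' ⟨a.2, ha⟩
    have hca : 1 < D.N (c * a) := by
      rw [D.N_mul hcE.2 ha, hc, N_inv (pow_mem hπ.2 m), N_pow hπ.2, inv_mul_eq_div]
      exact (one_lt_div (pow_pos π0 m)).2 hm
    have hN : D.N (1 + c * a) = D.N (c * a) := by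
      rw [add_comm]
      exact N_add_eq caE.2 (one_mem _) (by rwa [N_one])
    have hE1 : 1 + c * a ∈ D.loc H := add_mem (one_mem _) caE
    obtain ⟨n, hn, hroot⟩ := key (1 + c * a) hE1
      (fun h0 => by rw [h0, D.N_zero] at hN; linarith) (by rw [hN]; exact hca.ne')
    obtain ⟨s, hs, s0, e⟩ := hx.2 c hcE n hn
    set c' : (fixedSubfield H : Subfield Ω) := ⟨c, hcE'.1⟩
    obtain ⟨b, hb, hbn, -⟩ := hB.exists_pow_eq (c := 1 + c' * a)
      (s := ⟨s, fixedSubfield_anti hle hs⟩) hE1.2 hn (by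
      have : (⟨s, fixedSubfield_anti hle hs⟩ : (fixedSubfield H : Subfield Ω)) ^ n - (1 + c' * a)
          = c' * (x - a) := by
        rw [mul_sub, sub_eq_iff_eq_add]
        refine Subtype.ext ?_
        refine e.symm.trans ?_
        push_cast
        ring
      rw [this, map_mul]
      exact (mul_le_of_le_one_left' ((B.valuation_le_one_iff _).2
        (hB.mem c' hcE'.2))).trans_lt hxa)
    exact hroot b ⟨b.2, hb⟩ (congrArg Subtype.val hbn)
  · have hinv : B.valuation x⁻¹ < 1 := by
      rw [map_inv₀]; exact inv_lt_one_of_one_lt₀ hgt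
    have hI := hB.infinitesimal_of_valuation_lt_one hinv
    have x0' : (x : Ω) ≠ 0 := by simpa using x0
    have hpow : ∀ c ∈ D.loc H₁, c ≠ 0 → ∀ n : ℕ, n ≠ 0 → ∃ s ∈ fixedSubfield H, s ≠ 0 ∧
        c * x = s ^ n := fun c hc c0 n hn => by
      obtain ⟨s, hs, s0, e⟩ := hx.2 c hc n hn
      obtain ⟨t, ht, t0, e'⟩ := hI.2 c⁻¹ (loc_anti hle (inv_mem hc)) n hn
      refine ⟨s / t, div_mem (fixedSubfield_anti hle hs) ht, div_ne_zero s0 t0, ?_⟩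
      rw [div_pow, ← e, ← e', eq_div_iff (by rw [e']; exact pow_ne_zero n t0)]
      push_cast
      field_simp
      ring
    obtain ⟨n, hn, hroot⟩ := key π hπ' πne π1.ne
    obtain ⟨s, hs, s0, e⟩ := hpow π hπ πne n hn
    obtain ⟨t, ht, t0, e'⟩ := hpow 1 (one_mem _) one_ne_zero n hn
    have hst : (s / t) ^ n = π := by
      rw [div_pow, ← e, ← e']
      field_simp
    have hstH : s / t ∈ fixedSubfield H := div_mem hs ht
    exact hroot (s / t) ⟨hstH, D.mem_of_pow hn (by rw [hst]; exact hπ.2)⟩ hst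

lemma mem_iff_of_le [IsAlgClosed Ω] [H.FiniteIndex] (hle : H' ≤ H) [H'.FiniteIndex]
    {B' : ValuationSubring (fixedSubfield H' : Subfield Ω)} (hB' : D.IsCoarse H' B') {x : Ω}
    (hx : x ∈ fixedSubfield H) (hx' : x ∈ fixedSubfield H') :
    (⟨x, hx⟩ : (fixedSubfield H : Subfield Ω)) ∈ B ↔
      (⟨x, hx'⟩ : (fixedSubfield H' : Subfield Ω)) ∈ B' := by
  have small : ∀ y (hy : y ∈ fixedSubfield H) (hy' : y ∈ fixedSubfield H'),
      B.valuation (⟨y, hy⟩ : (fixedSubfield H : Subfield Ω)) < 1 →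
      B'.valuation (⟨y, hy'⟩ : (fixedSubfield H' : Subfield Ω)) < 1 := fun y hy hy' h =>
    hB'.valuation_lt_one_of_infinitesimal hle (hB.infinitesimal_of_valuation_lt_one h)
  constructor
  · intro h
    obtain ⟨c, hc, hxc⟩ := hB.exists_sub _ h
    have h1 := small _ (sub_mem hx c.2) (fixedSubfield_anti hle (sub_mem hx c.2)) hxc
    have h2 := add_mem ((B'.valuation_le_one_iff _).1 h1.le)
      (hB'.mem ⟨c, fixedSubfield_anti hle c.2⟩ hc)
    convert h2 using 1
    exact Subtype.ext (sub_add_cancel _ _).symm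
  · intro h
    by_contra hn
    have x0 : x ≠ 0 := by
      rintro rfl
      exact hn (zero_mem B)
    rw [← B.valuation_le_one_iff, not_le] at hn
    have h1 : B.valuation (⟨x, hx⟩⁻¹ : (fixedSubfield H : Subfield Ω)) < 1 := by
      rw [map_inv₀]; exact inv_lt_one_of_one_lt₀ hn
    have h2 : B'.valuation (⟨x, hx'⟩⁻¹ : (fixedSubfield H' : Subfield Ω)) < 1 :=
      small x⁻¹ (inv_mem hx) (inv_mem hx') h1
    have h3 := (B'.valuation_le_one_iff _).2 h
    rw [map_inv₀, inv_lt_one₀ (zero_lt_iff.2 ((Valuation.ne_zero_iff _).2 fun h0 =>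
      x0 (congrArg Subtype.val h0)))] at h2
    exact absurd h3 (not_le.2 h2)

end IsCoarse

variable [IsAlgClosed Ω] [CharZero Ω]

lemma exists_isCoarse (h : TameLevel p l Ω H) (hp : p.Prime) {ζ : Ω} (hζ : IsPrimitiveRoot ζ p)
    (hζH : ζ ∈ fixedSubfield H) : ∃ B, D.IsCoarse H B := by
  obtain ⟨ϖ, hϖ, π0, π1, hdisc⟩ := D.exists_unif H h.finiteIndex
  set π : (fixedSubfield H : Subfield Ω) := ⟨ϖ, hϖ.1⟩ with hπ
  obtain ⟨T, W⟩ := exists_wildDatum h hp hζ hζH (π := π) hϖ.2 π0 π1 hdisc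
  set A := D.tameRing h with hA
  have hint : ∀ x : (fixedSubfield H : Subfield Ω), (x : Ω) ∈ D.E → D.N x ≤ 1 → x ∈ A :=
    fun x hx hN => (A.valuation_le_one_iff _).1 (tameRing_valuation_le_one_of_N h hx hN)
  have πA : π ∈ A := hint π hϖ.2 π1.le
  have hπv := W.unif_lt
  have πne := W.unif_ne_zero
  have ϖne : ϖ ≠ 0 := fun h0 => πne (Subtype.ext h0)
  have hloc : ∀ c : (fixedSubfield H : Subfield Ω), (c : Ω) ∈ D.E → c ∈ A.invert π πA :=
    fun c hc => by
      by_cases c0 : c = 0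
      · rw [c0]; exact zero_mem _
      obtain ⟨j, hj⟩ := hdisc c ⟨c.2, hc⟩ (by simpa using c0)
      refine ⟨j.natAbs, hint _ (mul_mem (pow_mem hϖ.2 _) hc) ?_⟩
      push_cast
      rw [D.N_mul (pow_mem hϖ.2 _) hc, N_pow hϖ.2, hj, ← zpow_natCast, ← zpow_add₀ π0.ne']
      exact zpow_le_one₀ π0 π1.le (by omega)
  refine ⟨A.invert π πA, hloc, fun x hx => ?_⟩
  obtain ⟨n, hn⟩ := hx
  set X := π ^ n * x with hX
  have step : ∀ y ∈ A, ∃ c : (fixedSubfield H : Subfield Ω), ((c : Ω) ∈ D.E ∧ D.N c ≤ 1) ∧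
      A.valuation (y - c) ≤ A.valuation π := fun y hy => by
    obtain ⟨c, hc, h⟩ := W.exists_sub_le ((A.valuation_le_one_iff _).2 hy)
    exact ⟨c, ⟨hc.1.2, hc.2⟩, h⟩
  choose! f hf hfv using step
  have hvpos : ∀ i : ℕ, A.valuation π ^ i ≠ 0 := fun i =>
    pow_ne_zero i ((Valuation.ne_zero_iff _).2 πne)
  have hquot : ∀ (i : ℕ) (y : (fixedSubfield H : Subfield Ω)),
      A.valuation y ≤ A.valuation π ^ i → y / π ^ i ∈ A := fun i y hy => by
    rw [← A.valuation_le_one_iff, map_div₀, map_pow]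
    exact div_le_one_of_le₀ hy zero_le
  obtain ⟨c, hc0, hcs⟩ : ∃ c : ℕ → (fixedSubfield H : Subfield Ω), c 0 = 0 ∧
      ∀ i, c (i + 1) = c i + π ^ i * f ((X - c i) / π ^ i) :=
    ⟨fun i => Nat.rec 0 (fun i y => y + π ^ i * f ((X - y) / π ^ i)) i, rfl, fun _ => rfl⟩
  have hcv : ∀ i, A.valuation (X - c i) ≤ A.valuation π ^ i := fun i => by
    induction i with
    | zero => rw [hc0, sub_zero, pow_zero]; exact (A.valuation_le_one_iff _).2 hn
    | succ i ih =>
      have h1 := hfv _ (hquot i _ ih)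
      have e : X - c (i + 1) = π ^ i * ((X - c i) / π ^ i - f ((X - c i) / π ^ i)) := by
        rw [hcs, mul_sub, mul_div_cancel₀ _ (pow_ne_zero i πne)]; ring
      rw [e, map_mul, map_pow, pow_succ]
      exact mul_le_mul_right h1 _
  have hfE := fun i => hf _ (hquot i _ (hcv i))
  have hcE : ∀ i, (c i : Ω) ∈ D.E := fun i => by
    induction i with
    | zero => rw [hc0]; exact zero_mem D.E
    | succ i ih =>
      rw [hcs]
      exact add_mem ih (mul_mem (pow_mem hϖ.2 i) (hfE i).1)
  obtain ⟨a, ha, haN⟩ := D.complete H h.finiteIndex (D.N ϖ) (fun i => c i) π0 π1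
    (fun i => ⟨(c i).2, hcE i⟩) fun i => by
      have e : (c (i + 1) : Ω) - c i = ϖ ^ i * f ((X - c i) / π ^ i) := by
        rw [hcs]; push_cast; rw [hπ]; ring
      rw [e, D.N_mul (pow_mem hϖ.2 i) (hfE i).1, N_pow hϖ.2]
      exact mul_le_of_le_one_right (pow_nonneg π0.le i) (hfE i).2
  set a' : (fixedSubfield H : Subfield Ω) := ⟨a, ha.1⟩ with ha'
  have hXa : ∀ i : ℕ, A.valuation (X - a') ≤ A.valuation π ^ i := fun i => by
    have h1 : A.valuation (a' - c i) ≤ A.valuation π ^ i := by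
      have h2 : (a' - c i) / π ^ i ∈ A := hint _
        (div_mem (sub_mem ha.2 (hcE i)) (pow_mem hϖ.2 i)) (by
          push_cast
          rw [N_div (sub_mem ha.2 (hcE i)) (pow_mem hϖ.2 i), N_pow hϖ.2]
          exact div_le_one_of_le₀ (haN i) (pow_nonneg π0.le i))
      rw [← A.valuation_le_one_iff, map_div₀, map_pow,
        div_le_one₀ (zero_lt_iff.2 (hvpos i))] at h2
      exact h2
    have := A.valuation.map_sub_le (hcv i) h1
    rwa [sub_sub_sub_cancel_right] at this
  refine ⟨a' / π ^ n, div_mem ha.2 (pow_mem hϖ.2 n), ?_⟩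
  refine ValuationSubring.invert_valuation_lt_one πA πne hπv fun i => ?_
  have e : x - a' / π ^ n = (X - a') / π ^ n := by
    rw [sub_div, hX, mul_div_cancel_left₀ _ (pow_ne_zero n πne)]
  rw [e, map_div₀, map_pow, div_le_iff₀ (zero_lt_iff.2 (hvpos n)), ← pow_add]
  exact hXa _

end LocalAction

end Coarsening

section Gluing

open MulAction

lemma smul_mem_fixedSubfield_of_normal {G Ω : Type*} [Group G] [Field Ω] [MulSemiringAction G Ω]
    {H : Subgroup G} (hH : H.Normal) (σ : G) {x : Ω} (hx : x ∈ fixedSubfield H) :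
    σ • x ∈ fixedSubfield H := fun τ hτ => by
  have := hx (σ⁻¹ * τ * σ) (by simpa using hH.conj_mem τ hτ σ⁻¹)
  rw [mul_smul, mul_smul, inv_smul_eq_iff] at this
  exact this

namespace LocalAction

variable {p : ℕ} {G Ω : Type*} [Group G] [Field Ω] [MulSemiringAction G Ω]
  {D : LocalAction p G Ω} {H : Subgroup G}

lemma Infinitesimal.smul (hH : H.Normal) (σ : G) {x : Ω} (hx : D.Infinitesimal H x) :
    D.Infinitesimal H (σ • x) := by
  refine ⟨smul_mem_fixedSubfield_of_normal hH σ hx.1, fun c hc n hn => ?_⟩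
  obtain ⟨s, hs, s0, e⟩ := hx.2 (σ⁻¹ • c)
    ⟨smul_mem_fixedSubfield_of_normal hH _ hc.1, D.smul_mem _ hc.2⟩ n hn
  refine ⟨σ • s, smul_mem_fixedSubfield_of_normal hH σ hs, (smul_ne_zero_iff_ne σ).2 s0, ?_⟩
  rw [← smul_pow', ← e, smul_add, smul_one, smul_mul', smul_inv_smul]

/-- The valuation ring attached to an action of local type. -/
theorem exists_valuationSubring [IsAlgClosed Ω] [CharZero Ω] (D : LocalAction p G Ω)
    (hp : p.Prime) : ∃ O : ValuationSubring Ω, (∀ c ∈ D.E, c ∈ O) ∧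
      (∀ (σ : G), ∀ x ∈ O, σ • x ∈ O) ∧
      ∀ x ∈ O, (∀ σ : G, σ • x = x) →
        ∃ c ∈ D.E, (∀ σ : G, σ • c = c) ∧ O.valuation (x - c) < 1 := by
  obtain ⟨l, hl, hodd, hcop⟩ : ∃ l : ℕ, l.Prime ∧ Odd l ∧ l.Coprime p := by
    by_cases h3 : p = 3
    · exact ⟨5, by norm_num, by decide, by rw [h3]; norm_num⟩
    · exact ⟨3, by norm_num, by decide, (Nat.coprime_primes (by norm_num) hp).2 (Ne.symm h3)⟩
  have : NeZero (p : Ω) := ⟨Nat.cast_ne_zero.2 hp.ne_zero⟩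
  have : NeZero (l : Ω) := ⟨Nat.cast_ne_zero.2 hl.ne_zero⟩
  obtain ⟨ζ, hζ⟩ := HasEnoughRootsOfUnity.exists_primitiveRoot Ω p
  obtain ⟨ξ, hξ⟩ := HasEnoughRootsOfUnity.exists_primitiveRoot Ω l
  let Level : (H : Subgroup G) → ValuationSubring (fixedSubfield H : Subfield Ω) → Prop :=
    fun H B => H.Normal ∧ H.FiniteIndex ∧ D.IsCoarse H B
  have hcommon : ∀ H₀ : Subgroup G, H₀.FiniteIndex → ∃ H ≤ H₀, ∃ B, Level H B := fun H₀ h₀ => by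
    have := D.finiteIndex_stabilizer ζ
    have := D.finiteIndex_stabilizer ξ
    set H := (H₀ ⊓ stabilizer G ζ ⊓ stabilizer G ξ).normalCore with hH
    have hle : H ≤ _ := Subgroup.normalCore_le _
    have hfin : H.FiniteIndex := by rw [hH]; infer_instance
    have hT : TameLevel p l Ω H := ⟨hfin, hl, hodd, hcop, ξ, hξ, fun σ hσ => (hle hσ).2⟩
    obtain ⟨B, hB⟩ := exists_isCoarse (D := D) hT hp hζ (fun σ hσ => (hle hσ).1.2)
    exact ⟨H, fun σ hσ => (hle hσ).1.1, B, Subgroup.normalCore_normal _, hfin, hB⟩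
  have hpair : ∀ x y : Ω, ∃ H B, Level H B ∧ x ∈ fixedSubfield H ∧ y ∈ fixedSubfield H :=
    fun x y => by
      have := D.finiteIndex_stabilizer x
      have := D.finiteIndex_stabilizer y
      obtain ⟨H, hH, B, hB⟩ := hcommon (stabilizer G x ⊓ stabilizer G y) inferInstance
      exact ⟨H, B, hB, fun σ hσ => (hH hσ).1, fun σ hσ => (hH hσ).2⟩
  let P : Ω → Prop := fun x => ∃ H B, Level H B ∧ ∃ hx : x ∈ fixedSubfield H,
    (⟨x, hx⟩ : (fixedSubfield H : Subfield Ω)) ∈ B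
  have hP : ∀ {x H B}, Level H B → ∀ hx : x ∈ fixedSubfield H,
      (P x ↔ (⟨x, hx⟩ : (fixedSubfield H : Subfield Ω)) ∈ B) := fun {x H B} hB hx => by
    refine ⟨?_, fun h => ⟨H, B, hB, hx, h⟩⟩
    rintro ⟨H', B', hB', hx', h⟩
    have := hB.2.1
    have := hB'.2.1
    obtain ⟨H₁, hle, B₁, hB₁⟩ := hcommon (H ⊓ H') inferInstance
    have := hB₁.2.1
    have hx₁ := fixedSubfield_anti (hle.trans inf_le_left) hx
    rw [hB.2.2.mem_iff_of_le (hle.trans inf_le_left) hB₁.2.2 hx hx₁,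
      ← hB'.2.2.mem_iff_of_le (hle.trans inf_le_right) hB₁.2.2 hx' hx₁]
    exact h
  have hPmul : ∀ {x y}, P x → P y → P (x * y) := fun {x y} hx hy => by
    obtain ⟨H, B, hB, h1, h2⟩ := hpair x y
    exact (hP hB (mul_mem h1 h2)).2 (B.mul_mem _ _ ((hP hB h1).1 hx) ((hP hB h2).1 hy))
  have hPadd : ∀ {x y}, P x → P y → P (x + y) := fun {x y} hx hy => by
    obtain ⟨H, B, hB, h1, h2⟩ := hpair x y
    exact (hP hB (add_mem h1 h2)).2 (B.add_mem _ _ ((hP hB h1).1 hx) ((hP hB h2).1 hy))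
  have hPE : ∀ c ∈ D.E, P c := fun c hc => by
    obtain ⟨H, B, hB, h1, -⟩ := hpair c c
    exact (hP hB h1).2 (hB.2.2.mem _ hc)
  let O : ValuationSubring Ω :=
    { carrier := {x | P x}
      mul_mem' := hPmul
      one_mem' := hPE 1 (one_mem _)
      add_mem' := hPadd
      zero_mem' := hPE 0 (zero_mem _)
      neg_mem' := fun {x} hx => by
        rw [← neg_one_mul]
        exact hPmul (hPE _ (neg_mem (one_mem _))) hx
      mem_or_inv_mem' := fun x => by
        obtain ⟨H, B, hB, h1, -⟩ := hpair x x
        exact (B.mem_or_inv_mem ⟨x, h1⟩).imp (hP hB h1).2 (hP hB (inv_mem h1)).2 }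
  have hO : ∀ {x}, x ∈ O ↔ P x := Iff.rfl
  refine ⟨O, hPE, fun σ x hx => ?_, fun x hx hfix => ?_⟩
  · obtain ⟨H, B, hB, h1, h⟩ := hx
    have := hB.2.1
    obtain ⟨c, hc, hv⟩ := hB.2.2.exists_sub _ h
    have hI := (hB.2.2.infinitesimal_of_valuation_lt_one hv).smul hB.1 σ
    have h3 := hB.2.2.valuation_lt_one_of_infinitesimal (x := ⟨_, hI.1⟩) le_rfl hI
    have h4 := (hP hB hI.1).2 ((B.valuation_le_one_iff _).1 h3.le)
    have h5 := hPadd h4 (hPE (σ • c) (D.smul_mem σ hc))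
    rw [← smul_add] at h5
    push_cast at h5
    rwa [sub_add_cancel] at h5
  · obtain ⟨H, B, hB, h1, h⟩ := hx
    have := hB.2.1
    obtain ⟨c, hc, hv⟩ := hB.2.2.exists_sub _ h
    refine ⟨c, hc, fun σ => ?_, ?_⟩
    · have hI := (hB.2.2.infinitesimal_of_valuation_lt_one hv).smul hB.1 σ
      have h3 := hB.2.2.valuation_lt_one_of_infinitesimal (x := ⟨_, hI.1⟩) le_rfl hI
      have h4 := smul_mem_fixedSubfield_of_normal hB.1 σ c.2
      have h5 := B.valuation.map_sub_lt h3 hv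
      have e : (⟨_, hI.1⟩ - (⟨x, h1⟩ - c) : (fixedSubfield H : Subfield Ω)) = c - ⟨σ • c, h4⟩ := by
        refine Subtype.ext ?_
        push_cast
        rw [smul_sub, hfix]
        ring
      rw [e] at h5
      exact (congrArg Subtype.val
        (hB.2.2.eq_of_valuation_sub_lt hc (d := ⟨σ • c, h4⟩) (D.smul_mem σ hc) h5)).symm
    · by_cases h0 : x - c = 0
      · rw [h0]; simp
      have hy : x - c ∈ fixedSubfield H := sub_mem h1 c.2
      have h0' : (⟨x, h1⟩ - c : (fixedSubfield H : Subfield Ω)) ≠ 0 := fun h =>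
        h0 (congrArg Subtype.val h)
      rw [← not_le, ← inv_le_one₀ (zero_lt_iff.2 ((Valuation.ne_zero_iff _).2 h0')), ← map_inv₀,
        B.valuation_le_one_iff] at hv
      rw [← not_le, ← inv_le_one₀ (zero_lt_iff.2 ((Valuation.ne_zero_iff _).2 h0)), ← map_inv₀,
        O.valuation_le_one_iff]
      exact fun h => hv ((hP hB (inv_mem hy)).1 h)

end LocalAction

end Gluing

section ProperNormedField

open scoped NormedField Valued

variable {L : Type*} [NontriviallyNormedField L] [IsUltrametricDist L] [ProperSpace L]

instance compactSpace_integer : CompactSpace 𝒪[L] := by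
  rw [← isCompact_univ_iff, Subtype.isCompact_iff, Set.image_univ, Subtype.range_coe_subtype]
  convert isCompact_closedBall (0 : L) 1 using 1
  ext x
  simpa using Valued.integer.mem_iff

variable (L) in
theorem exists_norm_uniformizer : ∃ π : L, 0 < ‖π‖ ∧ ‖π‖ < 1 ∧
    ∀ c : L, c ≠ 0 → ∃ j : ℤ, ‖c‖ = ‖π‖ ^ j := by
  have : (Valued.v : Valuation L NNReal).IsNontrivial :=
    (inferInstance : (NormedField.valuation (K := L)).IsNontrivial)
  have : IsDiscreteValuationRing 𝒪[L] := Valued.integer.isDiscreteValuationRing_of_compactSpace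
  obtain ⟨π, hπ⟩ := IsDiscreteValuationRing.exists_irreducible 𝒪[L]
  have key : ∀ c : L, c ≠ 0 → ‖c‖ ≤ 1 → ∃ j : ℤ, ‖c‖ = ‖(π : L)‖ ^ j := by
    intro c hc h1
    obtain ⟨n, u, hu⟩ := IsDiscreteValuationRing.eq_unit_mul_pow_irreducible
      (x := (⟨c, Valued.integer.mem_iff.2 h1⟩ : 𝒪[L])) (fun h => hc (congrArg Subtype.val h)) hπ
    refine ⟨n, ?_⟩
    have := congrArg (fun x : 𝒪[L] => ‖(x : L)‖) hu
    simpa using this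
  refine ⟨π, Valued.integer.norm_irreducible_pos hπ, Valued.integer.norm_irreducible_lt_one hπ,
    fun c hc => ?_⟩
  rcases le_total ‖c‖ 1 with h | h
  · exact key c hc h
  · obtain ⟨j, hj⟩ := key c⁻¹ (inv_ne_zero hc) (by rw [norm_inv]; exact inv_le_one_of_one_le₀ h)
    exact ⟨-j, by rw [zpow_neg, ← hj, norm_inv, inv_inv]⟩

variable (L) in
theorem finite_residueField : Finite 𝓀[L] :=
  let _ : (Valued.v : Valuation L NNReal).RankOne :=
    (inferInstance : (NormedField.valuation (K := L)).RankOne)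
  (Valued.integer.compactSpace_iff_completeSpace_and_isDiscreteValuationRing_and_finite_residueField.1
    inferInstance).2.2

omit [ProperSpace L] in
theorem residue_eq_zero_iff_norm_lt_one (x : 𝒪[L]) :
    IsLocalRing.residue 𝒪[L] x = 0 ↔ ‖(x : L)‖ < 1 := by
  rw [IsLocalRing.residue_eq_zero_iff, IsLocalRing.mem_maximalIdeal, mem_nonunits_iff,
    Valued.integer.isUnit_iff_norm_eq_one]
  exact ⟨fun h => lt_of_le_of_ne (Valued.integer.mem_iff.1 x.2) h, fun h => h.ne⟩

theorem exists_norm_sub_le_pow {t : ℝ} (ht : t < 1) {c : ℕ → L}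
    (hc : ∀ n, ‖c (n + 1) - c n‖ ≤ t ^ n) : ∃ a, ∀ n, ‖a - c n‖ ≤ t ^ n := by
  have h0 : 0 ≤ t := by simpa using (norm_nonneg _).trans (hc 1)
  have hmono : ∀ n m, n ≤ m → ‖c m - c n‖ ≤ t ^ n := by
    intro n m hnm
    induction m, hnm using Nat.le_induction with
    | base => simpa using pow_nonneg h0 n
    | succ m hnm ih =>
      rw [← sub_add_sub_cancel _ (c m)]
      exact (IsUltrametricDist.norm_add_le_max _ _).trans
        (max_le ((hc m).trans (pow_le_pow_of_le_one h0 ht.le hnm)) ih)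
  have hC : CauchySeq c := by
    refine cauchySeq_of_le_geometric t 1 ht fun n => ?_
    rw [dist_comm, dist_eq_norm, one_mul]
    exact hc n
  obtain ⟨a, ha⟩ := cauchySeq_tendsto_of_complete hC
  refine ⟨a, fun n => le_of_tendsto (ha.sub_const (c n)).norm ?_⟩
  filter_upwards [Filter.eventually_ge_atTop n] with m hm using hmono n m hm

end ProperNormedField

section FiniteExtension

variable (p : ℕ) [Fact p.Prime] (L : Type) [Field L] [Algebra ℚ_[p] L]

theorem spectralNorm_mul_eq [Algebra.IsAlgebraic ℚ_[p] L] (x y : L) :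
    spectralNorm ℚ_[p] L (x * y) = spectralNorm ℚ_[p] L x * spectralNorm ℚ_[p] L y :=
  spectralAlgNorm_mul x y

variable [FiniteDimensional ℚ_[p] L]

theorem exists_spectralNorm_uniformizer : ∃ π : L, 0 < spectralNorm ℚ_[p] L π ∧
    spectralNorm ℚ_[p] L π < 1 ∧
    ∀ c : L, c ≠ 0 → ∃ j : ℤ, spectralNorm ℚ_[p] L c = spectralNorm ℚ_[p] L π ^ j := by
  let := spectralNorm.nontriviallyNormedField ℚ_[p] L
  let := spectralNorm.normedAlgebra ℚ_[p] L
  have : IsUltrametricDist L :=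
    IsUltrametricDist.isUltrametricDist_of_isNonarchimedean_norm isNonarchimedean_spectralNorm
  have : ProperSpace L := FiniteDimensional.proper ℚ_[p] L
  exact exists_norm_uniformizer L

theorem exists_spectralNorm_sub_le_pow {t : ℝ} (ht : t < 1) {c : ℕ → L}
    (hc : ∀ n, spectralNorm ℚ_[p] L (c (n + 1) - c n) ≤ t ^ n) :
    ∃ a, ∀ n, spectralNorm ℚ_[p] L (a - c n) ≤ t ^ n := by
  let := spectralNorm.nontriviallyNormedField ℚ_[p] L
  let := spectralNorm.normedAlgebra ℚ_[p] L
  have : IsUltrametricDist L :=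
    IsUltrametricDist.isUltrametricDist_of_isNonarchimedean_norm isNonarchimedean_spectralNorm
  have : ProperSpace L := FiniteDimensional.proper ℚ_[p] L
  exact exists_norm_sub_le_pow ht hc

open scoped NormedField Valued in
theorem exists_spectralNorm_residue : ∃ (κ : Type) (_ : Field κ) (_ : Finite κ) (r : L → κ),
    r 1 = 1 ∧ (∀ a, ∃ x, spectralNorm ℚ_[p] L x ≤ 1 ∧ r x = a) ∧
    (∀ x, spectralNorm ℚ_[p] L x ≤ 1 → (r x = 0 ↔ spectralNorm ℚ_[p] L x < 1)) ∧
    ∀ x y, spectralNorm ℚ_[p] L x ≤ 1 → spectralNorm ℚ_[p] L y ≤ 1 →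
      r (x + y) = r x + r y ∧ r (x * y) = r x * r y := by
  classical
  let := spectralNorm.nontriviallyNormedField ℚ_[p] L
  let := spectralNorm.normedAlgebra ℚ_[p] L
  have : IsUltrametricDist L :=
    IsUltrametricDist.isUltrametricDist_of_isNonarchimedean_norm isNonarchimedean_spectralNorm
  have : ProperSpace L := FiniteDimensional.proper ℚ_[p] L
  have hmem : ∀ x : L, spectralNorm ℚ_[p] L x ≤ 1 ↔ x ∈ 𝒪[L] := fun x =>
    (Valued.integer.mem_iff (K := L)).symm
  let r : L → 𝓀[L] := fun x => if h : x ∈ 𝒪[L] then IsLocalRing.residue 𝒪[L] ⟨x, h⟩ else 0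
  have hr : ∀ x (h : x ∈ 𝒪[L]), r x = IsLocalRing.residue 𝒪[L] ⟨x, h⟩ := fun x h => dif_pos h
  refine ⟨𝓀[L], inferInstance, finite_residueField L, r, ?_, fun a => ?_, fun x hx => ?_,
    fun x y hx hy => ?_⟩
  · rw [hr 1 (one_mem _)]
    exact map_one (IsLocalRing.residue 𝒪[L])
  · obtain ⟨x, rfl⟩ := IsLocalRing.residue_surjective a
    exact ⟨x, (hmem _).2 x.2, hr _ _⟩
  · rw [hr x ((hmem x).1 hx)]
    exact residue_eq_zero_iff_norm_lt_one _
  · rw [hmem] at hx hy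
    rw [hr x hx, hr y hy, hr _ (add_mem hx hy), hr _ (mul_mem hx hy), ← map_add, ← map_mul]
    exact ⟨rfl, rfl⟩

end FiniteExtension

section GaloisLocalAction

open MulAction

theorem finiteDimensional_fixedField_of_finiteIndex {k M : Type*} [Field k] [Field M] [Algebra k M]
    [IsGalois k M] (H : Subgroup (M ≃ₐ[k] M)) [H.FiniteIndex] :
    FiniteDimensional k (IntermediateField.fixedField H) := by
  have h1 : H ≤ (IntermediateField.fixedField H).fixingSubgroup :=
    (IntermediateField.le_iff_le H _).1 le_rfl
  have : (IntermediateField.fixedField H).fixingSubgroup.FiniteIndex :=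
    Subgroup.finiteIndex_of_le h1
  exact (InfiniteGalois.isOpen_iff_finite _).1 (Subgroup.isOpen_of_isClosed_of_finiteIndex _
    (InfiniteGalois.fixingSubgroup_isClosed _))

variable {p : ℕ} [Fact p.Prime] {k Ω : Type} [Field k] [Field Ω] [Algebra ℚ_[p] k]
  [Algebra k Ω] [Algebra ℚ_[p] Ω] [IsScalarTower ℚ_[p] k Ω] {M : IntermediateField k Ω}

open scoped Classical in
/-- The spectral norm on `M`, extended by zero. -/
noncomputable def extendedNorm (p : ℕ) [Fact p.Prime] {k Ω : Type} [Field k] [Field Ω]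
    [Algebra ℚ_[p] k] [Algebra k Ω] [Algebra ℚ_[p] Ω] [IsScalarTower ℚ_[p] k Ω]
    (M : IntermediateField k Ω) (x : Ω) : ℝ :=
  if h : x ∈ M then spectralNorm ℚ_[p] M ⟨x, h⟩ else 0

theorem extendedNorm_of_mem {x : Ω} (h : x ∈ M) :
    extendedNorm p M x = spectralNorm ℚ_[p] M ⟨x, h⟩ := dif_pos h

theorem extendedNorm_coe (x : M) : extendedNorm p M (x : Ω) = spectralNorm ℚ_[p] M x :=
  extendedNorm_of_mem x.2

theorem extendedNorm_coe_coe (F : IntermediateField k M) (y : F) :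
    extendedNorm p M ((y : M) : Ω) = spectralNorm ℚ_[p] F y :=
  have : IsScalarTower ℚ_[p] F M := IsScalarTower.of_algebraMap_eq fun _ => rfl
  (extendedNorm_coe (y : M)).trans (spectralNorm.eq_of_tower (K := ℚ_[p]) (L := M) y).symm

variable [MulSemiringAction (M ≃ₐ[k] M) Ω]

theorem mem_fixedSubfield_inf_iff (hact : ∀ (g : M ≃ₐ[k] M) (x : M), g • (x : Ω) = g x)
    (H : Subgroup (M ≃ₐ[k] M)) (x : Ω) :
    x ∈ fixedSubfield H ⊓ M.toSubfield ↔
      ∃ y : IntermediateField.fixedField H, ((y : M) : Ω) = x := by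
  constructor
  · rintro ⟨h1, h2⟩
    refine ⟨⟨⟨x, h2⟩, fun σ => Subtype.ext ?_⟩, rfl⟩
    have := hact σ ⟨x, h2⟩
    exact this.symm.trans (h1 σ σ.2)
  · rintro ⟨y, rfl⟩
    refine ⟨fun σ hσ => ?_, (y : M).2⟩
    rw [hact]
    exact congrArg _ (y.2 ⟨σ, hσ⟩)

/-- The local action of the Galois group of an algebraic extension `M` of a `p`-adic field on a
field containing `M`. -/
noncomputable def LocalAction.ofGalois [FiniteDimensional ℚ_[p] k] [IsGalois k M]
    (hact : ∀ (g : M ≃ₐ[k] M) (x : M), g • (x : Ω) = g x)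
    (hopen : ∀ x : Ω, IsOpen (stabilizer (M ≃ₐ[k] M) x : Set (M ≃ₐ[k] M)))
    (hpow : ∀ {x : Ω} {n : ℕ}, n ≠ 0 → x ^ n ∈ M → x ∈ M) :
    LocalAction p (M ≃ₐ[k] M) Ω :=
  have : Algebra.IsAlgebraic ℚ_[p] M := Algebra.IsAlgebraic.trans ℚ_[p] k M
  have hfin (H : Subgroup (M ≃ₐ[k] M)) (hH : H.FiniteIndex) :
      FiniteDimensional ℚ_[p] (IntermediateField.fixedField H) :=
    have := finiteDimensional_fixedField_of_finiteIndex H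
    FiniteDimensional.trans ℚ_[p] k _
  { E := M.toSubfield
    N := extendedNorm p M
    smul_mem := fun g x hx => by
      rw [hact g ⟨x, hx⟩]
      exact (g ⟨x, hx⟩).2
    mem_of_pow := hpow
    finiteIndex_of_mem := fun {x} _ =>
      have := Subgroup.quotient_finite_of_isOpen _ (hopen x)
      Subgroup.finiteIndex_of_finite_quotient
    exists_stabilizer_le := fun x => by
      obtain ⟨F, hF, h⟩ := (krullTopology_mem_nhds_one_iff k M _).1
        ((hopen x).mem_nhds (one_mem (stabilizer (M ≃ₐ[k] M) x)))
      obtain ⟨α, hα⟩ := Field.exists_primitive_element k F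
      have hFα : F = IntermediateField.adjoin k {(α : M)} := by
        rw [← IntermediateField.lift_adjoin_simple, hα, IntermediateField.lift_top]
      refine ⟨_, (α : M).2, le_trans ?_ h⟩
      rw [← IntermediateField.le_iff_le]
      refine hFα.le.trans (IntermediateField.adjoin_le_iff.2 (Set.singleton_subset_iff.2 ?_))
      exact fun σ => Subtype.ext ((hact σ α).symm.trans σ.2)
    N_zero := by
      rw [extendedNorm_of_mem (zero_mem M)]
      exact spectralNorm_zero
    N_pos := fun {x} hx h0 => by
      rw [extendedNorm_of_mem hx]
      exact spectralNorm_zero_lt (fun h => h0 (congrArg Subtype.val h))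
        (Algebra.IsAlgebraic.isAlgebraic _)
    N_mul := fun {x y} hx hy => by
      rw [extendedNorm_of_mem hx, extendedNorm_of_mem hy, extendedNorm_of_mem (mul_mem hx hy),
        ← spectralNorm_mul_eq]
      rfl
    N_add := fun {x y} hx hy => by
      rw [extendedNorm_of_mem hx, extendedNorm_of_mem hy, extendedNorm_of_mem (add_mem hx hy)]
      exact isNonarchimedean_spectralNorm (K := ℚ_[p]) (⟨x, hx⟩ : M) ⟨y, hy⟩
    N_smul := fun g {x} hx => by
      rw [hact g ⟨x, hx⟩, extendedNorm_coe, extendedNorm_of_mem hx]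
      exact (spectralNorm_eq_of_equiv (g.restrictScalars ℚ_[p]) _).symm
    N_p := by
      have h := spectralNorm_extends (K := ℚ_[p]) (L := M) p
      rw [map_natCast] at h
      have h2 := extendedNorm_coe (p := p) (p : M)
      rw [h] at h2
      exact h2.trans_lt Padic.norm_p_lt_one
    exists_unif := fun H hH => by
      have := hfin H hH
      obtain ⟨π, h0, h1, h⟩ := exists_spectralNorm_uniformizer p (IntermediateField.fixedField H)
      refine ⟨_, (mem_fixedSubfield_inf_iff hact H _).2 ⟨π, rfl⟩, ?_⟩
      simp only [extendedNorm_coe_coe]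
      refine ⟨h0, h1, fun c hc hc0 => ?_⟩
      obtain ⟨c, rfl⟩ := (mem_fixedSubfield_inf_iff hact H _).1 hc
      rw [extendedNorm_coe_coe]
      exact h c (by rintro rfl; exact hc0 rfl)
    exists_residue := fun H hH => by
      have := hfin H hH
      obtain ⟨κ, hκ, hf, r, h1, h2, h3, h4⟩ :=
        exists_spectralNorm_residue p (IntermediateField.fixedField H)
      let ι : IntermediateField.fixedField H → Ω := fun y => ((y : M) : Ω)
      have hι : Function.Injective ι := Subtype.val_injective.comp Subtype.val_injective
      let j : Ω → IntermediateField.fixedField H := Function.invFun ι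
      have hj : ∀ y, j (ι y) = y := Function.leftInverse_invFun hι
      have hN : ∀ y, extendedNorm p M (ι y) = _ := extendedNorm_coe_coe _
      simp only [mem_fixedSubfield_inf_iff hact]
      refine ⟨κ, hκ, hf, r ∘ j, ?_, fun a => ?_, ?_, ?_⟩
      · exact (congrArg r (hj 1)).trans h1
      · obtain ⟨x, hx, rfl⟩ := h2 a
        exact ⟨ι x, ⟨x, rfl⟩, (hN x).trans_le hx, congrArg r (hj x)⟩
      · rintro _ ⟨x, rfl⟩ hx
        change r (j (ι x)) = 0 ↔ extendedNorm p M (ι x) < 1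
        rw [hj, hN]
        exact h3 x (by rwa [← hN])
      · rintro _ ⟨x, rfl⟩ _ ⟨y, rfl⟩ hx hy
        have := h4 x y (by rwa [← hN]) (by rwa [← hN])
        change r (j (ι (x + y))) = r (j (ι x)) + r (j (ι y)) ∧
          r (j (ι (x * y))) = r (j (ι x)) * r (j (ι y))
        simpa only [hj] using this
    complete := fun H hH t c _ ht hc hcc => by
      have := hfin H hH
      simp only [mem_fixedSubfield_inf_iff hact] at hc
      choose y hy using hc
      obtain rfl : c = fun n => ((y n : M) : Ω) := funext fun n => (hy n).symm
      have hsub : ∀ a b : IntermediateField.fixedField H,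
          extendedNorm p M (((a : M) : Ω) - ((b : M) : Ω)) = spectralNorm ℚ_[p] _ (a - b) :=
        fun a b => extendedNorm_coe_coe _ (a - b)
      obtain ⟨a, ha⟩ := exists_spectralNorm_sub_le_pow p (IntermediateField.fixedField H) ht
        (c := y) (fun n => by rw [← hsub]; exact hcc n)
      exact ⟨_, (mem_fixedSubfield_inf_iff hact H _).2 ⟨a, rfl⟩, fun n => by
        rw [hsub]; exact ha n⟩ }

end GaloisLocalAction

theorem coe_resHom_apply {k F Kbar : Type*} [Field k] [Field F] [Field Kbar]
    [Algebra k F] [Algebra F Kbar] [Algebra k Kbar] [IsScalarTower k F Kbar]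
    [IsAlgClosed Kbar] (σ : Kbar ≃ₐ[F] Kbar) (x : algebraicClosure k Kbar) :
    (resHom k F Kbar σ x : Kbar) = σ x :=
  AlgEquiv.restrictNormal_commutes (σ.restrictScalars k) (algebraicClosure k Kbar) x

theorem residueEmbed_bijective {k K : Type*} [Field k] [Field K] [Algebra k K]
    (O : ValuationSubring K) (h : ∀ a : k, algebraMap k K a ∈ O)
    (hO : ∀ x ∈ O, ∃ a : k, x - algebraMap k K a ≠ 0 → (x - algebraMap k K a)⁻¹ ∉ O) :
    Function.Bijective (residueEmbed O h) := by
  constructor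
  · let f : k →+* IsLocalRing.ResidueField O :=
      (IsLocalRing.residue O).comp ((algebraMap k K).codRestrict O.toSubring h)
    exact f.injective
  · intro y
    obtain ⟨⟨x, hx⟩, rfl⟩ := IsLocalRing.residue_surjective y
    obtain ⟨a, ha⟩ := hO x hx
    refine ⟨a, (sub_eq_zero.1 ?_).symm⟩
    rw [residueEmbed, ← map_sub, IsLocalRing.residue_eq_zero_iff, IsLocalRing.mem_maximalIdeal, mem_nonunits_iff]
    rintro ⟨u, hu⟩
    have hu' : (u : O) = x - algebraMap k K a := congrArg Subtype.val hu
    have h1 : ((u : O) : K) * ((u⁻¹ : Oˣ) : O) = 1 := congrArg Subtype.val u.mul_inv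
    refine ha (hu' ▸ left_ne_zero_of_mul_eq_one h1) ?_
    rw [← hu', ← eq_inv_of_mul_eq_one_right h1]
    exact ((u⁻¹ : Oˣ) : O).2

/-- Let `k` be a finite extension of `ℚ_p` and `K` an arbitrary field
extension of `k`.  Every birational Galois section `s : Gal_k → Gal_K` has image in the
decomposition subgroup `D_Ō` of a `k`-valuation `Ō` of `Kbar` such that the valuation
subring `Ō ∩ K` of `K` has residue field `k`. -/
theorem birational_section_in_decomposition_group
    (p : ℕ) [Fact p.Prime]
    (k : Type) [Field k] [Algebra ℚ_[p] k] [FiniteDimensional ℚ_[p] k]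
    (K Kbar : Type) [Field K] [Field Kbar]
    [Algebra k K] [Algebra K Kbar] [Algebra k Kbar] [IsScalarTower k K Kbar]
    [IsAlgClosed Kbar] [Algebra.IsAlgebraic K Kbar]
    (s : ((algebraicClosure k Kbar) ≃ₐ[k] (algebraicClosure k Kbar)) →* (Kbar ≃ₐ[K] Kbar))
    (hs_cont : Continuous s)
    (hs_sec : ∀ g, resHom k K Kbar (s g) = g) :
    ∃ (Obar : ValuationSubring Kbar) (hk : ∀ a : k, algebraMap k Kbar a ∈ Obar),
      (∀ g, ∀ x : Kbar, x ∈ Obar ↔ s g x ∈ Obar) ∧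
      Function.Bijective (residueEmbed (Obar.comap (algebraMap K Kbar))
        (fun a => by
          rw [ValuationSubring.mem_comap, ← IsScalarTower.algebraMap_apply k K Kbar]
          exact hk a)) := by
  let := (algebraMap k Kbar).comp (algebraMap ℚ_[p] k) |>.toAlgebra
  have : IsScalarTower ℚ_[p] k Kbar := IsScalarTower.of_algebraMap_eq fun _ => rfl
  have : CharZero Kbar := charZero_of_injective_algebraMap (algebraMap ℚ_[p] Kbar).injective
  have : CharZero k := charZero_of_injective_algebraMap (algebraMap ℚ_[p] k).injective
  have : IsGalois k (algebraicClosure k Kbar) := inferInstance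
  let := MulSemiringAction.compHom Kbar s
  have hact : ∀ (g : algebraicClosure k Kbar ≃ₐ[k] algebraicClosure k Kbar)
      (x : algebraicClosure k Kbar), g • (x : Kbar) = g x := fun g x => by
    conv_rhs => rw [← hs_sec g]
    exact (coe_resHom_apply (s g) x).symm
  let D : LocalAction p _ Kbar := LocalAction.ofGalois (M := algebraicClosure k Kbar) hact
    (fun x => (stabilizer_isOpen_of_isIntegral (K := K) x).preimage hs_cont)
    (fun hn hx => by
      rw [mem_algebraicClosure_iff] at hx ⊢
      exact hx.of_pow (Nat.pos_of_ne_zero hn))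
  obtain ⟨O, hE, hinv, hres⟩ := D.exists_valuationSubring Fact.out
  have hk : ∀ a : k, algebraMap k Kbar a ∈ O := fun a =>
    hE _ ((algebraicClosure k Kbar).algebraMap_mem a)
  refine ⟨O, hk, fun g x => ⟨hinv g x, fun h => ?_⟩, residueEmbed_bijective _ _ fun x hx => ?_⟩
  · have := hinv g⁻¹ _ h
    rwa [show s g x = g • x from rfl, inv_smul_smul] at this
  · obtain ⟨c, hc, hfix, hv⟩ := hres (algebraMap K Kbar x) hx fun σ => (s σ).commutes x
    obtain ⟨a, ha⟩ := (InfiniteGalois.mem_range_algebraMap_iff_fixed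
      (⟨c, hc⟩ : algebraicClosure k Kbar)).2 fun g =>
        Subtype.ext ((hact g ⟨c, hc⟩).symm.trans (hfix g))
    have ha' : algebraMap k Kbar a = c := congrArg Subtype.val ha
    refine ⟨a, fun h0 h => hv.not_ge ?_⟩
    rw [ValuationSubring.mem_comap, map_inv₀, map_sub, ← IsScalarTower.algebraMap_apply, ha',
      ← O.valuation_le_one_iff, map_inv₀] at h
    refine (inv_le_one₀ (zero_lt_iff.2 ((Valuation.ne_zero_iff _).2 ?_))).1 h
    rw [← ha', IsScalarTower.algebraMap_apply k K Kbar, ← map_sub]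
    exact (map_ne_zero _).2 h0
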